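/- Let A be an n-dimensional algebra. (1) If n = 2, then lev(A) = 2 iff A is represented by one of: A_1^α (α ∈ k); A_2; B_2^α (α ∈ k); D_2^{α,β} (α,β ∈ k, α+β ≠ 1); or E_4. (2) If n = 3, then lev(A) = 2 iff A is represented by one of the following structures (the n = 3 instances of the families below): k^{n−2}⋊_α A_1^α (α ∈ k); k^{n−2}⋊_1 A_2; k^{n−2}⋊_0^t B_2^α (α ∈ k); k^{n−2}⋊_0^t D_2^{α,β} (α+β ≠ 1); F^{α,β} ⊕ k^{n−3} for some (α,β) ∈ k²∖{(0,0)}; T_0^{2,(α,β)} for some (α,β) ∈ k²∖{(0,0)}; T_1^{2,(α,β)} for some (α,β) ∈ k²; or k^{n−2}⋊E_4. (3) If n = 4, then lev(A) = 2 iff A is represented by one of: k^{n−2}⋊_α A_1^α; k^{n−2}⋊_1 A_2; k^{n−2}⋊_0^t B_2^α; k^{n−2}⋊_0^t D_2^{α,β} (α+β ≠ 1); F^{α,β} ⊕ k^{n−3} ((α,β) ≠ (0,0)); T_0^{2,(α,β)} ((α,β) ≠ (0,0)); T_1^{2,(α,β)}; T_0^3; or k^{n−2}⋊E_4. (4) If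 n ≥ 5, then lev(A) = 2 iff A is represented by one of: k^{n−2}⋊_α A_1^α; k^{n−2}⋊_1 A_2; k^{n−2}⋊_0^t B_2^α; k^{n−2}⋊_0^t D_2^{α,β} (α+β ≠ 1); F^{α,β} ⊕ k^{n−3} ((α,β) ≠ (0,0)); T_0^{2,(α,β)} ((α,β) ≠ (0,0)); T_1^{2,(α,β)}; T_0^{2,2}; k^{n−2}⋊E_4; or η_2 ⊕ k^{n−5}. -/

import Mathlib

open scoped BigOperators

noncomputable section

/-- The space of `n`-dimensional (nonassociative) algebra structures on `kⁿ`: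
bilinear maps `kⁿ × kⁿ → kⁿ`. -/
abbrev AlgStr (k : Type*) [Field k] (n : ℕ) : Type _ :=
  (Fin n → k) →ₗ[k] (Fin n → k) →ₗ[k] (Fin n → k)

variable {k : Type*} [Field k]

/-- The algebra structure with prescribed structure constants `c`:
`μ(x, y) m = ∑ i, ∑ j, x i * y j * c i j m`. -/
def ofConst {n : ℕ} (c : Fin n → Fin n → Fin n → k) : AlgStr k n :=
  ∑ i, ∑ j,
    ((LinearMap.mul k k).compl₁₂ (LinearMap.proj i) (LinearMap.proj j)).compr₂
      (LinearMap.toSpanSingleton k (Fin n → k) (c i j))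

/-- The structure constants of an algebra structure in the standard basis. -/
def structConst {n : ℕ} (μ : AlgStr k n) : Fin n × Fin n × Fin n → k :=
  fun t => μ (Pi.single t.1 1) (Pi.single t.2.1 1) t.2.2

/-- A subset of `AlgStr k n` is Zariski closed if it is the common zero locus of a
family of polynomials in the structure constants. -/
def IsZariskiClosed {n : ℕ} (S : Set (AlgStr k n)) : Prop :=
  ∃ P : Set (MvPolynomial (Fin n × Fin n × Fin n) k),
    ∀ μ : AlgStr k n, μ ∈ S ↔ ∀ p ∈ P, MvPolynomial.eval (structConst μ) p = 0

/-- The action of `GL(V)` on algebra structures: `(g • μ)(x,y) = g (μ (g⁻¹ x) (g⁻¹ y))`. -/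
def transport {n : ℕ} (g : (Fin n → k) ≃ₗ[k] (Fin n → k)) (μ : AlgStr k n) :
    AlgStr k n :=
  ((μ.comp g.symm.toLinearMap).compl₂ g.symm.toLinearMap).compr₂ g.toLinearMap

/-- The `GL(V)`-orbit of an algebra structure; two structures represent isomorphic
algebras iff they lie in the same orbit. -/
def orbit {n : ℕ} (μ : AlgStr k n) : Set (AlgStr k n) :=
  {χ | ∃ g : (Fin n → k) ≃ₗ[k] (Fin n → k), transport g μ = χ}

/-- The Zariski closure of a set of algebra structures. -/
def zclosure {n : ℕ} (S : Set (AlgStr k n)) : Set (AlgStr k n) :=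
  {χ | ∀ T : Set (AlgStr k n), IsZariskiClosed T → S ⊆ T → χ ∈ T}

/-- `μ` degenerates to `χ` if `χ` lies in the Zariski closure of the orbit of `μ`. -/
def degenerates {n : ℕ} (μ χ : AlgStr k n) : Prop :=
  χ ∈ zclosure (orbit μ)

/-- A proper degeneration: additionally `χ` is not isomorphic to `μ`. -/
def properlyDegenerates {n : ℕ} (μ χ : AlgStr k n) : Prop :=
  degenerates μ χ ∧ χ ∉ orbit μ

/-- There is a chain of `m` proper degenerations starting at `μ`. -/
def hasChain {n : ℕ} (μ : AlgStr k n) (m : ℕ) : Prop :=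
  ∃ c : ℕ → AlgStr k n, c m = μ ∧ ∀ i < m, properlyDegenerates (c (i + 1)) (c i)

/-- The level of `μ` is `m`: there is a chain of `m` proper degenerations starting
at `μ` but no chain of `m+1`. -/
def levelIs {n : ℕ} (μ : AlgStr k n) (m : ℕ) : Prop :=
  hasChain μ m ∧ ¬ hasChain μ (m + 1)

/-- The subalgebra generated by a set `s`. -/
def subalgGen {n : ℕ} (μ : AlgStr k n) (s : Set (Fin n → k)) :
    Submodule k (Fin n → k) :=
  sInf {W | s ⊆ W ∧ ∀ x ∈ W, ∀ y ∈ W, μ x y ∈ W}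

/-- The generation type of `μ` is `m`: `m` is the maximal dimension of a
one-generated subalgebra. -/
def genType {n : ℕ} (μ : AlgStr k n) (m : ℕ) : Prop :=
  IsGreatest {d : ℕ | ∃ a : Fin n → k, Module.finrank k ↥(subalgGen μ {a}) = d} m

/-- A standard `1`-generated algebra: it admits a grading `A = ⊕_{i ≥ 1} A_i` with
`dim A_1 = 1`, `A_i A_j ⊆ A_{i+j}`, generated by `A_1` as an algebra. -/
def StandardOneGenerated {m : ℕ} (μ : AlgStr k m) : Prop :=
  ∃ A : ℕ → Submodule k (Fin m → k),
    A 0 = ⊥ ∧ DirectSum.IsInternal A ∧ Module.finrank k ↥(A 1) = 1 ∧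
    (∀ i j : ℕ, ∀ x ∈ A i, ∀ y ∈ A j, μ x y ∈ A (i + j)) ∧
    subalgGen μ ((A 1 : Submodule k (Fin m → k)) : Set (Fin m → k)) = ⊤

/-- Extension by zero of coordinates, `kᵐ → kⁿ`. -/
def inclMap (k : Type*) [Field k] {m n : ℕ} (h : m ≤ n) :
    (Fin m → k) →ₗ[k] (Fin n → k) where
  toFun x i := if hi : (i : ℕ) < m then x ⟨i, hi⟩ else 0
  map_add' x y := by funext i; by_cases hi : (i : ℕ) < m <;> simp [hi]
  map_smul' a x := by funext i; by_cases hi : (i : ℕ) < m <;> simp [hi]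

/-- The `n`-dimensional algebra `B ⊕ k^{n-m}` obtained from an `m`-dimensional
algebra `B` by adjoining a complement with all products zero. -/
def extendZero {m n : ℕ} (h : m ≤ n) (B : AlgStr k m) : AlgStr k n :=
  ((B.comp (LinearMap.funLeft k k (Fin.castLE h))).compl₂
      (LinearMap.funLeft k k (Fin.castLE h))).compr₂ (inclMap k h)

/-- The `i`-th standard basis vector (as a plain function, `0` if `i ≥ n`). -/
def unitVec {k : Type*} [Field k] (n i : ℕ) : Fin n → k :=
  fun j => if (j : ℕ) = i then 1 else 0

/-- Projection onto the coordinate `0` part. -/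
def proj0 (k : Type*) [Field k] (n : ℕ) : (Fin n → k) →ₗ[k] (Fin n → k) :=
  LinearMap.pi fun i => if (i : ℕ) = 0 then LinearMap.proj i else 0

/-- Projection onto the coordinates `≥ 1` part. -/
def projPos (k : Type*) [Field k] (n : ℕ) : (Fin n → k) →ₗ[k] (Fin n → k) :=
  LinearMap.pi fun i => if (i : ℕ) = 0 then 0 else LinearMap.proj i

/-- The Inönü–Wigner contraction of `μ` with respect to the `1`-dimensional
subalgebra spanned by the first basis vector (the remaining coordinates form the
square-zero ideal part). -/
def IWcontract0 {n : ℕ} (μ : AlgStr k n) : AlgStr k n :=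
  ((μ.comp (projPos k n)).compl₂ (proj0 k n)).compr₂ (projPos k n) +
    ((μ.comp (proj0 k n)).compl₂ (projPos k n)).compr₂ (projPos k n) +
    (μ.comp (proj0 k n)).compl₂ (proj0 k n)

/-- The annihilator of an algebra structure. -/
def annihilator {n : ℕ} (μ : AlgStr k n) : Submodule k (Fin n → k) where
  carrier := {a | ∀ b, μ a b = 0 ∧ μ b a = 0}
  add_mem' := by
    intro a b ha hb
    intro c
    constructor
    · rw [map_add, LinearMap.add_apply, (ha c).1, (hb c).1, add_zero]
    · rw [map_add, (ha c).2, (hb c).2, add_zero]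
  zero_mem' := by
    intro b
    constructor
    · rw [map_zero, LinearMap.zero_apply]
    · rw [map_zero]
  smul_mem' := by
    intro t a ha b
    constructor
    · rw [map_smul, LinearMap.smul_apply, (ha b).1, smul_zero]
    · rw [map_smul, (ha b).2, smul_zero]

/-- `μ` has a square-zero (two-sided) ideal of codimension `1`. -/
def hasSqZeroIdealCodim1 {n : ℕ} (μ : AlgStr k n) : Prop :=
  ∃ I : Submodule k (Fin n → k), Module.finrank k ↥I = n - 1 ∧
    (∀ x ∈ I, ∀ y : Fin n → k, μ x y ∈ I ∧ μ y x ∈ I) ∧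
    ∀ x ∈ I, ∀ y ∈ I, μ x y = 0

/-- `a` (viewed as the sequence of parts `a 0 ≥ a 1 ≥ …`) is a partition of `N`. -/
def IsPartitionOf (a : ℕ → ℕ) (N : ℕ) : Prop :=
  (∀ i j : ℕ, i ≤ j → a j ≤ a i) ∧
    ∃ l : ℕ, (∀ i, l ≤ i → a i = 0) ∧ ∑ i ∈ Finset.range l, a i = N

/-- The dominance order on partitions: `a ⪰ b`. -/
def Dominates (a b : ℕ → ℕ) : Prop :=
  ∀ m : ℕ, ∑ i ∈ Finset.range m, b i ≤ ∑ i ∈ Finset.range m, a i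

/-- `a` is the Jordan type of the matrix `M` at the eigenvalue `lam`:
`a` is a partition of the generalized eigenspace dimension, and the parts of `a`
are the sizes of the Jordan blocks of `M` with eigenvalue `lam`, expressed via
the ranks of powers of `M - lam • 1`. -/
def IsJordanTypeAt {N : ℕ} (M : Matrix (Fin N) (Fin N) k) (lam : k) (a : ℕ → ℕ) :
    Prop :=
  IsPartitionOf a (N - ((M - lam • (1 : Matrix (Fin N) (Fin N) k)) ^ N).rank) ∧
    ∀ p : ℕ, ((M - lam • (1 : Matrix (Fin N) (Fin N) k)) ^ p).rank =
      N - ∑ i ∈ Finset.range N, min (a i) p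

/-- The full specter of `M` is `{(lam i, a i)}`: the `lam i` are pairwise distinct,
each `a i` is the (nonempty) Jordan type of `M` at `lam i`, and every eigenvalue
of `M` occurs among the `lam i`. -/
def IsFullSpecter {N : ℕ} (M : Matrix (Fin N) (Fin N) k) {l : ℕ}
    (lam : Fin l → k) (a : Fin l → ℕ → ℕ) : Prop :=
  Function.Injective lam ∧
    (∀ i, IsJordanTypeAt M (lam i) (a i) ∧ a i 0 ≠ 0) ∧
    ∀ c : k, (∃ v : Fin N → k, v ≠ 0 ∧ M.mulVec v = c • v) → ∃ i, lam i = c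

/-- There is a chain of `len` strict dominance steps of partitions of `N`
starting (on top) at `a`. -/
def partChain (a : ℕ → ℕ) (N len : ℕ) : Prop :=
  ∃ c : ℕ → ℕ → ℕ, (∀ i ≤ len, IsPartitionOf (c i) N) ∧ c len = a ∧
    ∀ i < len, Dominates (c (i + 1)) (c i) ∧ c (i + 1) ≠ c i

/-- The structure `T_α^M ∈ A_{m+1}`. -/
def Tstr {m : ℕ} (α : k) (M : Matrix (Fin m) (Fin m) k) : AlgStr k (m + 1) :=
  ofConst fun i j mm =>
    if hi : i = 0 then
      if hj : j = 0 then (if mm = 0 then α else 0)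
      else if hmm : mm = 0 then 0 else M (mm.pred hmm) (j.pred hj)
    else if hj : j = 0 then
      if hmm : mm = 0 then 0 else (if i = mm then α else 0) - M (mm.pred hmm) (i.pred hi)
    else 0

/-- The trivial singular extension `k^{n-2} ⋊_{(L₁,R₁,L₂,R₂)} χ` of the
`2`-dimensional algebra `χ` given by the coefficients `c11, c12, c21, d12, d21, d22`
(with `χ(e₁,e₁) = c11·e₁ + e₂`, `χ(e₁,e₂) = c12·e₁ + d12·e₂`,
`χ(e₂,e₁) = c21·e₁ + d21·e₂`, `χ(e₂,e₂) = d22·e₂`). -/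
def sdExt {m : ℕ} (c11 c12 c21 d12 d21 d22 : k)
    (L1 R1 L2 R2 : Matrix (Fin m) (Fin m) k) : AlgStr k (m + 2) :=
  ofConst fun i j mm =>
    if hi0 : (i : ℕ) = 0 then
      if hj0 : (j : ℕ) = 0 then
        if (mm : ℕ) = 0 then c11 else if (mm : ℕ) = 1 then 1 else 0
      else if hj1 : (j : ℕ) = 1 then
        if (mm : ℕ) = 0 then c12 else if (mm : ℕ) = 1 then d12 else 0
      else if hmm : (mm : ℕ) < 2 then 0
      else L1 ⟨(mm : ℕ) - 2, by have := mm.isLt; omega⟩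
             ⟨(j : ℕ) - 2, by have := j.isLt; omega⟩
    else if hi1 : (i : ℕ) = 1 then
      if hj0 : (j : ℕ) = 0 then
        if (mm : ℕ) = 0 then c21 else if (mm : ℕ) = 1 then d21 else 0
      else if hj1 : (j : ℕ) = 1 then
        if (mm : ℕ) = 1 then d22 else 0
      else if hmm : (mm : ℕ) < 2 then 0
      else L2 ⟨(mm : ℕ) - 2, by have := mm.isLt; omega⟩
             ⟨(j : ℕ) - 2, by have := j.isLt; omega⟩
    else
      if hj0 : (j : ℕ) = 0 then
        if hmm : (mm : ℕ) < 2 then 0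
        else R1 ⟨(mm : ℕ) - 2, by have := mm.isLt; omega⟩
               ⟨(i : ℕ) - 2, by have := i.isLt; omega⟩
      else if hj1 : (j : ℕ) = 1 then
        if hmm : (mm : ℕ) < 2 then 0
        else R2 ⟨(mm : ℕ) - 2, by have := mm.isLt; omega⟩
               ⟨(i : ℕ) - 2, by have := i.isLt; omega⟩
      else 0

/-! Concrete algebra structures, given by multiplication tables on the standard
basis `e₁, …, eₙ` (0-indexed as `0, …, n-1`); all unspecified products are zero. -/

/-- `A₃ ⊕ k^{n-2}`: `e₁e₁ = e₂`. -/
def A3str (n : ℕ) : AlgStr k n :=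
  ofConst fun i j m => if (i : ℕ) = 0 ∧ (j : ℕ) = 0 ∧ (m : ℕ) = 1 then 1 else 0

/-- `n₃ ⊕ k^{n-3}`: `e₁e₂ = e₃`, `e₂e₁ = -e₃`. -/
def n3str (n : ℕ) : AlgStr k n :=
  ofConst fun i j m =>
    if (i : ℕ) = 0 ∧ (j : ℕ) = 1 ∧ (m : ℕ) = 2 then 1
    else if (i : ℕ) = 1 ∧ (j : ℕ) = 0 ∧ (m : ℕ) = 2 then -1
    else 0

/-- `p⁻`: `e₁eᵢ = eᵢ`, `eᵢe₁ = -eᵢ` for `i ≥ 2`. -/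
def pminusStr (n : ℕ) : AlgStr k n :=
  ofConst fun i j m =>
    if (i : ℕ) = 0 ∧ 1 ≤ (j : ℕ) ∧ m = j then 1
    else if 1 ≤ (i : ℕ) ∧ (j : ℕ) = 0 ∧ m = i then -1
    else 0

/-- `ν^α`: `e₁e₁ = e₁`, `e₁eᵢ = α eᵢ`, `eᵢe₁ = (1-α) eᵢ` for `i ≥ 2`. -/
def nuStr (n : ℕ) (α : k) : AlgStr k n :=
  ofConst fun i j m =>
    if (i : ℕ) = 0 then
      if (j : ℕ) = 0 then (if (m : ℕ) = 0 then 1 else 0)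
      else (if m = j then α else 0)
    else if (j : ℕ) = 0 then (if m = i then 1 - α else 0)
    else 0

/-- `k^{n-2} ⋊ E₄`: `e₁e₁ = e₁`, `e₁e₂ = e₁ + e₂`, `e₂e₂ = e₂`,
`e₁eᵢ = eᵢ`, `eᵢe₂ = eᵢ` for `i ≥ 3`.  (For `n = 2` this is `E₄`.) -/
def kE4str (n : ℕ) : AlgStr k n :=
  ofConst fun i j m =>
    if (i : ℕ) = 0 ∧ (j : ℕ) = 0 then (if (m : ℕ) = 0 then 1 else 0)
    else if (i : ℕ) = 0 ∧ (j : ℕ) = 1 then (if (m : ℕ) = 0 ∨ (m : ℕ) = 1 then 1 else 0)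
    else if (i : ℕ) = 1 ∧ (j : ℕ) = 1 then (if (m : ℕ) = 1 then 1 else 0)
    else if (i : ℕ) = 0 ∧ 2 ≤ (j : ℕ) then (if m = j then 1 else 0)
    else if 2 ≤ (i : ℕ) ∧ (j : ℕ) = 1 then (if m = i then 1 else 0)
    else 0

/-- `T₀^{2,(α,β)}`: `e₁e₂ = αe₂ + e₃`, `e₂e₁ = -αe₂ - e₃`,
`e₁eᵢ = βeᵢ`, `eᵢe₁ = -βeᵢ` for `i ≥ 3`. -/
def T02str (n : ℕ) (α β : k) : AlgStr k n :=
  ofConst fun i j m =>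
    if (i : ℕ) = 0 ∧ (j : ℕ) = 1 then
      (if (m : ℕ) = 1 then α else if (m : ℕ) = 2 then 1 else 0)
    else if (i : ℕ) = 1 ∧ (j : ℕ) = 0 then
      (if (m : ℕ) = 1 then -α else if (m : ℕ) = 2 then -1 else 0)
    else if (i : ℕ) = 0 ∧ 2 ≤ (j : ℕ) then (if m = j then β else 0)
    else if 2 ≤ (i : ℕ) ∧ (j : ℕ) = 0 then (if m = i then -β else 0)
    else 0

/-- `T₁^{2,(α,β)}`: `e₁e₁ = e₁`, `e₁e₂ = αe₂ + e₃`, `e₂e₁ = (1-α)e₂ - e₃`,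
`e₁eᵢ = βeᵢ`, `eᵢe₁ = (1-β)eᵢ` for `i ≥ 3`. -/
def T12str (n : ℕ) (α β : k) : AlgStr k n :=
  ofConst fun i j m =>
    if (i : ℕ) = 0 ∧ (j : ℕ) = 0 then (if (m : ℕ) = 0 then 1 else 0)
    else if (i : ℕ) = 0 ∧ (j : ℕ) = 1 then
      (if (m : ℕ) = 1 then α else if (m : ℕ) = 2 then 1 else 0)
    else if (i : ℕ) = 1 ∧ (j : ℕ) = 0 then
      (if (m : ℕ) = 1 then 1 - α else if (m : ℕ) = 2 then -1 else 0)
    else if (i : ℕ) = 0 ∧ 2 ≤ (j : ℕ) then (if m = j then β else 0)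
    else if 2 ≤ (i : ℕ) ∧ (j : ℕ) = 0 then (if m = i then 1 - β else 0)
    else 0

/-- `T₀³`: `e₁e₂ = e₃`, `e₂e₁ = -e₃`, `e₁e₃ = e₄`, `e₃e₁ = -e₄`. -/
def T03str (n : ℕ) : AlgStr k n :=
  ofConst fun i j m =>
    if (i : ℕ) = 0 ∧ (j : ℕ) = 1 ∧ (m : ℕ) = 2 then 1
    else if (i : ℕ) = 1 ∧ (j : ℕ) = 0 ∧ (m : ℕ) = 2 then -1
    else if (i : ℕ) = 0 ∧ (j : ℕ) = 2 ∧ (m : ℕ) = 3 then 1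
    else if (i : ℕ) = 2 ∧ (j : ℕ) = 0 ∧ (m : ℕ) = 3 then -1
    else 0

/-- `T₀^{2,2}`: `e₁e₂ = e₃`, `e₂e₁ = -e₃`, `e₁e₄ = e₅`, `e₄e₁ = -e₅`. -/
def T022str (n : ℕ) : AlgStr k n :=
  ofConst fun i j m =>
    if (i : ℕ) = 0 ∧ (j : ℕ) = 1 ∧ (m : ℕ) = 2 then 1
    else if (i : ℕ) = 1 ∧ (j : ℕ) = 0 ∧ (m : ℕ) = 2 then -1
    else if (i : ℕ) = 0 ∧ (j : ℕ) = 3 ∧ (m : ℕ) = 4 then 1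
    else if (i : ℕ) = 3 ∧ (j : ℕ) = 0 ∧ (m : ℕ) = 4 then -1
    else 0

/-- `η_l ⊕ k^{n-2l-1}`: `e_{2i-1}e_{2i} = e_{2l+1}`, `e_{2i}e_{2i-1} = -e_{2l+1}`
for `1 ≤ i ≤ l`. -/
def etaStr (n l : ℕ) : AlgStr k n :=
  ofConst fun i j m =>
    if (i : ℕ) % 2 = 0 ∧ (j : ℕ) = (i : ℕ) + 1 ∧ (i : ℕ) < 2 * l ∧ (m : ℕ) = 2 * l then 1
    else if (j : ℕ) % 2 = 0 ∧ (i : ℕ) = (j : ℕ) + 1 ∧ (j : ℕ) < 2 * l ∧ (m : ℕ) = 2 * l then -1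
    else 0

/-- `F^{α,β} ⊕ k^{n-3}`: `e₁e₁ = e₃`, `e₁e₂ = αe₃`, `e₂e₁ = βe₃`. -/
def FabStr (n : ℕ) (α β : k) : AlgStr k n :=
  ofConst fun i j m =>
    if (i : ℕ) = 0 ∧ (j : ℕ) = 0 ∧ (m : ℕ) = 2 then 1
    else if (i : ℕ) = 0 ∧ (j : ℕ) = 1 ∧ (m : ℕ) = 2 then α
    else if (i : ℕ) = 1 ∧ (j : ℕ) = 0 ∧ (m : ℕ) = 2 then β
    else 0

/-- `k^{n-2} ⋊ A₃`: `e₁e₁ = e₂`, `e₁eᵢ = eᵢ`, `eᵢe₁ = -eᵢ` for `i ≥ 3`. -/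
def kA3str (n : ℕ) : AlgStr k n :=
  ofConst fun i j m =>
    if (i : ℕ) = 0 ∧ (j : ℕ) = 0 ∧ (m : ℕ) = 1 then 1
    else if (i : ℕ) = 0 ∧ 2 ≤ (j : ℕ) then (if m = j then 1 else 0)
    else if 2 ≤ (i : ℕ) ∧ (j : ℕ) = 0 then (if m = i then -1 else 0)
    else 0

/-- `k² ⋊_{α,β} A₃ ⊕ k^{n-4}`: `e₁e₁ = e₂`, `e₁e₃ = αe₄`, `e₃e₁ = βe₄`. -/
def k2A3str (n : ℕ) (α β : k) : AlgStr k n :=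
  ofConst fun i j m =>
    if (i : ℕ) = 0 ∧ (j : ℕ) = 0 ∧ (m : ℕ) = 1 then 1
    else if (i : ℕ) = 0 ∧ (j : ℕ) = 2 ∧ (m : ℕ) = 3 then α
    else if (i : ℕ) = 2 ∧ (j : ℕ) = 0 ∧ (m : ℕ) = 3 then β
    else 0

/-- `k^{n-2} ⋊_α A₁^α`: `e₁e₁ = e₁ + e₂`, `e₁eᵢ = αeᵢ`, `eᵢe₁ = (1-α)eᵢ` for `i ≥ 2`. -/
def kA1str (n : ℕ) (α : k) : AlgStr k n :=
  ofConst fun i j m =>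
    if (i : ℕ) = 0 ∧ (j : ℕ) = 0 then (if (m : ℕ) = 0 ∨ (m : ℕ) = 1 then 1 else 0)
    else if (i : ℕ) = 0 then (if m = j then α else 0)
    else if (j : ℕ) = 0 then (if m = i then 1 - α else 0)
    else 0

/-- `k^{n-2} ⋊₁ A₂`: `e₁e₁ = e₂`, `e₁eᵢ = eᵢ`, `eᵢe₁ = -eᵢ` for `i ≥ 2`. -/
def kA2str (n : ℕ) : AlgStr k n :=
  ofConst fun i j m =>
    if (i : ℕ) = 0 ∧ (j : ℕ) = 0 then (if (m : ℕ) = 1 then 1 else 0)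
    else if (i : ℕ) = 0 then (if m = j then 1 else 0)
    else if (j : ℕ) = 0 then (if m = i then -1 else 0)
    else 0

/-- `k^{n-2} ⋊₀ᵗ B₂^α`: `e₁eᵢ = αeᵢ`, `eᵢe₁ = (1-α)eᵢ` for `i ≥ 2`. -/
def ktB2str (n : ℕ) (α : k) : AlgStr k n :=
  ofConst fun i j m =>
    if (i : ℕ) = 0 ∧ 1 ≤ (j : ℕ) then (if m = j then α else 0)
    else if 1 ≤ (i : ℕ) ∧ (j : ℕ) = 0 then (if m = i then 1 - α else 0)
    else 0

/-- `k^{n-2} ⋊₀ᵗ D₂^{α,β}`: `e₁e₁ = e₁`, `e₁eᵢ = αeᵢ`, `eᵢe₁ = βeᵢ` for `i ≥ 2`. -/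
def ktD2str (n : ℕ) (α β : k) : AlgStr k n :=
  ofConst fun i j m =>
    if (i : ℕ) = 0 ∧ (j : ℕ) = 0 then (if (m : ℕ) = 0 then 1 else 0)
    else if (i : ℕ) = 0 then (if m = j then α else 0)
    else if (j : ℕ) = 0 then (if m = i then β else 0)
    else 0

section LinearAlgebra

variable {V : Type*} [AddCommGroup V] [Module k V]

theorem exists_dual_family {ι : Type*} [Finite ι] [DecidableEq ι] {v : ι → V}
    (hv : LinearIndependent k v) :
    ∃ φ : ι → V →ₗ[k] k, ∀ i j, φ i (v j) = if i = j then 1 else 0 := by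
  have := Fintype.ofFinite ι
  obtain ⟨g, hg⟩ := (Fintype.linearCombination k v).exists_leftInverse_of_injective
    (LinearMap.ker_eq_bot.2 hv.fintypeLinearCombination_injective)
  refine ⟨fun i => LinearMap.proj i ∘ₗ g, fun i j => ?_⟩
  have h := LinearMap.congr_fun hg (Pi.single j 1)
  simp only [LinearMap.comp_apply, Fintype.linearCombination_apply_single, one_smul,
    LinearMap.id_apply] at h
  simp [h, Pi.single_apply]

theorem surjective_pi_of_linearIndependent {ι : Type*} [Finite ι] {φ : ι → V →ₗ[k] k}
    (hφ : LinearIndependent k φ) : Function.Surjective (LinearMap.pi φ) := by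
  classical
  have := Fintype.ofFinite ι
  rw [← LinearMap.range_eq_top]
  by_contra h
  obtain ⟨f, hf0, hf⟩ := Submodule.exists_le_ker_of_lt_top _ (lt_top_iff_ne_top.2 h)
  apply hf0
  have key : ∑ i, f (Pi.single i 1) • φ i = 0 := by
    ext x
    have hx : f (LinearMap.pi φ x) = 0 := hf ⟨x, rfl⟩
    rw [LinearMap.zero_apply, ← hx, LinearMap.pi_apply_eq_sum_univ f]
    simp only [LinearMap.coe_sum, Finset.sum_apply, LinearMap.smul_apply, LinearMap.pi_apply,
      smul_eq_mul]
    refine Finset.sum_congr rfl fun i _ => ?_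
    rw [mul_comm]
    congr 2; ext j; simp [Pi.single_apply, eq_comm]
  have := Fintype.linearIndependent_iff.1 hφ _ key
  ext i
  simpa using this i

theorem exists_dual_vectors {ι : Type*} [Finite ι] [DecidableEq ι] {φ : ι → V →ₗ[k] k}
    (hφ : LinearIndependent k φ) :
    ∃ v : ι → V, ∀ i j, φ i (v j) = if i = j then 1 else 0 := by
  choose v hv using fun j => surjective_pi_of_linearIndependent hφ (Pi.single j 1)
  refine ⟨v, fun i j => ?_⟩
  have := congr_fun (hv j) i
  simpa [Pi.single_apply] using this

theorem exists_equiv_intertwining [FiniteDimensional k V] {X Y : Type*} [AddCommGroup X]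
    [Module k X] [FiniteDimensional k X] [AddCommGroup Y] [Module k Y] [FiniteDimensional k Y]
    {L L' : X →ₗ[k] V} {A A' : V →ₗ[k] Y} (hL : Function.Injective L)
    (hL' : Function.Injective L') (hA : Function.Surjective A) (hA' : Function.Surjective A')
    (h : A ∘ₗ L = A' ∘ₗ L') :
    ∃ g : V ≃ₗ[k] V, (∀ x, A' (g x) = A x) ∧ ∀ x, g (L x) = L' x := by
  have compl : ∀ (L : X →ₗ[k] V) (A : V →ₗ[k] Y), Function.Injective L → Function.Surjective A →
      ∃ C : Submodule k V, (∀ x ∈ C, A x = 0) ∧ (∀ x, A x = 0 → ∃ a, ∃ c ∈ C, x = L a + c) ∧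
        (∀ a, L a ∈ C → a = 0) ∧
        Module.finrank k (LinearMap.ker (A ∘ₗ L)) + Module.finrank k C + Module.finrank k Y =
          Module.finrank k V := by
    intro L A hL hA
    obtain ⟨C₀, hC₀⟩ := Submodule.exists_isCompl
      ((LinearMap.range L).comap (LinearMap.ker A).subtype)
    refine ⟨C₀.map (LinearMap.ker A).subtype, ?_, ?_, ?_, ?_⟩
    · rintro _ ⟨x, -, rfl⟩
      exact x.2
    · intro x hx
      have : (⟨x, hx⟩ : LinearMap.ker A) ∈
          (LinearMap.range L).comap (LinearMap.ker A).subtype ⊔ C₀ := by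
        rw [hC₀.sup_eq_top]; trivial
      obtain ⟨y, ⟨a, ha⟩, c, hc, hyc⟩ := Submodule.mem_sup.1 this
      refine ⟨a, c, ⟨c, hc, rfl⟩, ?_⟩
      have := congr_arg Subtype.val hyc
      simp only [Submodule.coe_add] at this
      rw [ha, Submodule.subtype_apply, this]
    · rintro a ⟨c, hc, hca⟩
      have : c ∈ (LinearMap.range L).comap (LinearMap.ker A).subtype ⊓ C₀ := ⟨⟨a, hca.symm⟩, hc⟩
      rw [hC₀.inf_eq_bot] at this
      have hc0 : c = 0 := by simpa using this
      apply hL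
      rw [← hca, hc0]; simp
    · have h1 := Submodule.finrank_add_eq_of_isCompl hC₀
      have h2 := A.finrank_range_add_finrank_ker
      rw [LinearMap.range_eq_top.2 hA, finrank_top] at h2
      have h3 : Module.finrank k (C₀.map (LinearMap.ker A).subtype) = Module.finrank k C₀ :=
        (Submodule.equivMapOfInjective _ (Submodule.injective_subtype _) C₀).finrank_eq.symm
      have h4 : Module.finrank k (LinearMap.ker (A ∘ₗ L)) =
          Module.finrank k ((LinearMap.range L).comap (LinearMap.ker A).subtype) := by
        have hm : (LinearMap.ker (A ∘ₗ L)).map L =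
            ((LinearMap.range L).comap (LinearMap.ker A).subtype).map
              (LinearMap.ker A).subtype := by
          ext x
          constructor
          · rintro ⟨a, ha, rfl⟩
            exact ⟨⟨L a, ha⟩, ⟨a, rfl⟩, rfl⟩
          · rintro ⟨⟨y, hy⟩, ⟨a, ha⟩, rfl⟩
            refine ⟨a, ?_, ha⟩
            have : L a = y := ha
            simpa [this] using hy
        rw [(Submodule.equivMapOfInjective L hL (LinearMap.ker (A ∘ₗ L))).finrank_eq,
          (Submodule.equivMapOfInjective (LinearMap.ker A).subtype
            (Submodule.injective_subtype _) _).finrank_eq, hm]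
      omega
  obtain ⟨C, hC1, hC2, hC3, hC4⟩ := compl L A hL hA
  obtain ⟨C', hC1', hC2', hC3', hC4'⟩ := compl L' A' hL' hA'
  rw [← h] at hC4'
  obtain ⟨i⟩ : Nonempty (C ≃ₗ[k] C') := ⟨LinearEquiv.ofFinrankEq _ _ (by omega)⟩
  obtain ⟨s, hs⟩ := A'.exists_rightInverse_of_surjective (LinearMap.range_eq_top.2 hA')
  have hs' : ∀ y, A' (s y) = y := fun y => LinearMap.congr_fun hs y
  have hinj : Function.Injective (L.coprod C.subtype) := by
    rw [← LinearMap.ker_eq_bot, LinearMap.ker_eq_bot']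
    rintro ⟨a, c⟩ hac
    simp only [LinearMap.coprod_apply, Submodule.subtype_apply] at hac
    have ha : a = 0 := hC3 a (by rw [eq_neg_of_add_eq_zero_left hac]; exact C.neg_mem c.2)
    subst ha
    simpa using hac
  obtain ⟨D, hD⟩ := Submodule.exists_isCompl (LinearMap.range (L.coprod C.subtype))
  let e := (LinearEquiv.ofInjective _ hinj)
  let Φ := Submodule.prodEquivOfIsCompl _ _ hD
  let g₁ : LinearMap.range (L.coprod C.subtype) →ₗ[k] V :=
    (L'.coprod (C'.subtype ∘ₗ i.toLinearMap)) ∘ₗ e.symm.toLinearMap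
  let g₀ : V →ₗ[k] V := (g₁.coprod (s ∘ₗ A ∘ₗ D.subtype)) ∘ₗ Φ.symm.toLinearMap
  have hg1 : ∀ a c, g₀ (L a + (c : C)) = L' a + (i c : V) := by
    intro a c
    have : L a + (c : V) = Φ (e (a, c), 0) := by simp [Φ, e]
    simp only [g₀, this, LinearMap.comp_apply, LinearEquiv.coe_coe, LinearEquiv.symm_apply_apply,
      LinearMap.coprod_apply, g₁, map_zero, add_zero]
    rfl
  have hg2 : ∀ d : D, g₀ d = s (A d) := by
    intro d
    have : (d : V) = Φ (0, d) := by simp [Φ]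
    simp only [g₀]
    rw [this]
    simp only [LinearMap.comp_apply, LinearEquiv.coe_coe, LinearEquiv.symm_apply_apply,
      LinearMap.coprod_apply, map_zero, zero_add]
    simp [Φ]
  have hgA : ∀ x, A' (g₀ x) = A x := by
    intro x
    obtain ⟨⟨y, d⟩, rfl⟩ := Φ.surjective x
    obtain ⟨⟨a, c⟩, rfl⟩ := e.surjective y
    have : Φ (e (a, c), d) = (L a + (c : V)) + d := by simp [Φ, e]
    rw [this, map_add, hg1, hg2, map_add, map_add, map_add, map_add, hs', hC1 _ c.2,
      hC1' _ (i c).2]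
    have := LinearMap.congr_fun h a
    simp only [LinearMap.comp_apply] at this
    rw [this]
  have hgi : Function.Injective g₀ := by
    rw [← LinearMap.ker_eq_bot, LinearMap.ker_eq_bot']
    intro x hx
    have hAx : A x = 0 := by rw [← hgA, hx, map_zero]
    obtain ⟨a, c, hc, rfl⟩ := hC2 x hAx
    have h1 := hg1 a ⟨c, hc⟩
    rw [hx] at h1
    have ha : a = 0 := hC3' a (by
      rw [eq_neg_of_add_eq_zero_left h1.symm]; exact C'.neg_mem (i ⟨c, hc⟩).2)
    subst ha
    simp only [map_zero, zero_add] at h1 ⊢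
    have : i ⟨c, hc⟩ = 0 := Subtype.ext h1.symm
    have := i.map_eq_zero_iff.1 this
    simpa using this
  refine ⟨LinearEquiv.ofInjectiveEndo g₀ hgi, fun x => hgA x, fun x => ?_⟩
  have := hg1 x 0
  simpa using this

theorem exists_equiv_of_pairing_eq [FiniteDimensional k V] {r s : ℕ} {φ φ' : Fin r → V →ₗ[k] k}
    {v v' : Fin s → V} (hφ : LinearIndependent k φ) (hφ' : LinearIndependent k φ')
    (hv : LinearIndependent k v) (hv' : LinearIndependent k v')
    (h : ∀ i j, φ i (v j) = φ' i (v' j)) :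
    ∃ g : V ≃ₗ[k] V, (∀ i x, φ' i (g x) = φ i x) ∧ ∀ j, g (v j) = v' j := by
  obtain ⟨g, h1, h2⟩ := exists_equiv_intertwining
    hv.fintypeLinearCombination_injective hv'.fintypeLinearCombination_injective
    (surjective_pi_of_linearIndependent hφ) (surjective_pi_of_linearIndependent hφ') (by
      refine LinearMap.pi_ext' fun j => LinearMap.ext_ring (funext fun i => ?_)
      simpa using h i j)
  refine ⟨g, fun i x => congr_fun (h1 x) i, fun j => ?_⟩
  simpa using h2 (Pi.single j 1)

end LinearAlgebra

section PolyCurves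

variable {V W X : Type*} [AddCommGroup V] [Module k V] [AddCommGroup W] [Module k W]
  [AddCommGroup X] [Module k X]

/-- Curves in a vector space which are polynomial in the parameter. -/
inductive PolyCurve : (k → V) → Prop
  | const (v : V) : PolyCurve fun _ => v
  | smul {F : k → V} : PolyCurve F → PolyCurve fun t => t • F t
  | add {F G : k → V} : PolyCurve F → PolyCurve G → PolyCurve fun t => F t + G t

theorem PolyCurve.map {F : k → V} (hF : PolyCurve F) (f : V →ₗ[k] W) :
    PolyCurve fun t => f (F t) := by
  induction hF with
  | const v => exact .const _
  | smul _ ih => simpa only [map_smul] using ih.smul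
  | add _ _ ih₁ ih₂ => simpa only [map_add] using ih₁.add ih₂

theorem PolyCurve.bilin {F : k → V} {G : k → W} (hF : PolyCurve F) (hG : PolyCurve G)
    (b : V →ₗ[k] W →ₗ[k] X) : PolyCurve fun t => b (F t) (G t) := by
  induction hF with
  | const v => exact hG.map (b v)
  | smul _ ih => simpa only [map_smul, LinearMap.smul_apply] using ih.smul
  | add _ _ ih₁ ih₂ => simpa only [map_add, LinearMap.add_apply] using ih₁.add ih₂

theorem PolyCurve.neg {F : k → V} (hF : PolyCurve F) : PolyCurve fun t => -F t :=
  hF.map (-LinearMap.id)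

theorem PolyCurve.sub {F G : k → V} (hF : PolyCurve F) (hG : PolyCurve G) :
    PolyCurve fun t => F t - G t := by
  simpa only [sub_eq_add_neg] using hF.add hG.neg

theorem PolyCurve.id : PolyCurve (k := k) (V := k) fun t => t := by
  simpa using (PolyCurve.const (k := k) (1 : k)).smul

theorem PolyCurve.smul' {f : k → k} {F : k → V} (hf : PolyCurve f) (hF : PolyCurve F) :
    PolyCurve fun t => f t • F t := hf.bilin hF (LinearMap.lsmul k V)

theorem PolyCurve.mul {f g : k → k} (hf : PolyCurve f) (hg : PolyCurve g) :
    PolyCurve fun t => f t * g t := hf.smul' hg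

theorem PolyCurve.pow {f : k → k} (hf : PolyCurve f) (m : ℕ) : PolyCurve fun t => f t ^ m := by
  induction m with
  | zero => simpa using PolyCurve.const (1 : k)
  | succ m ih => simpa only [pow_succ] using ih.mul hf

theorem PolyCurve.exists_polynomial {f : k → k} (hf : PolyCurve f) :
    ∃ p : Polynomial k, ∀ t, f t = p.eval t := by
  induction hf with
  | const v => exact ⟨Polynomial.C v, by simp⟩
  | smul _ ih =>
    obtain ⟨p, hp⟩ := ih
    exact ⟨Polynomial.X * p, by simp [hp]⟩
  | add _ _ ih₁ ih₂ =>
    obtain ⟨p, hp⟩ := ih₁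
    obtain ⟨q, hq⟩ := ih₂
    exact ⟨p + q, by simp [hp, hq]⟩

theorem PolyCurve.mvPolynomial_eval {σ : Type*} {c : k → σ → k} (hc : ∀ i, PolyCurve fun t => c t i)
    (P : MvPolynomial σ k) : PolyCurve fun t => MvPolynomial.eval (c t) P := by
  induction P using MvPolynomial.induction_on with
  | C a => simpa using PolyCurve.const a
  | add p q hp hq => simpa using hp.add hq
  | mul_X p i hp => simpa using hp.mul (hc i)

theorem PolyCurve.eventually_ne {f : k → k} (hf : PolyCurve f) {s : k} (hs : f s ≠ 0) :
    ∀ᶠ t in Filter.cofinite, f t ≠ 0 := by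
  obtain ⟨p, hp⟩ := hf.exists_polynomial
  have hp0 : p ≠ 0 := by
    rintro rfl
    simp [hp] at hs
  rw [Filter.eventually_cofinite]
  refine (Multiset.finite_toSet p.roots).subset fun t ht => ?_
  simp only [not_not, Set.mem_ofPred_eq] at ht ⊢
  rw [Polynomial.mem_roots hp0]
  simpa [Polynomial.IsRoot, hp] using ht

theorem PolyCurve.eq_zero_of_eventually [Infinite k] {F : k → V} (hF : PolyCurve F)
    (h : ∀ᶠ t in Filter.cofinite, F t = 0) (t : k) : F t = 0 := by
  by_contra ht
  obtain ⟨f, hf⟩ : ∃ f : V →ₗ[k] k, f (F t) ≠ 0 := by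
    by_contra! h'
    exact ht ((Module.forall_dual_apply_eq_zero_iff k _).1 h')
  obtain ⟨s, h1, h2⟩ := (h.and ((hF.map f).eventually_ne hf)).exists
  exact h2 (by rw [h1, map_zero])

theorem eventually_cofinite_ne {α : Type*} (a : α) : ∀ᶠ t in Filter.cofinite, t ≠ a := by
  simp [Filter.eventually_cofinite]

theorem PolyCurve.eq_zero_of_ne [Infinite k] {F : k → V} (hF : PolyCurve F)
    (h : ∀ t ≠ 0, F t = 0) (t : k) : F t = 0 :=
  hF.eq_zero_of_eventually ((eventually_cofinite_ne 0).mono h) t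

end PolyCurves

section Degenerations

variable {n : ℕ}

theorem transport_apply (g : (Fin n → k) ≃ₗ[k] (Fin n → k)) (μ : AlgStr k n) (x y : Fin n → k) :
    transport g μ x y = g (μ (g.symm x) (g.symm y)) := rfl

theorem mem_orbit_iff {μ χ : AlgStr k n} :
    χ ∈ orbit μ ↔ ∃ h : (Fin n → k) →ₗ[k] (Fin n → k), Function.Injective h ∧
      ∀ x y, h (χ x y) = μ (h x) (h y) := by
  constructor
  · rintro ⟨g, rfl⟩
    exact ⟨g.symm.toLinearMap, g.symm.injective, fun x y => by simp [transport_apply]⟩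
  · rintro ⟨h, hi, hm⟩
    refine ⟨(LinearEquiv.ofInjectiveEndo h hi).symm, ?_⟩
    refine LinearMap.ext₂ fun x y => ?_
    rw [transport_apply, LinearEquiv.symm_apply_eq]
    simp [hm]

theorem mem_orbit_of_equiv {μ χ : AlgStr k n} (g : (Fin n → k) ≃ₗ[k] (Fin n → k))
    (h : ∀ x y, g (χ x y) = μ (g x) (g y)) : χ ∈ orbit μ :=
  mem_orbit_iff.2 ⟨g.toLinearMap, g.injective, h⟩

theorem mem_orbit_iff_equiv {μ χ : AlgStr k n} :
    χ ∈ orbit μ ↔ ∃ g : (Fin n → k) ≃ₗ[k] (Fin n → k), ∀ x y, g (χ x y) = μ (g x) (g y) := by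
  constructor
  · rintro ⟨g, rfl⟩
    exact ⟨g.symm, fun x y => by simp [transport_apply]⟩
  · rintro ⟨g, hg⟩
    exact mem_orbit_of_equiv g hg

theorem mem_orbit_self (μ : AlgStr k n) : μ ∈ orbit μ :=
  mem_orbit_of_equiv (LinearEquiv.refl _ _) fun _ _ => rfl

theorem mem_orbit_symm {μ χ : AlgStr k n} (h : χ ∈ orbit μ) : μ ∈ orbit χ := by
  obtain ⟨g, hg⟩ := mem_orbit_iff_equiv.1 h
  refine mem_orbit_of_equiv g.symm fun x y => ?_
  rw [LinearEquiv.symm_apply_eq, hg]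
  simp

theorem degenerates_iff {μ χ : AlgStr k n} :
    degenerates μ χ ↔ ∀ P : MvPolynomial (Fin n × Fin n × Fin n) k,
      (∀ ν ∈ orbit μ, MvPolynomial.eval (structConst ν) P = 0) →
        MvPolynomial.eval (structConst χ) P = 0 := by
  constructor
  · intro h P hP
    exact h {ν | MvPolynomial.eval (structConst ν) P = 0} ⟨{P}, by simp⟩ hP
  · rintro h T ⟨Ps, hPs⟩ hT
    rw [hPs]
    exact fun p hp => h p fun ν hν => (hPs ν).1 (hT hν) p hp

theorem degenerates_self (μ : AlgStr k n) : degenerates μ μ :=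
  degenerates_iff.2 fun _ h => h _ (mem_orbit_self μ)

theorem exists_degenerates_of_family [Infinite k] {μ : AlgStr k n}
    (h : k → (Fin n → k) →ₗ[k] (Fin n → k)) (F : k → (Fin n → k) → (Fin n → k) → (Fin n → k))
    (hF : ∀ x y, PolyCurve fun t => F t x y) (hi : ∀ t ≠ 0, Function.Injective (h t))
    (hm : ∀ t ≠ 0, ∀ x y, h t (F t x y) = μ (h t x) (h t y)) :
    ∃ χ, degenerates μ χ ∧ ∀ x y, χ x y = F 0 x y := by
  have hadd₁ : ∀ t x x' y, F t (x + x') y = F t x y + F t x' y := fun t x x' y => by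
    rw [← sub_eq_zero]
    refine ((hF _ _).sub ((hF _ _).add (hF _ _))).eq_zero_of_ne (fun t ht => ?_) t
    rw [sub_eq_zero]
    apply hi t ht
    simp [hm t ht]
  have hadd₂ : ∀ t x y y', F t x (y + y') = F t x y + F t x y' := fun t x y y' => by
    rw [← sub_eq_zero]
    refine ((hF _ _).sub ((hF _ _).add (hF _ _))).eq_zero_of_ne (fun t ht => ?_) t
    rw [sub_eq_zero]
    apply hi t ht
    simp [hm t ht]
  have hsmul₁ : ∀ t (c : k) x y, F t (c • x) y = c • F t x y := fun t c x y => by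
    rw [← sub_eq_zero]
    refine ((hF _ _).sub ((hF _ _).map (c • LinearMap.id))).eq_zero_of_ne (fun t ht => ?_) t
    rw [sub_eq_zero]
    apply hi t ht
    simp [hm t ht]
  have hsmul₂ : ∀ t (c : k) x y, F t x (c • y) = c • F t x y := fun t c x y => by
    rw [← sub_eq_zero]
    refine ((hF _ _).sub ((hF _ _).map (c • LinearMap.id))).eq_zero_of_ne (fun t ht => ?_) t
    rw [sub_eq_zero]
    apply hi t ht
    simp [hm t ht]
  let χ : k → AlgStr k n := fun t =>
    LinearMap.mk₂ k (F t) (hadd₁ t) (hsmul₁ t) (hadd₂ t) (hsmul₂ t)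
  refine ⟨χ 0, degenerates_iff.2 fun P hP => ?_, fun x y => rfl⟩
  have hc : ∀ i, PolyCurve fun t => structConst (χ t) i := fun i =>
    (hF _ _).map (LinearMap.proj i.2.2)
  refine (PolyCurve.mvPolynomial_eval hc P).eq_zero_of_ne (fun t ht => ?_) 0
  exact hP _ (mem_orbit_iff.2 ⟨h t, hi t ht, hm t ht⟩)

theorem degenerates_zero [Infinite k] (μ : AlgStr k n) : degenerates μ 0 := by
  obtain ⟨χ, h1, h2⟩ := exists_degenerates_of_family (μ := μ) (fun t => t • LinearMap.id)
    (fun t x y => t • μ x y) (fun x y => (PolyCurve.const _).smul)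
    (fun t ht x y hxy => by simpa [ht] using hxy) (fun t _ x y => by simp [smul_smul])
  have : χ = 0 := LinearMap.ext₂ fun x y => by simp [h2]
  rwa [this] at h1

theorem exists_degenerates_proj [Infinite k] (μ : AlgStr k n) {P Q : (Fin n → k) →ₗ[k] (Fin n → k)}
    (hP : ∀ x, P (P x) = P x) (hQ : ∀ x, Q (Q x) = Q x) (hPQ : ∀ x, P (Q x) = 0)
    (hQP : ∀ x, Q (P x) = 0) :
    ∃ χ, degenerates μ χ ∧ ∀ x y, χ x y = Q (μ (P x) (P y)) := by
  let R : (Fin n → k) →ₗ[k] (Fin n → k) := LinearMap.id - P - Q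
  let H : k → (Fin n → k) →ₗ[k] (Fin n → k) := fun t => P + t • R + (t * t) • Q
  let G : k → (Fin n → k) →ₗ[k] (Fin n → k) := fun t => (t * t) • P + t • R + Q
  have hGH : ∀ t x, H t (G t x) = (t * t) • x := fun t x => by
    simp only [H, G, R, LinearMap.add_apply, LinearMap.smul_apply, LinearMap.sub_apply,
      LinearMap.id_apply, map_add, map_sub, map_smul, hP, hQ, hPQ, hQP]
    module
  have hHG : ∀ t x, G t (H t x) = (t * t) • x := fun t x => by
    simp only [H, G, R, LinearMap.add_apply, LinearMap.smul_apply, LinearMap.sub_apply,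
      LinearMap.id_apply, map_add, map_sub, map_smul, hP, hQ, hPQ, hQP]
    module
  have cH : ∀ x, PolyCurve fun t => H t x := fun x =>
    ((PolyCurve.const (P x)).add (PolyCurve.const (R x)).smul).add
      ((PolyCurve.id.mul PolyCurve.id).smul' (PolyCurve.const (Q x)))
  have cG : ∀ z : k → Fin n → k, PolyCurve z → PolyCurve fun t => G t (z t) := fun z hz =>
    (((PolyCurve.id.mul PolyCurve.id).smul' (hz.map P)).add (hz.map R).smul).add (hz.map Q)
  obtain ⟨χ, h1, h2⟩ := exists_degenerates_of_family (μ := μ) (fun t => (t * t) • H t)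
    (fun t x y => G t (μ (H t x) (H t y))) (fun x y => cG _ ((cH x).bilin (cH y) μ))
    (fun t ht x y hxy => by
      have := congr_arg (G t) hxy
      simpa [ht, hHG] using this)
    (fun t _ x y => by simp [hGH, smul_smul])
  refine ⟨χ, h1, fun x y => ?_⟩
  simp [h2, H, G]

theorem exists_degenerates_IW [Infinite k] (μ : AlgStr k n) {φ : (Fin n → k) →ₗ[k] k}
    {f : Fin n → k} (hf : φ f = 1) {a : k} (hff : μ f f = a • f) :
    ∃ χ, degenerates μ χ ∧ ∀ x y, χ x y = (φ x * φ y * a) • f +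
      φ x • (μ f (y - φ y • f) - φ (μ f (y - φ y • f)) • f) +
      φ y • (μ (x - φ x • f) f - φ (μ (x - φ x • f) f) • f) := by
  let P : (Fin n → k) →ₗ[k] (Fin n → k) := φ.smulRight f
  let Q : (Fin n → k) →ₗ[k] (Fin n → k) := LinearMap.id - P
  have hPP : ∀ x, P (P x) = P x := fun x => by simp [P, hf]
  have hQP : ∀ x, Q (P x) = 0 := fun x => by simp [P, Q, hf]
  have hPQ : ∀ x, P (Q x) = 0 := fun x => by simp [P, Q, hf]
  have hQQ : ∀ x, Q (Q x) = Q x := fun x => by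
    simp only [Q, LinearMap.sub_apply, LinearMap.id_apply, map_sub, hPP]; abel
  have hPQi : ∀ x, P x + Q x = x := fun x => by simp [Q]
  have hQμ : ∀ x y, Q (μ (P x) (P y)) = 0 := fun x y => by simp [P, Q, hff, hf]
  let H : k → (Fin n → k) →ₗ[k] (Fin n → k) := fun t => P + t • Q
  have cH : ∀ x, PolyCurve fun t => H t x := fun x =>
    (PolyCurve.const (P x)).add (PolyCurve.const (Q x)).smul
  obtain ⟨χ, h1, h2⟩ := exists_degenerates_of_family (μ := μ) H
    (fun t x y => P (μ (H t x) (H t y)) + Q (μ (P x) (Q y) + μ (Q x) (P y) + t • μ (Q x) (Q y)))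
    (fun x y => (((cH x).bilin (cH y) μ).map P).add
      (((PolyCurve.const _).add (PolyCurve.const _).smul).map Q))
    (fun t ht x y hxy => by
      have h1 := congr_arg P hxy
      have h2 := congr_arg Q hxy
      simp only [H, LinearMap.add_apply, LinearMap.smul_apply, map_add, map_smul, hPP, hQP, hPQ,
        hQQ, smul_zero, add_zero, zero_add] at h1 h2
      rw [← hPQi x, ← hPQi y, h1, smul_right_injective _ ht h2])
    (fun t _ x y => by
      simp only [H, LinearMap.add_apply, LinearMap.smul_apply, map_add, map_smul, hPP, hQP, hPQ,
        hQQ, smul_zero, add_zero, zero_add]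
      conv_rhs => rw [← hPQi (μ (P x) (P y)), hQμ, ← hPQi (μ (P x) (Q y)), ← hPQi (μ (Q x) (P y)),
        ← hPQi (μ (Q x) (Q y))]
      module)
  refine ⟨χ, h1, fun x y => ?_⟩
  rw [h2]
  simp only [H, P, Q, LinearMap.add_apply, LinearMap.smul_apply, zero_smul, map_zero,
    LinearMap.smulRight_apply, LinearMap.sub_apply, LinearMap.id_apply, map_smul, map_add, hff, hf,
    smul_eq_mul, smul_sub, map_sub, smul_smul, mul_one, sub_smul]
  module

end Degenerations

section ClosedConditions

variable {n : ℕ} {W X Y : Type*} [AddCommGroup W] [Module k W] [AddCommGroup X] [Module k X]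
  [AddCommGroup Y] [Module k Y]

/-- Vector-valued expressions which depend polynomially on the structure constants of an algebra,
on a linear functional and on a scalar. -/
inductive AlgPoly : (AlgStr k n → ((Fin n → k) →ₗ[k] k) → k → W) → Prop
  | const (w : W) : AlgPoly fun _ _ _ => w
  | structConst_smul (s : Fin n × Fin n × Fin n) {F} :
      AlgPoly F → AlgPoly fun ν φ t => structConst ν s • F ν φ t
  | coord_smul (i : Fin n) {F} :
      AlgPoly F → AlgPoly fun ν φ t => φ (Pi.single i 1) • F ν φ t
  | param_smul {F} : AlgPoly F → AlgPoly fun ν φ t => t • F ν φ t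
  | add {F G} : AlgPoly F → AlgPoly G → AlgPoly fun ν φ t => F ν φ t + G ν φ t

variable {F : AlgStr k n → ((Fin n → k) →ₗ[k] k) → k → W}
  {G : AlgStr k n → ((Fin n → k) →ₗ[k] k) → k → X}

theorem AlgPoly.map (hF : AlgPoly F) (f : W →ₗ[k] X) : AlgPoly fun ν φ t => f (F ν φ t) := by
  induction hF with
  | const v => exact .const _
  | structConst_smul s _ ih => simpa only [map_smul] using ih.structConst_smul s
  | coord_smul i _ ih => simpa only [map_smul] using ih.coord_smul i
  | param_smul _ ih => simpa only [map_smul] using ih.param_smul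
  | add _ _ ih₁ ih₂ => simpa only [map_add] using ih₁.add ih₂

theorem AlgPoly.bilin (hF : AlgPoly F) (hG : AlgPoly G) (b : W →ₗ[k] X →ₗ[k] Y) :
    AlgPoly fun ν φ t => b (F ν φ t) (G ν φ t) := by
  induction hF with
  | const v => exact hG.map (b v)
  | structConst_smul s _ ih =>
    simpa only [map_smul, LinearMap.smul_apply] using ih.structConst_smul s
  | coord_smul i _ ih => simpa only [map_smul, LinearMap.smul_apply] using ih.coord_smul i
  | param_smul _ ih => simpa only [map_smul, LinearMap.smul_apply] using ih.param_smul
  | add _ _ ih₁ ih₂ => simpa only [map_add, LinearMap.add_apply] using ih₁.add ih₂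

theorem AlgPoly.sub {F' : AlgStr k n → ((Fin n → k) →ₗ[k] k) → k → W} (hF : AlgPoly F)
    (hG : AlgPoly F') : AlgPoly fun ν φ t => F ν φ t - F' ν φ t := by
  simpa [sub_eq_add_neg] using hF.add (hG.map (-LinearMap.id))

theorem AlgPoly.smul {f : AlgStr k n → ((Fin n → k) →ₗ[k] k) → k → k} (hf : AlgPoly f)
    (hF : AlgPoly F) : AlgPoly fun ν φ t => f ν φ t • F ν φ t := hf.bilin hF (LinearMap.lsmul k W)

theorem AlgPoly.mul {f g : AlgStr k n → ((Fin n → k) →ₗ[k] k) → k → k} (hf : AlgPoly f)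
    (hg : AlgPoly g) : AlgPoly fun ν φ t => f ν φ t * g ν φ t := hf.smul hg

theorem AlgPoly.sum {ι : Type*} {F : ι → AlgStr k n → ((Fin n → k) →ₗ[k] k) → k → W}
    (s : Finset ι) (h : ∀ i ∈ s, AlgPoly (F i)) : AlgPoly fun ν φ t => ∑ i ∈ s, F i ν φ t := by
  classical
  induction s using Finset.induction_on with
  | empty => simpa using AlgPoly.const (0 : W)
  | insert a s ha ih =>
    simp only [Finset.sum_insert ha]
    exact (h a (by simp)).add (ih fun i hi => h i (by simp [hi]))

theorem AlgPoly.param : AlgPoly (n := n) (k := k) (W := k) fun _ _ t => t := by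
  simpa using (AlgPoly.const (k := k) (n := n) (1 : k)).param_smul

theorem ofConst_apply (c : Fin n → Fin n → Fin n → k) (x y : Fin n → k) (m : Fin n) :
    ofConst c x y m = ∑ i, ∑ j, x i * y j * c i j m := by
  simp [ofConst, LinearMap.sum_apply, Finset.sum_apply]

theorem AlgPoly.self : AlgPoly fun (ν : AlgStr k n) (_ : (Fin n → k) →ₗ[k] k) (_ : k) => ν := by
  have : ∀ ν : AlgStr k n, ∑ s : Fin n × Fin n × Fin n, structConst ν s •
      ofConst (fun i j m => if s = (i, j, m) then 1 else 0) = ν := fun ν => by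
    refine LinearMap.pi_ext' fun i => LinearMap.ext_ring ?_
    refine LinearMap.pi_ext' fun j => LinearMap.ext_ring (funext fun m => ?_)
    have : ∀ s : Fin n × Fin n × Fin n, ofConst (fun i j m => if s = (i, j, m) then (1 : k) else 0)
        (Pi.single i 1) (Pi.single j 1) m = if s = (i, j, m) then 1 else 0 := fun s => by
      rw [ofConst_apply, Finset.sum_eq_single i, Finset.sum_eq_single j] <;>
        simp +contextual [Pi.single_apply]
    simp [Finset.sum_apply, structConst, this]
  have h2 := AlgPoly.sum (W := AlgStr k n) Finset.univ
    fun (s : Fin n × Fin n × Fin n) _ => (AlgPoly.const (k := k) (n := n) (W := AlgStr k n)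
      (ofConst (fun i j m => if s = (i, j, m) then 1 else 0))).structConst_smul s
  simpa only [this] using h2

theorem AlgPoly.str {f g : AlgStr k n → ((Fin n → k) →ₗ[k] k) → k → (Fin n → k)} (hf : AlgPoly f)
    (hg : AlgPoly g) : AlgPoly fun ν φ t => ν (f ν φ t) (g ν φ t) :=
  hg.bilin (hf.bilin .self (LinearMap.applyₗ (R := k))) (LinearMap.applyₗ (R := k))

theorem AlgPoly.functional {f : AlgStr k n → ((Fin n → k) →ₗ[k] k) → k → (Fin n → k)}
    (hf : AlgPoly f) : AlgPoly fun ν φ t => φ (f ν φ t) := by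
  have key : ∀ (φ : (Fin n → k) →ₗ[k] k) (x : Fin n → k),
      φ x = ∑ i, φ (Pi.single i 1) • x i := fun φ x => by
    rw [LinearMap.pi_apply_eq_sum_univ φ x]
    refine Finset.sum_congr rfl fun i _ => ?_
    rw [smul_eq_mul, smul_eq_mul, mul_comm]
    congr 2
    ext j
    simp [Pi.single_apply, eq_comm]
  rw [show (fun (ν : AlgStr k n) (φ : (Fin n → k) →ₗ[k] k) (t : k) => φ (f ν φ t)) = fun ν φ t =>
    ∑ i, φ (Pi.single i 1) • f ν φ t i from funext₃ fun ν φ t => key φ _]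
  exact AlgPoly.sum _ fun i _ => (hf.map (LinearMap.proj i)).coord_smul i

/-- The coordinates of a pair consisting of a linear functional and a scalar. -/
def pairCoord (φ : (Fin n → k) →ₗ[k] k) (t : k) : Option (Fin n) → k :=
  fun i => i.elim t fun j => φ (Pi.single j 1)

theorem AlgPoly.exists_mvPolynomial {f : AlgStr k n → ((Fin n → k) →ₗ[k] k) → k → k}
    (hf : AlgPoly f) :
    ∃ P : MvPolynomial (Option (Fin n)) (MvPolynomial (Fin n × Fin n × Fin n) k), ∀ ν φ t,
      f ν φ t = MvPolynomial.eval (pairCoord φ t)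
        (MvPolynomial.map (MvPolynomial.eval (structConst ν)) P) := by
  induction hf with
  | const v => exact ⟨.C (.C v), by simp⟩
  | structConst_smul s _ ih =>
    obtain ⟨p, hp⟩ := ih
    exact ⟨.C (.X s) * p, by simp [hp]⟩
  | coord_smul i _ ih =>
    obtain ⟨p, hp⟩ := ih
    exact ⟨.X (some i) * p, by simp [hp, pairCoord]⟩
  | param_smul _ ih =>
    obtain ⟨p, hp⟩ := ih
    exact ⟨.X none * p, by simp [hp, pairCoord]⟩
  | add _ _ ih₁ ih₂ =>
    obtain ⟨p, hp⟩ := ih₁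
    obtain ⟨q, hq⟩ := ih₂
    exact ⟨p + q, by simp [hp, hq]⟩

/-- Conditions on an algebra, a linear functional and a scalar which are defined by polynomial
equations. -/
def ClosedCond (C : AlgStr k n → ((Fin n → k) →ₗ[k] k) → k → Prop) : Prop :=
  ∃ S : Set (AlgStr k n → ((Fin n → k) →ₗ[k] k) → k → k), (∀ f ∈ S, AlgPoly f) ∧
    ∀ ν φ t, C ν φ t ↔ ∀ f ∈ S, f ν φ t = 0

theorem ClosedCond.and {C D : AlgStr k n → ((Fin n → k) →ₗ[k] k) → k → Prop} (hC : ClosedCond C)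
    (hD : ClosedCond D) : ClosedCond fun ν φ t => C ν φ t ∧ D ν φ t := by
  obtain ⟨S, hS, hS'⟩ := hC
  obtain ⟨T, hT, hT'⟩ := hD
  refine ⟨S ∪ T, fun f hf => hf.elim (hS f) (hT f), fun ν φ t => ?_⟩
  show C ν φ t ∧ D ν φ t ↔ _
  rw [hS', hT']
  exact ⟨fun h f hf => hf.elim (h.1 f) (h.2 f), fun h => ⟨fun f hf => h f (.inl hf),
    fun f hf => h f (.inr hf)⟩⟩

theorem ClosedCond.all {ι : Type*} {C : ι → AlgStr k n → ((Fin n → k) →ₗ[k] k) → k → Prop}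
    (hC : ∀ i, ClosedCond (C i)) : ClosedCond fun ν φ t => ∀ i, C i ν φ t := by
  choose S hS hS' using hC
  refine ⟨⋃ i, S i, fun f hf => ?_, fun ν φ t => ?_⟩
  · obtain ⟨i, hi⟩ := Set.mem_iUnion.1 hf
    exact hS i f hi
  · simp only [hS', Set.mem_iUnion]
    exact ⟨fun h f ⟨i, hi⟩ => h i f hi, fun h i f hf => h f ⟨i, hf⟩⟩

theorem ClosedCond.eq {F F' : AlgStr k n → ((Fin n → k) →ₗ[k] k) → k → W} (hF : AlgPoly F)
    (hF' : AlgPoly F') : ClosedCond fun ν φ t => F ν φ t = F' ν φ t := by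
  refine ⟨Set.range fun (f : W →ₗ[k] k) ν φ t => f (F ν φ t - F' ν φ t), ?_, fun ν φ t => ?_⟩
  · rintro _ ⟨f, rfl⟩
    exact (hF.sub hF').map f
  · show F ν φ t = F' ν φ t ↔ _
    rw [← sub_eq_zero, ← Module.forall_dual_apply_eq_zero_iff k]
    simp

theorem homogeneous_part_eq_zero [Infinite k] {ι : Type*} {D : ℕ}
    [Fintype {m : ι →₀ ℕ // m.degree = D}] {q : MvPolynomial ι k} {z : ι → k}
    (h : ∀ c : k, MvPolynomial.eval (c • z) q = 0) :
    ∑ m : {m : ι →₀ ℕ // m.degree = D}, q.coeff m * m.1.prod (fun i e => z i ^ e) = 0 := by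
  classical
  let p : Polynomial k := ∑ m ∈ q.support,
    Polynomial.monomial m.degree (q.coeff m * m.prod (fun i e => z i ^ e))
  have hp : p = 0 := by
    refine Polynomial.funext fun c => ?_
    rw [Polynomial.eval_zero, ← h c, MvPolynomial.eval_eq, Polynomial.eval_finsetSum]
    refine Finset.sum_congr rfl fun m _ => ?_
    rw [Polynomial.eval_monomial, Finsupp.prod, Finsupp.degree_apply]
    simp only [Pi.smul_apply, smul_eq_mul, mul_pow, Finset.prod_mul_distrib,
      Finset.prod_pow_eq_pow_sum]
    ring
  have hD := congr_arg (fun p => p.coeff D) hp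
  simp only [p, Polynomial.finsetSum_coeff, Polynomial.coeff_monomial, Polynomial.coeff_zero] at hD
  rw [← hD, ← Finset.sum_filter]
  symm
  refine Finset.sum_bij_ne_zero (fun m hm _ => ⟨m, (Finset.mem_filter.1 hm).2⟩) (by simp)
    (fun _ _ _ _ _ _ h => congr_arg Subtype.val h) (fun m _ hm => ⟨m.1, ?_, hm, rfl⟩)
    (fun _ _ _ => rfl)
  rw [Finset.mem_filter, MvPolynomial.mem_support_iff]
  exact ⟨left_ne_zero_of_mul hm, m.2⟩

theorem exists_of_degenerates [IsAlgClosed k] {μ χ : AlgStr k n} (h : degenerates μ χ)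
    {C : AlgStr k n → ((Fin n → k) →ₗ[k] k) → k → Prop} (hC : ClosedCond C)
    (hμ : ∀ ν ∈ orbit μ, ∃ φ t, (φ ≠ 0 ∨ t ≠ 0) ∧ ∀ c : k, C ν (c • φ) (c * t)) :
    ∃ φ t, (φ ≠ 0 ∨ t ≠ 0) ∧ C χ φ t := by
  classical
  have : Infinite k := IsAlgClosed.instInfinite
  by_contra! hcon
  obtain ⟨S, hS, hS'⟩ := hC
  choose! P hP using fun f (hf : f ∈ S) => (hS f hf).exists_mvPolynomial
  let ev : AlgStr k n → MvPolynomial (Option (Fin n)) (MvPolynomial (Fin n × Fin n × Fin n) k) →+*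
    MvPolynomial (Option (Fin n)) k := fun ν => MvPolynomial.map (MvPolynomial.eval (structConst ν))
  let I := Ideal.span (P '' S)
  have hev : Function.Surjective (ev χ) := MvPolynomial.map_surjective _ fun a => ⟨.C a, by simp⟩
  have hsub : (MvPolynomial.idealOfVars (Option (Fin n)) k) ≤ (I.map (ev χ)).radical := by
    rw [← MvPolynomial.vanishingIdeal_zeroLocus_eq_radical (K := k), MvPolynomial.idealOfVars,
      Ideal.span_le]
    rintro _ ⟨i, rfl⟩
    rw [SetLike.mem_coe, MvPolynomial.mem_vanishingIdeal_iff]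
    intro z hz
    let φ : (Fin n → k) →ₗ[k] k := Fintype.linearCombination k fun j => z (some j)
    have hzφ : pairCoord φ (z none) = z := by
      ext i
      cases i <;> simp [pairCoord, φ, Fintype.linearCombination_apply_single]
    have hCz : C χ φ (z none) := (hS' _ _ _).2 fun f hf => by
      rw [hP f hf, hzφ]
      exact (MvPolynomial.mem_zeroLocus_iff.1 hz) _
        (Ideal.mem_map_of_mem _ (Ideal.subset_span ⟨f, hf, rfl⟩))
    by_cases hz0 : φ ≠ 0 ∨ z none ≠ 0
    · exact absurd hCz (hcon _ _ hz0)
    · push Not at hz0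
      rw [MvPolynomial.aeval_X, ← hzφ, hz0.1, hz0.2]
      cases i <;> simp [pairCoord]
  obtain ⟨N, hN⟩ := Ideal.exists_pow_le_of_le_radical_of_fg hsub
    (MvPolynomial.idealOfVars_fg _ _)
  let D := N + 1
  have : Finite {m : Option (Fin n) →₀ ℕ // m.degree = D} :=
    (Set.Finite.subset (Finsupp.finite_of_degree_le D) fun m (hm : m.degree = D) => hm.le)
  have := Fintype.ofFinite {m : Option (Fin n) →₀ ℕ // m.degree = D}
  have hmon : ∀ m : {m : Option (Fin n) →₀ ℕ // m.degree = D}, ∃ Q ∈ I,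
      ev χ Q = MvPolynomial.monomial m.1 1 := fun m => by
    refine (Ideal.mem_map_iff_of_surjective _ hev).1 (hN ?_)
    rw [MvPolynomial.monomial_mem_pow_idealOfVars_iff _ _ one_ne_zero, m.2]
    exact N.le_succ
  choose Q hQI hQ using hmon
  let A : Matrix {m : Option (Fin n) →₀ ℕ // m.degree = D}
    {m : Option (Fin n) →₀ ℕ // m.degree = D} (MvPolynomial (Fin n × Fin n × Fin n) k) :=
    Matrix.of fun m m' => (Q m).coeff m'.1
  have hA : ∀ ν, MvPolynomial.eval (structConst ν) A.det =
      (Matrix.of fun m m' => (ev ν (Q m)).coeff m'.1).det := fun ν => by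
    rw [RingHom.map_det]
    congr 1
  have hdet : MvPolynomial.eval (structConst χ) A.det = 1 := by
    rw [hA, ← Matrix.det_one (n := {m : Option (Fin n) →₀ ℕ // m.degree = D})]
    congr 1
    ext m m'
    rw [Matrix.of_apply, hQ, MvPolynomial.coeff_monomial, Matrix.one_apply]
    simp [Subtype.ext_iff]
  refine one_ne_zero (α := k) ?_
  rw [← hdet]
  refine degenerates_iff.1 h _ fun ν hν => ?_
  obtain ⟨φ, t, hφt, hc⟩ := hμ ν hν
  rw [hA, ← Matrix.exists_mulVec_eq_zero_iff]
  let z := pairCoord φ t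
  have hz : ∃ i, z i ≠ 0 := by
    by_contra! hz
    rcases hφt with hφ | ht
    · apply hφ
      exact LinearMap.pi_ext' fun j => LinearMap.ext_ring
        (by simpa using! show φ (Pi.single j 1) = 0 from hz (some j))
    · exact ht (hz none)
  obtain ⟨i, hi⟩ := hz
  refine ⟨fun m => m.1.prod fun i e => z i ^ e, fun h0 => ?_, ?_⟩
  · have := congr_fun h0 ⟨Finsupp.single i D, by simp⟩
    simp only [Finsupp.prod_single_index, pow_zero, Pi.zero_apply] at this
    exact hi (pow_eq_zero_iff (by simp [D]) |>.1 this)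
  · ext m
    have hI : ∀ c : k, I ≤ RingHom.ker ((MvPolynomial.eval (c • z)).comp (ev ν)) := fun c => by
      rw [Ideal.span_le]
      rintro _ ⟨f, hf, rfl⟩
      have := (hS' _ _ _).1 (hc c) f hf
      rw [hP f hf] at this
      have hcz : pairCoord (c • φ) (c * t) = c • z := by
        ext i
        cases i <;> simp [pairCoord, z]
      rw [hcz] at this
      exact this
    exact homogeneous_part_eq_zero fun c => hI c (hQI m)

end ClosedConditions

section NormalForms

variable {n : ℕ}

/-- The algebra `μ` is given by a fixed formula in terms of linearly independent functionals and
linearly independent vectors with a prescribed pairing. -/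
def HasNormalForm {r s : ℕ} (p : Fin r → Fin s → k) (a b : (Fin r → k) → k)
    (c : Fin s → (Fin r → k) → (Fin r → k) → k) (μ : AlgStr k n) : Prop :=
  ∃ (φ : Fin r → (Fin n → k) →ₗ[k] k) (v : Fin s → Fin n → k), LinearIndependent k φ ∧
    LinearIndependent k v ∧ (∀ i j, φ i (v j) = p i j) ∧ ∀ x y, μ x y =
      a (fun i => φ i x) • y + b (fun i => φ i y) • x +
        ∑ j, c j (fun i => φ i x) (fun i => φ i y) • v j

section

variable {r s : ℕ} {p : Fin r → Fin s → k} {a b : (Fin r → k) → k}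
  {c : Fin s → (Fin r → k) → (Fin r → k) → k} {μ ν : AlgStr k n}

theorem HasNormalForm.mem_orbit (hμ : HasNormalForm p a b c μ) (hν : HasNormalForm p a b c ν) :
    ν ∈ orbit μ := by
  obtain ⟨φ, v, hφ, hv, hp, h⟩ := hν
  obtain ⟨φ', v', hφ', hv', hp', h'⟩ := hμ
  obtain ⟨g, hg, hg'⟩ := exists_equiv_of_pairing_eq hφ hφ' hv hv' fun i j => by rw [hp, hp']
  refine mem_orbit_of_equiv g fun x y => ?_
  simp only [h, h', map_add, map_smul, map_sum, hg, hg']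

theorem HasNormalForm.of_mem_orbit (hμ : HasNormalForm p a b c μ) (hν : ν ∈ orbit μ) :
    HasNormalForm p a b c ν := by
  obtain ⟨φ, v, hφ, hv, hp, h⟩ := hμ
  obtain ⟨g, hg⟩ := mem_orbit_iff_equiv.1 hν
  refine ⟨fun i => φ i ∘ₗ g.toLinearMap, fun j => g.symm (v j), ?_, ?_, ?_, ?_⟩
  · exact hφ.map' (LinearMap.lcomp k k g.toLinearMap) (LinearMap.ker_eq_bot.2 fun f f' hff =>
      LinearMap.ext fun x => by simpa using LinearMap.congr_fun hff (g.symm x))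
  · exact hv.map' g.symm.toLinearMap g.symm.ker
  · simpa using hp
  · intro x y
    apply g.injective
    rw [hg, h]
    simp

end

/-- Algebras isomorphic to `A₃ ⊕ kⁿ⁻²`. -/
def IsA3 (μ : AlgStr k n) : Prop :=
  ∃ (φ : (Fin n → k) →ₗ[k] k) (v : Fin n → k), φ ≠ 0 ∧ v ≠ 0 ∧ φ v = 0 ∧
    ∀ x y, μ x y = (φ x * φ y) • v

/-- Algebras of the form `xy = αφ(x)y + βφ(y)x + φ(x)φ(y)w` with `φ(w) = γ`. -/
def IsGamma (α β γ : k) (μ : AlgStr k n) : Prop :=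
  ∃ (φ : (Fin n → k) →ₗ[k] k) (w : Fin n → k), φ ≠ 0 ∧ w ≠ 0 ∧ φ w = γ ∧
    ∀ x y, μ x y = (α * φ x) • y + (β * φ y) • x + (φ x * φ y) • w

/-- Algebras of the form `xy = aφ(x)y + bφ(y)x`. -/
def IsScalar (a b : k) (μ : AlgStr k n) : Prop :=
  ∃ φ : (Fin n → k) →ₗ[k] k, φ ≠ 0 ∧ ∀ x y, μ x y = (a * φ x) • y + (b * φ y) • x

/-- Algebras isomorphic to `kⁿ⁻² ⋊ E₄`. -/
def IsE4 (μ : AlgStr k n) : Prop :=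
  ∃ φ ψ : (Fin n → k) →ₗ[k] k, LinearIndependent k ![φ, ψ] ∧
    ∀ x y, μ x y = φ x • y + ψ y • x

/-- Algebras of the form `xy = β₁φ(x)y + β₂φ(y)x + (φ ∧ ψ)(x, y)v` with `φ(v) = 0`
and `ψ(v) = δ`. -/
def IsT (β₁ β₂ δ : k) (μ : AlgStr k n) : Prop :=
  ∃ (φ ψ : (Fin n → k) →ₗ[k] k) (v : Fin n → k), LinearIndependent k ![φ, ψ] ∧ v ≠ 0 ∧
    φ v = 0 ∧ ψ v = δ ∧
    ∀ x y, μ x y = (β₁ * φ x) • y + (β₂ * φ y) • x + (φ x * ψ y - φ y * ψ x) • v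

/-- Algebras isomorphic to `F^{α,β} ⊕ kⁿ⁻³`. -/
def IsF (α β : k) (μ : AlgStr k n) : Prop :=
  ∃ (φ ψ : (Fin n → k) →ₗ[k] k) (v : Fin n → k), LinearIndependent k ![φ, ψ] ∧ v ≠ 0 ∧
    φ v = 0 ∧ ψ v = 0 ∧
    ∀ x y, μ x y = (φ x * φ y + α * (φ x * ψ y) + β * (ψ x * φ y)) • v

/-- Algebras isomorphic to `η₂ ⊕ kⁿ⁻⁵`. -/
def IsEta (μ : AlgStr k n) : Prop :=
  ∃ (φ : Fin 4 → (Fin n → k) →ₗ[k] k) (v : Fin n → k), LinearIndependent k φ ∧ v ≠ 0 ∧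
    (∀ i, φ i v = 0) ∧ ∀ x y, μ x y =
      (φ 0 x * φ 1 y - φ 0 y * φ 1 x + (φ 2 x * φ 3 y - φ 2 y * φ 3 x)) • v

/-- Algebras isomorphic to `T₀^{2,2}`. -/
def IsT022 (μ : AlgStr k n) : Prop :=
  ∃ (φ ψ χ : (Fin n → k) →ₗ[k] k) (v u : Fin n → k), LinearIndependent k ![φ, ψ, χ] ∧
    LinearIndependent k ![v, u] ∧ φ v = 0 ∧ φ u = 0 ∧ ψ v = 0 ∧ ψ u = 0 ∧ χ v = 0 ∧ χ u = 0 ∧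
    ∀ x y, μ x y = (φ x * ψ y - φ y * ψ x) • v + (φ x * χ y - φ y * χ x) • u

/-- Algebras isomorphic to `T₀³` (possibly with an abelian summand). -/
def IsT03 (μ : AlgStr k n) : Prop :=
  ∃ (φ ψ χ : (Fin n → k) →ₗ[k] k) (v u : Fin n → k), LinearIndependent k ![φ, ψ, χ] ∧
    LinearIndependent k ![v, u] ∧ φ v = 0 ∧ φ u = 0 ∧ ψ v = 0 ∧ ψ u = 0 ∧ χ v = 1 ∧ χ u = 0 ∧
    ∀ x y, μ x y = (φ x * ψ y - φ y * ψ x) • v + (φ x * χ y - φ y * χ x) • u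

section

variable {V : Type*}

theorem exists_fin_one {P : (Fin 1 → V) → Prop} : (∃ v, P v) ↔ ∃ v, P ![v] :=
  ⟨fun ⟨v, h⟩ => ⟨v 0, by convert h using 1; ext i; fin_cases i; rfl⟩, fun ⟨v, h⟩ => ⟨_, h⟩⟩

theorem exists_fin_two {P : (Fin 2 → V) → Prop} : (∃ v, P v) ↔ ∃ v w, P ![v, w] :=
  ⟨fun ⟨v, h⟩ => ⟨v 0, v 1, by convert h using 1; ext i; fin_cases i <;> rfl⟩,
    fun ⟨v, w, h⟩ => ⟨_, h⟩⟩

theorem exists_fin_three {P : (Fin 3 → V) → Prop} : (∃ v, P v) ↔ ∃ v w u, P ![v, w, u] :=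
  ⟨fun ⟨v, h⟩ => ⟨v 0, v 1, v 2, by convert h using 1; ext i; fin_cases i <;> rfl⟩,
    fun ⟨v, w, u, h⟩ => ⟨_, h⟩⟩

end

theorem isA3_iff {μ : AlgStr k n} : IsA3 μ ↔ HasNormalForm (r := 1) (s := 1) (fun _ _ => 0)
    (fun _ => 0) (fun _ => 0) (fun _ f g => f 0 * g 0) μ := by
  simp [HasNormalForm, IsA3, exists_fin_one]

theorem isGamma_iff {α β γ : k} {μ : AlgStr k n} : IsGamma α β γ μ ↔
    HasNormalForm (r := 1) (s := 1) (fun _ _ => γ)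
    (fun f => α * f 0) (fun f => β * f 0) (fun _ f g => f 0 * g 0) μ := by
  simp [HasNormalForm, IsGamma, exists_fin_one]

theorem isScalar_iff {a b : k} {μ : AlgStr k n} : IsScalar a b μ ↔
    HasNormalForm (r := 1) (s := 0) (fun _ => finZeroElim)
    (fun f => a * f 0) (fun f => b * f 0) (fun _ _ _ => 0) μ := by
  simp [HasNormalForm, IsScalar, exists_fin_one]

theorem isE4_iff {μ : AlgStr k n} : IsE4 μ ↔
    HasNormalForm (r := 2) (s := 0) (fun _ => finZeroElim)
    (fun f => f 0) (fun f => f 1) (fun _ _ _ => 0) μ := by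
  simp [HasNormalForm, IsE4, exists_fin_two]

theorem isT_iff {β₁ β₂ δ : k} {μ : AlgStr k n} : IsT β₁ β₂ δ μ ↔
    HasNormalForm (r := 2) (s := 1) ![fun _ => 0, fun _ => δ]
    (fun f => β₁ * f 0) (fun f => β₂ * f 0) (fun _ f g => f 0 * g 1 - g 0 * f 1) μ := by
  simp [HasNormalForm, IsT, exists_fin_two, exists_fin_one, and_assoc]

theorem isF_iff {α β : k} {μ : AlgStr k n} : IsF α β μ ↔
    HasNormalForm (r := 2) (s := 1) (fun _ _ => 0) (fun _ => 0) (fun _ => 0)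
    (fun _ f g => f 0 * g 0 + α * (f 0 * g 1) + β * (f 1 * g 0)) μ := by
  simp [HasNormalForm, IsF, exists_fin_two, exists_fin_one, and_assoc]

theorem isEta_iff {μ : AlgStr k n} : IsEta μ ↔
    HasNormalForm (r := 4) (s := 1) (fun _ _ => 0) (fun _ => 0) (fun _ => 0)
    (fun _ f g => f 0 * g 1 - g 0 * f 1 + (f 2 * g 3 - g 2 * f 3)) μ := by
  simp [HasNormalForm, IsEta, exists_fin_one]

theorem isT022_iff {μ : AlgStr k n} : IsT022 μ ↔
    HasNormalForm (r := 3) (s := 2) (fun _ _ => 0) (fun _ => 0) (fun _ => 0)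
    ![fun f g => f 0 * g 1 - g 0 * f 1, fun f g => f 0 * g 2 - g 0 * f 2] μ := by
  simp [HasNormalForm, IsT022, exists_fin_two, exists_fin_three, Fin.forall_fin_succ, and_assoc]

theorem isT03_iff {μ : AlgStr k n} : IsT03 μ ↔
    HasNormalForm (r := 3) (s := 2) ![![0, 0], ![0, 0], ![1, 0]] (fun _ => 0) (fun _ => 0)
    ![fun f g => f 0 * g 1 - g 0 * f 1, fun f g => f 0 * g 2 - g 0 * f 2] μ := by
  simp [HasNormalForm, IsT03, exists_fin_two, exists_fin_three, Fin.forall_fin_succ, and_assoc]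

theorem IsGamma.smul {α β γ : k} {μ : AlgStr k n} (h : IsGamma α β γ μ) {c : k} (hc : c ≠ 0) :
    IsGamma (c * α) (c * β) (c * γ) μ := by
  obtain ⟨φ, w, hφ, hw, rfl, h⟩ := h
  refine ⟨c⁻¹ • φ, (c ^ 2) • w, by simp [hc, hφ], by simp [hc, hw], by simp; field_simp,
    fun x y => ?_⟩
  rw [h, smul_smul]
  simp only [LinearMap.smul_apply, smul_eq_mul]
  congr 1
  · congr 2 <;> field_simp
  · congr 1; field_simp

theorem IsT.smul {β₁ β₂ δ : k} {μ : AlgStr k n} (h : IsT β₁ β₂ δ μ) {c : k} (hc : c ≠ 0) :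
    IsT (c * β₁) (c * β₂) (c * δ) μ := by
  obtain ⟨φ, ψ, v, hφ, hv, h0, rfl, h⟩ := h
  refine ⟨c⁻¹ • φ, ψ, c • v, ?_, by simp [hc, hv], by simp [h0], by simp, fun x y => ?_⟩
  · rw [LinearIndependent.pair_iff] at hφ ⊢
    intro s t hst
    rw [smul_smul] at hst
    obtain ⟨h1, h2⟩ := hφ _ _ hst
    exact ⟨by simpa [hc] using h1, h2⟩
  · rw [h, smul_smul]
    simp only [LinearMap.smul_apply, smul_eq_mul]
    congr 1
    · congr 2 <;> field_simp
    · congr 1; field_simp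

end NormalForms

section StandardStructures

variable {n : ℕ}

theorem ofConst_eq {c : Fin n → Fin n → Fin n → k} {B : AlgStr k n}
    (h : ∀ i j m, c i j m = B (Pi.single i 1) (Pi.single j 1) m) : ofConst c = B := by
  refine LinearMap.pi_ext' fun i => LinearMap.ext_ring ?_
  refine LinearMap.pi_ext' fun j => LinearMap.ext_ring (funext fun m => ?_)
  have : ofConst c (Pi.single i 1) (Pi.single j 1) m = c i j m := by
    rw [ofConst_apply, Finset.sum_eq_single i, Finset.sum_eq_single j] <;>
      simp +contextual [Pi.single_apply]
  exact this.trans (h i j m)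

/-- The bilinear map `(x, y) ↦ φ(x)y`. -/
def leftMul (φ : (Fin n → k) →ₗ[k] k) : AlgStr k n := φ.smulRight LinearMap.id

/-- The bilinear map `(x, y) ↦ φ(x)ψ(y)v`. -/
def outerMul (φ ψ : (Fin n → k) →ₗ[k] k) (v : Fin n → k) : AlgStr k n :=
  φ.smulRight (ψ.smulRight v)

@[simp]
theorem leftMul_apply (φ : (Fin n → k) →ₗ[k] k) (x y : Fin n → k) :
    leftMul φ x y = φ x • y := rfl

@[simp]
theorem outerMul_apply (φ ψ : (Fin n → k) →ₗ[k] k) (v x y : Fin n → k) :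
    outerMul φ ψ v x y = (φ x * ψ y) • v := by
  simp [outerMul, smul_smul]

theorem linearIndependent_proj {r : ℕ} {f : Fin r → Fin n} (hf : Function.Injective f) :
    LinearIndependent k fun i => (LinearMap.proj (f i) : (Fin n → k) →ₗ[k] k) := by
  rw [Fintype.linearIndependent_iff]
  intro g hg i
  simpa [Pi.single_apply, hf.eq_iff] using LinearMap.congr_fun hg (Pi.single (f i) 1)

theorem linearIndependent_proj_two {i j : Fin n} (h : i ≠ j) :
    LinearIndependent k ![(LinearMap.proj i : (Fin n → k) →ₗ[k] k), LinearMap.proj j] := by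
  convert linearIndependent_proj (f := ![i, j]) ?_ using 1
  · ext a; fin_cases a <;> rfl
  · intro a b; fin_cases a <;> fin_cases b <;> simp [h, h.symm]

theorem linearIndependent_proj_three {i j l : Fin n} (h : i ≠ j) (h' : i ≠ l) (h'' : j ≠ l) :
    LinearIndependent k ![(LinearMap.proj i : (Fin n → k) →ₗ[k] k), LinearMap.proj j,
      LinearMap.proj l] := by
  convert linearIndependent_proj (f := ![i, j, l]) ?_ using 1
  · ext a; fin_cases a <;> rfl
  · intro a b; fin_cases a <;> fin_cases b <;> simp [h, h.symm, h', h'.symm, h'', h''.symm]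

theorem linearIndependent_unitVec_two {a b : ℕ} (ha : a < n) (hb : b < n) (h : a ≠ b) :
    LinearIndependent k ![unitVec (k := k) n a, unitVec n b] := by
  rw [LinearIndependent.pair_iff]
  intro s t hst
  have h1 := congr_fun hst ⟨a, ha⟩
  have h2 := congr_fun hst ⟨b, hb⟩
  simp [unitVec, h, h.symm] at h1 h2
  exact ⟨h1, h2⟩

theorem proj_ne_zero (i : Fin n) : (LinearMap.proj i : (Fin n → k) →ₗ[k] k) ≠ 0 := fun h => by
  simpa using LinearMap.congr_fun h (Pi.single i 1)

theorem unitVec_ne_zero {a : ℕ} (ha : a < n) : unitVec (k := k) n a ≠ 0 := fun h => by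
  simpa [unitVec] using congr_fun h ⟨a, ha⟩

theorem isGamma_kA1str (hn : 2 ≤ n) (α : k) : IsGamma α (1 - α) 0 (kA1str n α) := by
  refine ⟨LinearMap.proj ⟨0, by omega⟩, unitVec n 1, proj_ne_zero _, unitVec_ne_zero (by omega),
    by simp [unitVec], fun x y => ?_⟩
  rw [kA1str, ofConst_eq (B := leftMul ((α : k) • LinearMap.proj ⟨0, by omega⟩) +
    (leftMul (((1 - α) : k) • LinearMap.proj ⟨0, by omega⟩)).flip +
    outerMul (LinearMap.proj ⟨0, by omega⟩) (LinearMap.proj ⟨0, by omega⟩) (unitVec n 1))]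
  · simp only [LinearMap.add_apply, LinearMap.flip_apply, leftMul_apply,
      outerMul_apply, LinearMap.smul_apply, LinearMap.proj_apply, smul_eq_mul]
  · intro i j m
    simp only [LinearMap.add_apply, LinearMap.flip_apply, leftMul_apply,
      outerMul_apply, LinearMap.smul_apply, LinearMap.proj_apply, Pi.add_apply,
      Pi.smul_apply, smul_eq_mul, unitVec, Pi.single_apply, Fin.ext_iff]
    grind

theorem isGamma_kA2str (hn : 2 ≤ n) : IsGamma (1 : k) (-1) 0 (kA2str n) := by
  refine ⟨LinearMap.proj ⟨0, by omega⟩, unitVec n 1, proj_ne_zero _, unitVec_ne_zero (by omega),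
    by simp [unitVec], fun x y => ?_⟩
  rw [kA2str, ofConst_eq (B := leftMul (((1 : k) : k) • LinearMap.proj ⟨0, by omega⟩) +
    (leftMul (((-1) : k) • LinearMap.proj ⟨0, by omega⟩)).flip +
    outerMul (LinearMap.proj ⟨0, by omega⟩) (LinearMap.proj ⟨0, by omega⟩) (unitVec n 1))]
  · simp only [LinearMap.add_apply, LinearMap.flip_apply, leftMul_apply,
      outerMul_apply, LinearMap.smul_apply, LinearMap.proj_apply, smul_eq_mul]
  · intro i j m
    simp only [LinearMap.add_apply, LinearMap.flip_apply, leftMul_apply,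
      outerMul_apply, LinearMap.smul_apply, LinearMap.proj_apply, Pi.add_apply,
      Pi.smul_apply, smul_eq_mul, unitVec, Pi.single_apply, Fin.ext_iff]
    grind

theorem isGamma_ktB2str (hn : 2 ≤ n) (α : k) : IsGamma α (1 - α) (-1) (ktB2str n α) := by
  refine ⟨LinearMap.proj ⟨0, by omega⟩, -unitVec n 0, proj_ne_zero _,
      neg_ne_zero.2 (unitVec_ne_zero (by omega)),
    by simp [unitVec], fun x y => ?_⟩
  rw [ktB2str, ofConst_eq (B := leftMul ((α : k) • LinearMap.proj ⟨0, by omega⟩) +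
    (leftMul (((1 - α) : k) • LinearMap.proj ⟨0, by omega⟩)).flip +
    outerMul (LinearMap.proj ⟨0, by omega⟩) (LinearMap.proj ⟨0, by omega⟩) (-unitVec n 0))]
  · simp only [LinearMap.add_apply, LinearMap.flip_apply, leftMul_apply,
      outerMul_apply, LinearMap.smul_apply, LinearMap.proj_apply, smul_eq_mul]
  · intro i j m
    simp only [LinearMap.add_apply, LinearMap.flip_apply, leftMul_apply,
      outerMul_apply, LinearMap.smul_apply, LinearMap.proj_apply, Pi.add_apply, Pi.neg_apply,
      Pi.smul_apply, smul_eq_mul, unitVec, Pi.single_apply, Fin.ext_iff]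
    grind

theorem isGamma_ktD2str (hn : 2 ≤ n) {α β : k} (h : α + β ≠ 1) :
    IsGamma α β (1 - α - β) (ktD2str n α β) := by
  refine ⟨LinearMap.proj ⟨0, by omega⟩, (1 - α - β) • unitVec n 0, proj_ne_zero _,
      smul_ne_zero (fun h' => h (by linear_combination -h'))
    (unitVec_ne_zero (by omega)),
    by simp [unitVec], fun x y => ?_⟩
  rw [ktD2str, ofConst_eq (B := leftMul ((α : k) • LinearMap.proj ⟨0, by omega⟩) +
    (leftMul ((β : k) • LinearMap.proj ⟨0, by omega⟩)).flip +
    outerMul (LinearMap.proj ⟨0, by omega⟩)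
        (LinearMap.proj ⟨0, by omega⟩) ((1 - α - β) • unitVec n 0))]
  · simp only [LinearMap.add_apply, LinearMap.flip_apply, leftMul_apply,
      outerMul_apply, LinearMap.smul_apply, LinearMap.proj_apply, smul_eq_mul]
  · intro i j m
    simp only [LinearMap.add_apply, LinearMap.flip_apply, leftMul_apply,
      outerMul_apply, LinearMap.smul_apply, LinearMap.proj_apply, Pi.add_apply,
      Pi.smul_apply, smul_eq_mul, unitVec, Pi.single_apply, Fin.ext_iff]
    grind

theorem isE4_kE4str (hn : 2 ≤ n) : IsE4 (kE4str n : AlgStr k n) := by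
  refine ⟨LinearMap.proj ⟨0, by omega⟩, LinearMap.proj ⟨1, by omega⟩,
    linearIndependent_proj_two (Fin.ne_of_val_ne (by simp)), fun x y => ?_⟩
  rw [kE4str, ofConst_eq (B := leftMul (LinearMap.proj ⟨0, by omega⟩) +
    (leftMul (LinearMap.proj ⟨1, by omega⟩)).flip)]
  · simp only [LinearMap.add_apply, LinearMap.flip_apply, leftMul_apply,
      LinearMap.proj_apply]
  · intro i j m
    simp only [LinearMap.add_apply, LinearMap.flip_apply, leftMul_apply,
      LinearMap.proj_apply, Pi.add_apply,
      Pi.smul_apply, smul_eq_mul, Pi.single_apply, Fin.ext_iff]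
    grind

theorem isT_T02str (hn : 3 ≤ n) (α β : k) : IsT β (-β) (α - β) (T02str n α β) := by
  refine ⟨LinearMap.proj ⟨0, by omega⟩, LinearMap.proj ⟨1, by omega⟩,
    unitVec n 2 + (α - β) • unitVec n 1, linearIndependent_proj_two (Fin.ne_of_val_ne (by simp)),
        fun h => ?_,
    by simp [unitVec], by simp [unitVec], fun x y => ?_⟩
  · simpa [unitVec] using congr_fun h ⟨2, by omega⟩
  rw [T02str, ofConst_eq (B := leftMul ((β : k) • LinearMap.proj ⟨0, by omega⟩) +
    (leftMul (((-β) : k) • LinearMap.proj ⟨0, by omega⟩)).flip +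
    (outerMul (LinearMap.proj ⟨0, by omega⟩) (LinearMap.proj ⟨1, by omega⟩)
      (unitVec n 2 + (α - β) • unitVec n 1) -
    (outerMul (LinearMap.proj ⟨0, by omega⟩) (LinearMap.proj ⟨1, by omega⟩)
      (unitVec n 2 + (α - β) • unitVec n 1)).flip))]
  · simp only [LinearMap.add_apply, LinearMap.sub_apply, LinearMap.flip_apply, leftMul_apply,
      outerMul_apply, LinearMap.smul_apply, LinearMap.proj_apply, smul_eq_mul]
    module
  · intro i j m
    simp only [LinearMap.add_apply, LinearMap.sub_apply, LinearMap.flip_apply, leftMul_apply,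
      outerMul_apply, LinearMap.smul_apply, LinearMap.proj_apply, Pi.add_apply, Pi.sub_apply,
      Pi.smul_apply, smul_eq_mul, unitVec, Pi.single_apply, Fin.ext_iff]
    grind

theorem isT_T12str (hn : 3 ≤ n) (α β : k) : IsT β (1 - β) (α - β) (T12str n α β) := by
  refine ⟨LinearMap.proj ⟨0, by omega⟩, LinearMap.proj ⟨1, by omega⟩,
    unitVec n 2 + (α - β) • unitVec n 1, linearIndependent_proj_two (Fin.ne_of_val_ne (by simp)),
        fun h => ?_,
    by simp [unitVec], by simp [unitVec], fun x y => ?_⟩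
  · simpa [unitVec] using congr_fun h ⟨2, by omega⟩
  rw [T12str, ofConst_eq (B := leftMul ((β : k) • LinearMap.proj ⟨0, by omega⟩) +
    (leftMul (((1 - β) : k) • LinearMap.proj ⟨0, by omega⟩)).flip +
    (outerMul (LinearMap.proj ⟨0, by omega⟩) (LinearMap.proj ⟨1, by omega⟩)
      (unitVec n 2 + (α - β) • unitVec n 1) -
    (outerMul (LinearMap.proj ⟨0, by omega⟩) (LinearMap.proj ⟨1, by omega⟩)
      (unitVec n 2 + (α - β) • unitVec n 1)).flip))]
  · simp only [LinearMap.add_apply, LinearMap.sub_apply, LinearMap.flip_apply, leftMul_apply,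
      outerMul_apply, LinearMap.smul_apply, LinearMap.proj_apply, smul_eq_mul]
    module
  · intro i j m
    simp only [LinearMap.add_apply, LinearMap.sub_apply, LinearMap.flip_apply, leftMul_apply,
      outerMul_apply, LinearMap.smul_apply, LinearMap.proj_apply, Pi.add_apply, Pi.sub_apply,
      Pi.smul_apply, smul_eq_mul, unitVec, Pi.single_apply, Fin.ext_iff]
    grind

theorem isF_FabStr (hn : 3 ≤ n) (α β : k) : IsF α β (FabStr n α β) := by
  refine ⟨LinearMap.proj ⟨0, by omega⟩, LinearMap.proj ⟨1, by omega⟩, unitVec n 2,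
    linearIndependent_proj_two (Fin.ne_of_val_ne (by simp)), unitVec_ne_zero (by omega),
    by simp [unitVec], by simp [unitVec], fun x y => ?_⟩
  rw [FabStr, ofConst_eq (B := outerMul (LinearMap.proj ⟨0, by omega⟩)
      (LinearMap.proj ⟨0, by omega⟩) (unitVec n 2) +
    α • outerMul (LinearMap.proj ⟨0, by omega⟩) (LinearMap.proj ⟨1, by omega⟩) (unitVec n 2) +
    β • outerMul (LinearMap.proj ⟨1, by omega⟩) (LinearMap.proj ⟨0, by omega⟩) (unitVec n 2))]
  · simp only [LinearMap.add_apply,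
      outerMul_apply, LinearMap.smul_apply, LinearMap.proj_apply]
    module
  · intro i j m
    simp only [LinearMap.add_apply,
      outerMul_apply, LinearMap.smul_apply, LinearMap.proj_apply, Pi.add_apply,
      Pi.smul_apply, smul_eq_mul, unitVec, Pi.single_apply, Fin.ext_iff]
    grind

theorem isT03_T03str (hn : 4 ≤ n) : IsT03 (T03str n : AlgStr k n) := by
  refine ⟨LinearMap.proj ⟨0, by omega⟩, LinearMap.proj ⟨1, by omega⟩,
    LinearMap.proj ⟨2, by omega⟩, unitVec n 2, unitVec n 3,
    linearIndependent_proj_three (Fin.ne_of_val_ne (by simp)) (Fin.ne_of_val_ne (by simp))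
      (Fin.ne_of_val_ne (by simp)),
    linearIndependent_unitVec_two (by omega) (by omega) (by omega),
    by simp [unitVec], by simp [unitVec], by simp [unitVec], by simp [unitVec], by simp [unitVec],
    by simp [unitVec], fun x y => ?_⟩
  rw [T03str, ofConst_eq (B := (outerMul (LinearMap.proj ⟨0, by omega⟩)
      (LinearMap.proj ⟨1, by omega⟩) (unitVec n 2) -
    (outerMul (LinearMap.proj ⟨0, by omega⟩) (LinearMap.proj ⟨1, by omega⟩) (unitVec n 2)).flip) +
    (outerMul (LinearMap.proj ⟨0, by omega⟩) (LinearMap.proj ⟨2, by omega⟩) (unitVec n 3) -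
    (outerMul (LinearMap.proj ⟨0, by omega⟩) (LinearMap.proj ⟨2, by omega⟩) (unitVec n 3)).flip))]
  · simp only [LinearMap.add_apply, LinearMap.sub_apply, LinearMap.flip_apply, leftMul_apply,
      outerMul_apply, LinearMap.smul_apply, LinearMap.proj_apply, smul_eq_mul]
    module
  · intro i j m
    simp only [LinearMap.add_apply, LinearMap.sub_apply, LinearMap.flip_apply, leftMul_apply,
      outerMul_apply, LinearMap.smul_apply, LinearMap.proj_apply, Pi.add_apply, Pi.sub_apply,
          Pi.neg_apply,
      Pi.smul_apply, smul_eq_mul, unitVec, Pi.single_apply, Fin.ext_iff]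
    grind

theorem isT022_T022str (hn : 5 ≤ n) : IsT022 (T022str n : AlgStr k n) := by
  refine ⟨LinearMap.proj ⟨0, by omega⟩, LinearMap.proj ⟨1, by omega⟩,
    LinearMap.proj ⟨3, by omega⟩, unitVec n 2, unitVec n 4,
    linearIndependent_proj_three (Fin.ne_of_val_ne (by simp)) (Fin.ne_of_val_ne (by simp))
      (Fin.ne_of_val_ne (by simp)),
    linearIndependent_unitVec_two (by omega) (by omega) (by omega),
    by simp [unitVec], by simp [unitVec], by simp [unitVec], by simp [unitVec], by simp [unitVec],
    by simp [unitVec], fun x y => ?_⟩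
  rw [T022str, ofConst_eq (B := (outerMul (LinearMap.proj ⟨0, by omega⟩)
      (LinearMap.proj ⟨1, by omega⟩) (unitVec n 2) -
    (outerMul (LinearMap.proj ⟨0, by omega⟩) (LinearMap.proj ⟨1, by omega⟩) (unitVec n 2)).flip) +
    (outerMul (LinearMap.proj ⟨0, by omega⟩) (LinearMap.proj ⟨3, by omega⟩) (unitVec n 4) -
    (outerMul (LinearMap.proj ⟨0, by omega⟩) (LinearMap.proj ⟨3, by omega⟩) (unitVec n 4)).flip))]
  · simp only [LinearMap.add_apply, LinearMap.sub_apply, LinearMap.flip_apply, leftMul_apply,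
      outerMul_apply, LinearMap.smul_apply, LinearMap.proj_apply, smul_eq_mul]
    module
  · intro i j m
    simp only [LinearMap.add_apply, LinearMap.sub_apply, LinearMap.flip_apply, leftMul_apply,
      outerMul_apply, LinearMap.smul_apply, LinearMap.proj_apply, Pi.add_apply, Pi.sub_apply,
          Pi.neg_apply,
      Pi.smul_apply, smul_eq_mul, unitVec, Pi.single_apply, Fin.ext_iff]
    grind

theorem isEta_etaStr (hn : 5 ≤ n) : IsEta (etaStr n 2 : AlgStr k n) := by
  refine ⟨fun i => LinearMap.proj (Fin.castLE (show 4 ≤ n by omega) i), unitVec n 4,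
    linearIndependent_proj (Fin.castLE_injective (show 4 ≤ n by omega)),
    unitVec_ne_zero (by omega), fun i => by
      have : (i : ℕ) ≠ 4 := by omega
      simp [unitVec, this], fun x y => ?_⟩
  rw [etaStr, ofConst_eq (B := (outerMul (LinearMap.proj ⟨0, by omega⟩)
      (LinearMap.proj ⟨1, by omega⟩) (unitVec n 4) -
    (outerMul (LinearMap.proj ⟨0, by omega⟩) (LinearMap.proj ⟨1, by omega⟩) (unitVec n 4)).flip) +
    (outerMul (LinearMap.proj ⟨2, by omega⟩) (LinearMap.proj ⟨3, by omega⟩) (unitVec n 4) -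
    (outerMul (LinearMap.proj ⟨2, by omega⟩) (LinearMap.proj ⟨3, by omega⟩) (unitVec n 4)).flip))]
  · simp only [LinearMap.add_apply, LinearMap.sub_apply, LinearMap.flip_apply, leftMul_apply,
      outerMul_apply, LinearMap.smul_apply, LinearMap.proj_apply, smul_eq_mul]
    rw [← sub_smul, ← sub_smul, ← add_smul]
    rfl
  · intro i j m
    simp only [LinearMap.add_apply, LinearMap.sub_apply, LinearMap.flip_apply, leftMul_apply,
      outerMul_apply, LinearMap.smul_apply, LinearMap.proj_apply, Pi.add_apply, Pi.sub_apply,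
          Pi.neg_apply,
      Pi.smul_apply, smul_eq_mul, unitVec, Pi.single_apply, Fin.ext_iff]
    grind (splits := 30)

end StandardStructures

section Lists

variable {n : ℕ} {μ ν : AlgStr k n}

theorem IsGamma.of_mem_orbit {α β γ : k} (h : IsGamma α β γ μ) (hν : ν ∈ orbit μ) :
    IsGamma α β γ ν := isGamma_iff.2 ((isGamma_iff.1 h).of_mem_orbit hν)

theorem IsGamma.mem_orbit {α β γ : k} (h : IsGamma α β γ μ) (h' : IsGamma α β γ ν) :
    ν ∈ orbit μ := (isGamma_iff.1 h).mem_orbit (isGamma_iff.1 h')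

theorem IsT.of_mem_orbit {α β γ : k} (h : IsT α β γ μ) (hν : ν ∈ orbit μ) :
    IsT α β γ ν := isT_iff.2 ((isT_iff.1 h).of_mem_orbit hν)

theorem IsT.mem_orbit {α β γ : k} (h : IsT α β γ μ) (h' : IsT α β γ ν) :
    ν ∈ orbit μ := (isT_iff.1 h).mem_orbit (isT_iff.1 h')

theorem IsF.of_mem_orbit {α β : k} (h : IsF α β μ) (hν : ν ∈ orbit μ) :
    IsF α β ν := isF_iff.2 ((isF_iff.1 h).of_mem_orbit hν)

theorem IsF.mem_orbit {α β : k} (h : IsF α β μ) (h' : IsF α β ν) :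
    ν ∈ orbit μ := (isF_iff.1 h).mem_orbit (isF_iff.1 h')

theorem IsScalar.of_mem_orbit {α β : k} (h : IsScalar α β μ) (hν : ν ∈ orbit μ) :
    IsScalar α β ν := isScalar_iff.2 ((isScalar_iff.1 h).of_mem_orbit hν)

theorem IsScalar.mem_orbit {α β : k} (h : IsScalar α β μ) (h' : IsScalar α β ν) :
    ν ∈ orbit μ := (isScalar_iff.1 h).mem_orbit (isScalar_iff.1 h')

theorem IsA3.of_mem_orbit (h : IsA3 μ) (hν : ν ∈ orbit μ) : IsA3 ν :=
  isA3_iff.2 ((isA3_iff.1 h).of_mem_orbit hν)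

theorem IsA3.mem_orbit (h : IsA3 μ) (h' : IsA3 ν) : ν ∈ orbit μ :=
  (isA3_iff.1 h).mem_orbit (isA3_iff.1 h')

theorem IsE4.of_mem_orbit (h : IsE4 μ) (hν : ν ∈ orbit μ) : IsE4 ν :=
  isE4_iff.2 ((isE4_iff.1 h).of_mem_orbit hν)

theorem IsE4.mem_orbit (h : IsE4 μ) (h' : IsE4 ν) : ν ∈ orbit μ :=
  (isE4_iff.1 h).mem_orbit (isE4_iff.1 h')

theorem IsEta.of_mem_orbit (h : IsEta μ) (hν : ν ∈ orbit μ) : IsEta ν :=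
  isEta_iff.2 ((isEta_iff.1 h).of_mem_orbit hν)

theorem IsEta.mem_orbit (h : IsEta μ) (h' : IsEta ν) : ν ∈ orbit μ :=
  (isEta_iff.1 h).mem_orbit (isEta_iff.1 h')

theorem IsT022.of_mem_orbit (h : IsT022 μ) (hν : ν ∈ orbit μ) : IsT022 ν :=
  isT022_iff.2 ((isT022_iff.1 h).of_mem_orbit hν)

theorem IsT022.mem_orbit (h : IsT022 μ) (h' : IsT022 ν) : ν ∈ orbit μ :=
  (isT022_iff.1 h).mem_orbit (isT022_iff.1 h')

theorem IsT03.of_mem_orbit (h : IsT03 μ) (hν : ν ∈ orbit μ) : IsT03 ν :=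
  isT03_iff.2 ((isT03_iff.1 h).of_mem_orbit hν)

theorem IsT03.mem_orbit (h : IsT03 μ) (h' : IsT03 ν) : ν ∈ orbit μ :=
  (isT03_iff.1 h).mem_orbit (isT03_iff.1 h')

theorem isE4_iff_mem_orbit (hn : 2 ≤ n) : IsE4 μ ↔ μ ∈ orbit (kE4str n) :=
  ⟨(isE4_kE4str hn).mem_orbit, (isE4_kE4str hn).of_mem_orbit⟩

theorem isF_iff_mem_orbit (hn : 3 ≤ n) (α β : k) : IsF α β μ ↔ μ ∈ orbit (FabStr n α β) :=
  ⟨(isF_FabStr hn α β).mem_orbit, (isF_FabStr hn α β).of_mem_orbit⟩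

theorem isT03_iff_mem_orbit (hn : 4 ≤ n) : IsT03 μ ↔ μ ∈ orbit (T03str n) :=
  ⟨(isT03_T03str hn).mem_orbit, (isT03_T03str hn).of_mem_orbit⟩

theorem isT022_iff_mem_orbit (hn : 5 ≤ n) : IsT022 μ ↔ μ ∈ orbit (T022str n) :=
  ⟨(isT022_T022str hn).mem_orbit, (isT022_T022str hn).of_mem_orbit⟩

theorem isEta_iff_mem_orbit (hn : 5 ≤ n) : IsEta μ ↔ μ ∈ orbit (etaStr n 2) :=
  ⟨(isEta_etaStr hn).mem_orbit, (isEta_etaStr hn).of_mem_orbit⟩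

theorem exists_isGamma_iff (hn : 2 ≤ n) :
    (∃ α β γ : k, (α, β, γ) ≠ 0 ∧ IsGamma α β γ μ) ↔
      (∃ α : k, μ ∈ orbit (kA1str n α)) ∨ μ ∈ orbit (kA2str n) ∨
        (∃ α : k, μ ∈ orbit (ktB2str n α)) ∨
        (∃ α β : k, α + β ≠ 1 ∧ μ ∈ orbit (ktD2str n α β)) := by
  constructor
  · rintro ⟨α, β, γ, h0, h⟩
    by_cases hγ : γ = 0
    · subst hγ
      by_cases hs : α + β = 0
      · refine .inr (.inl ((isGamma_kA2str hn).mem_orbit ?_))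
        have hα : α ≠ 0 := by rintro rfl; exact h0 (by simpa using hs)
        convert h.smul (inv_ne_zero hα) using 1
        · field_simp
        · rw [eq_neg_of_add_eq_zero_right hs]; field_simp
        · simp
      · refine .inl ⟨(α + β)⁻¹ * α, (isGamma_kA1str hn _).mem_orbit ?_⟩
        convert h.smul (inv_ne_zero hs) using 1
        · field_simp; ring
        · simp
    · by_cases hs : α + β + γ = 0
      · have hs' : α + β ≠ 0 := fun h => hγ (by simpa [h] using hs)
        refine .inr (.inr (.inl ⟨(α + β)⁻¹ * α, (isGamma_ktB2str hn _).mem_orbit ?_⟩))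
        convert h.smul (inv_ne_zero hs') using 1
        · field_simp; ring
        · field_simp; linear_combination -hs
      · refine .inr (.inr (.inr ⟨(α + β + γ)⁻¹ * α, (α + β + γ)⁻¹ * β, fun h => hγ ?_,
          (isGamma_ktD2str hn fun h => hγ ?_).mem_orbit ?_⟩))
        · field_simp at h; linear_combination -h
        · field_simp at h; linear_combination -h
        · convert h.smul (inv_ne_zero hs) using 1
          field_simp; ring
  · rintro (⟨α, h⟩ | h | ⟨α, h⟩ | ⟨α, β, hne, h⟩)
    · exact ⟨_, _, _, by simp +contextual, (isGamma_kA1str hn α).of_mem_orbit h⟩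
    · exact ⟨_, _, _, by simp, (isGamma_kA2str hn).of_mem_orbit h⟩
    · exact ⟨_, _, _, by simp, (isGamma_ktB2str hn α).of_mem_orbit h⟩
    · exact ⟨_, _, _, by simp +contextual, (isGamma_ktD2str hn hne).of_mem_orbit h⟩

theorem exists_isT_iff (hn : 3 ≤ n) :
    (∃ β₁ β₂ δ : k, (β₁, β₂, δ) ≠ 0 ∧ IsT β₁ β₂ δ μ) ↔
      (∃ α β : k, (α, β) ≠ (0, 0) ∧ μ ∈ orbit (T02str n α β)) ∨
        ∃ α β : k, μ ∈ orbit (T12str n α β) := by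
  constructor
  · rintro ⟨β₁, β₂, δ, h0, h⟩
    by_cases hs : β₁ + β₂ = 0
    · obtain rfl := eq_neg_of_add_eq_zero_right hs
      refine .inl ⟨δ + β₁, β₁, fun h => h0 ?_, (isT_T02str hn _ _).mem_orbit ?_⟩
      · simp only [Prod.mk.injEq] at h
        simpa [h.2] using h.1
      · simpa using h
    · refine .inr ⟨(β₁ + β₂)⁻¹ * δ + (β₁ + β₂)⁻¹ * β₁, (β₁ + β₂)⁻¹ * β₁,
        (isT_T12str hn _ _).mem_orbit ?_⟩
      convert h.smul (inv_ne_zero hs) using 1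
      · field_simp; ring
      · ring
  · rintro (⟨α, β, h0, h⟩ | ⟨α, β, h⟩)
    · refine ⟨_, _, _, fun h' => h0 ?_, (isT_T02str hn α β).of_mem_orbit h⟩
      simp only [Prod.mk_eq_zero] at h'
      simpa [h'.1] using h'.2.2
    · exact ⟨_, _, _, by simp +contextual, (isT_T12str hn α β).of_mem_orbit h⟩

/-- The algebras of level at most one. -/
def IsLow (μ : AlgStr k n) : Prop :=
  μ = 0 ∨ IsA3 μ ∨ IsT 0 0 0 μ ∨ ∃ a b : k, IsScalar a b μ

/-- The algebras of level two. -/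
def IsListed (μ : AlgStr k n) : Prop :=
  (∃ α β γ : k, (α, β, γ) ≠ 0 ∧ IsGamma α β γ μ) ∨ IsE4 μ ∨
    (∃ α β : k, (α, β) ≠ 0 ∧ IsF α β μ) ∨
    (3 ≤ n ∧ ∃ β₁ β₂ δ : k, (β₁, β₂, δ) ≠ 0 ∧ IsT β₁ β₂ δ μ) ∨
    (n = 4 ∧ IsT03 μ) ∨ IsT022 μ ∨ IsEta μ

theorem IsListed.of_mem_orbit (h : IsListed μ) (hν : ν ∈ orbit μ) : IsListed ν := by
  rcases h with ⟨α, β, γ, h0, h⟩ | h | ⟨α, β, h0, h⟩ | ⟨hn, α, β, γ, h0, h⟩ | ⟨hn, h⟩ | h | h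
  · exact .inl ⟨α, β, γ, h0, h.of_mem_orbit hν⟩
  · exact .inr (.inl (h.of_mem_orbit hν))
  · exact .inr (.inr (.inl ⟨α, β, h0, h.of_mem_orbit hν⟩))
  · exact .inr (.inr (.inr (.inl ⟨hn, α, β, γ, h0, h.of_mem_orbit hν⟩)))
  · exact .inr (.inr (.inr (.inr (.inl ⟨hn, h.of_mem_orbit hν⟩))))
  · exact .inr (.inr (.inr (.inr (.inr (.inl (h.of_mem_orbit hν))))))
  · exact .inr (.inr (.inr (.inr (.inr (.inr (h.of_mem_orbit hν))))))

/-- Linearly independent functionals vanishing on linearly independent vectors. -/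
theorem add_le_of_pairing_eq_zero {r s : ℕ} {φ : Fin r → (Fin n → k) →ₗ[k] k}
    {v : Fin s → Fin n → k} (hφ : LinearIndependent k φ) (hv : LinearIndependent k v)
    (h : ∀ i j, φ i (v j) = 0) : r + s ≤ n := by
  obtain ⟨w, hw⟩ := exists_dual_vectors hφ
  have : LinearIndependent k (Sum.elim w v) := by
    rw [Fintype.linearIndependent_iff]
    intro g hg
    simp only [Fintype.sum_sum_type, Sum.elim_inl, Sum.elim_inr] at hg
    have h1 : ∀ i, g (.inl i) = 0 := fun i => by
      simpa [hw, h] using congr_arg (φ i) hg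
    have h2 := Fintype.linearIndependent_iff.1 hv (fun j => g (.inr j)) (by simpa [h1] using hg)
    rintro (i | j)
    exacts [h1 i, h2 j]
  simpa using this.fintype_card_le_finrank

theorem IsF.three_le {α β : k} (h : IsF α β μ) : 3 ≤ n := by
  obtain ⟨φ, v, hφ, hv, h, -⟩ := isF_iff.1 h
  exact add_le_of_pairing_eq_zero hφ hv h

theorem IsT022.five_le (h : IsT022 μ) : 5 ≤ n := by
  obtain ⟨φ, v, hφ, hv, h, -⟩ := isT022_iff.1 h
  exact add_le_of_pairing_eq_zero hφ hv h

theorem IsEta.five_le (h : IsEta μ) : 5 ≤ n := by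
  obtain ⟨φ, v, hφ, hv, h, -⟩ := isEta_iff.1 h
  exact add_le_of_pairing_eq_zero hφ hv h

end Lists

section Levels

variable {n : ℕ} {μ : AlgStr k n}

theorem eq_zero_of_zero_mem_orbit (h : (0 : AlgStr k n) ∈ orbit μ) : μ = 0 := by
  obtain ⟨g, hg⟩ := mem_orbit_iff_equiv.1 (mem_orbit_symm h)
  refine LinearMap.ext₂ fun x y => g.injective ?_
  rw [hg]
  simp

theorem not_properlyDegenerates_zero {χ : AlgStr k n} : ¬ properlyDegenerates 0 χ := by
  rintro ⟨h, h'⟩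
  refine h' ?_
  have : χ = 0 := by
    have := h {0} ⟨Set.range MvPolynomial.X, fun ν => ?_⟩ ?_
    · simpa using this
    · simp only [Set.mem_singleton_iff, Set.forall_mem_range, MvPolynomial.eval_X]
      refine ⟨by rintro rfl; simp [structConst], fun h => ?_⟩
      refine LinearMap.pi_ext' fun i => LinearMap.ext_ring ?_
      exact LinearMap.pi_ext' fun j => LinearMap.ext_ring (funext fun m => h (i, j, m))
    · intro ν hν
      exact eq_zero_of_zero_mem_orbit (mem_orbit_symm hν)
  rw [this]
  exact mem_orbit_self _

theorem levelIs_two_iff_of [Infinite k] {Low L : AlgStr k n → Prop}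
    (hLow : ∀ μ χ, Low μ → degenerates μ χ → χ = 0 ∨ χ ∈ orbit μ)
    (hL : ∀ μ ν, L μ → ν ∈ orbit μ → L ν)
    (hcover : ∀ μ, Low μ ∨ ∃ ν, L ν ∧ degenerates μ ν)
    (hclosure : ∀ μ χ, L μ → degenerates μ χ → χ ∈ orbit μ ∨ Low χ)
    (hproper : ∀ μ, L μ → ∃ χ ≠ 0, properlyDegenerates μ χ) (μ : AlgStr k n) :
    levelIs μ 2 ↔ L μ := by
  have hzero : ∀ χ : AlgStr k n, χ ≠ 0 → properlyDegenerates χ 0 := fun χ h =>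
    ⟨degenerates_zero χ, fun h' => h (eq_zero_of_zero_mem_orbit h')⟩
  have hlow : ∀ μ χ ν, Low μ → properlyDegenerates μ χ → ¬ properlyDegenerates χ ν := by
    rintro μ χ ν h ⟨h₁, h₂⟩ h₃
    rw [(hLow μ χ h h₁).resolve_right h₂] at h₃
    exact not_properlyDegenerates_zero h₃
  constructor
  · rintro ⟨⟨c, rfl, hc⟩, hno⟩
    rcases hcover (c 2) with h | ⟨ν, hν, hd⟩
    · exact absurd (hc 0 (by omega)) (hlow _ _ _ h (hc 1 (by omega)))
    · by_cases hmem : ν ∈ orbit (c 2)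
      · exact hL _ _ hν (mem_orbit_symm hmem)
      · obtain ⟨χ, h0, hχ⟩ := hproper ν hν
        refine absurd ⟨fun i => if i = 0 then 0 else if i = 1 then χ else if i = 2 then ν else c 2,
          by simp, fun i hi => ?_⟩ hno
        interval_cases i
        · simpa using hzero χ h0
        · simpa using hχ
        · simpa using ⟨hd, hmem⟩
  · intro h
    constructor
    · obtain ⟨χ, h0, hχ⟩ := hproper μ h
      refine ⟨fun i => if i = 0 then 0 else if i = 1 then χ else μ, by simp, fun i hi => ?_⟩
      interval_cases i
      · simpa using hzero χ h0
      · simpa using hχ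
    · rintro ⟨c, rfl, hc⟩
      obtain ⟨h₁, h₂⟩ := hc 2 (by omega)
      exact hlow _ _ _ ((hclosure _ _ h h₁).resolve_left h₂) (hc 1 (by omega)) (hc 0 (by omega))

end Levels

section RankOne

variable {V W : Type*} [AddCommGroup V] [Module k V] [AddCommGroup W] [Module k W]

theorem eq_of_forall_dual {v w : W} (h : ∀ f : W →ₗ[k] k, f v = f w) : v = w := by
  rw [← sub_eq_zero, ← Module.forall_dual_apply_eq_zero_iff k]
  exact fun f => by rw [map_sub, h, sub_self]

theorem exists_dual_eq_one {v : W} (hv : v ≠ 0) : ∃ f : W →ₗ[k] k, f v = 1 := by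
  obtain ⟨f, hf⟩ := exists_dual_family
    (show LinearIndependent k ![v] from LinearIndependent.of_subsingleton 0 hv)
  exact ⟨f 0, by simpa using hf 0 0⟩

theorem exists_apply_eq_one {φ : V →ₗ[k] k} (hφ : φ ≠ 0) : ∃ v, φ v = 1 := by
  obtain ⟨v, hv⟩ := DFunLike.ne_iff.1 hφ
  exact ⟨(φ v)⁻¹ • v, by simpa using inv_mul_cancel₀ hv⟩

theorem linearIndependent_pair_of_apply_ne {φ ψ : V →ₗ[k] k} {x y : V}
    (h : φ x * ψ y - φ y * ψ x ≠ 0) : LinearIndependent k ![φ, ψ] := by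
  rw [LinearIndependent.pair_iff]
  intro s t hst
  have hx := LinearMap.congr_fun hst x
  have hy := LinearMap.congr_fun hst y
  simp only [LinearMap.add_apply, LinearMap.smul_apply, smul_eq_mul, LinearMap.zero_apply] at hx hy
  constructor
  · refine (mul_eq_zero.1 (?_ : s * (φ x * ψ y - φ y * ψ x) = 0)).resolve_right h
    linear_combination ψ y * hx - ψ x * hy
  · refine (mul_eq_zero.1 (?_ : t * (φ x * ψ y - φ y * ψ x) = 0)).resolve_right h
    linear_combination φ x * hy - φ y * hx

theorem exists_symmetric_rank_one {b : V →ₗ[k] V →ₗ[k] W}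
    (h : ∀ (f g : W →ₗ[k] k) (x y z w : V), f (b x y) * g (b z w) = f (b x z) * g (b y w)) :
    ∃ (φ : V →ₗ[k] k) (v : W), ∀ x y, b x y = (φ x * φ y) • v := by
  by_cases h0 : b = 0
  · exact ⟨0, 0, by simp [h0]⟩
  · obtain ⟨p, hp⟩ := DFunLike.ne_iff.1 h0
    obtain ⟨q, hq⟩ := DFunLike.ne_iff.1 hp
    obtain ⟨f, hf⟩ := exists_dual_eq_one (k := k) (v := b p q) (by simpa using hq)
    have hpp : f (b p p) ≠ 0 := left_ne_zero_of_mul (b := f (b q q)) (by simp [h f f p p q q, hf])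
    refine ⟨f ∘ₗ b p, ((f (b p p)) ^ 2)⁻¹ • b p p, fun z w => eq_of_forall_dual (k := k) fun g =>
        ?_⟩
    have h1 := h f g p p z w
    have h2 := h g f p w p p
    have h3 := h f f p w p p
    simp only [LinearMap.comp_apply, map_smul, smul_eq_mul]
    rw [mul_comm] at h2
    field_simp
    linear_combination f (b p p) * h1 + f (b p z) * h2 - f (b p z) * g (b p p) * h3 *
      (f (b p p))⁻¹ + (f (b p z) * g (b p p)) * (f (b p w) - f (b w p)) * (mul_inv_cancel₀ hpp)

theorem eq_zero_or_exists_alternating_rank_one {b : V →ₗ[k] V →ₗ[k] W} (hb : ∀ x, b x x = 0)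
    (h : ∀ (f g : W →ₗ[k] k) (x y z w : V),
      f (b x y) * g (b z w) - f (b x z) * g (b y w) + f (b x w) * g (b y z) = 0) :
    b = 0 ∨ ∃ (φ ψ : V →ₗ[k] k) (v : W), LinearIndependent k ![φ, ψ] ∧ v ≠ 0 ∧
      ∀ x y, b x y = (φ x * ψ y - φ y * ψ x) • v := by
  refine or_iff_not_imp_left.2 fun h0 => ?_
  obtain ⟨p, hp⟩ := DFunLike.ne_iff.1 h0
  obtain ⟨q, hq⟩ := DFunLike.ne_iff.1 hp
  obtain ⟨f, hf⟩ := exists_dual_eq_one (k := k) (v := b p q) (by simpa using hq)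
  have hneg : ∀ x y, b x y = -b y x := fun x y => by
    have := hb (x + y)
    simp only [map_add, LinearMap.add_apply, hb, zero_add, add_zero] at this
    rwa [add_comm, add_eq_zero_iff_eq_neg] at this
  refine ⟨f ∘ₗ b p, f ∘ₗ b q, b p q, ?_, by simpa using hq, fun z w => ?_⟩
  · exact linearIndependent_pair_of_apply_ne (x := q) (y := p) (by simp [hneg q p, hf, hb])
  · refine eq_of_forall_dual (k := k) fun g => ?_
    have h1 := h f g p q z w
    have h2 := fun w => h f g q p q w
    simp only [hneg q p, hb, map_neg, map_zero, hf] at h1 h2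
    simp only [LinearMap.comp_apply, map_smul, smul_eq_mul]
    linear_combination h1 - f (b p z) * h2 w + f (b p w) * h2 z

theorem exists_rank_decomposition [FiniteDimensional k V] (D : V →ₗ[k] W) :
    ∃ (r : ℕ) (φ : Fin r → V →ₗ[k] k) (v : Fin r → W), LinearIndependent k φ ∧
      LinearIndependent k v ∧ ∀ x, D x = ∑ i, φ i x • v i := by
  let b := Module.finBasis k (LinearMap.range D)
  refine ⟨_, fun i => b.coord i ∘ₗ D.rangeRestrict, fun i => (b i : W), ?_, ?_, fun x => ?_⟩
  · refine b.linearIndependent_coord.map' (LinearMap.lcomp k k D.rangeRestrict)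
      (LinearMap.ker_eq_bot.2 fun f g hfg => LinearMap.ext fun y => ?_)
    obtain ⟨x, rfl⟩ := D.surjective_rangeRestrict y
    exact LinearMap.congr_fun hfg x
  · exact b.linearIndependent.map' (Submodule.subtype _) (Submodule.ker_subtype _)
  · have h := congr_arg (Submodule.subtype _) (b.sum_repr (D.rangeRestrict x)).symm
    rw [map_sum] at h
    exact h

end RankOne

section ClosedTools

variable [IsAlgClosed k] {n : ℕ} {μ χ : AlgStr k n}

theorem exists_functional_of_degenerates (h : degenerates μ χ)
    {C : AlgStr k n → ((Fin n → k) →ₗ[k] k) → Prop} (hC : ClosedCond fun ν φ _ => C ν φ)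
    (hμ : ∀ ν ∈ orbit μ, ∃ φ ≠ 0, ∀ c : k, C ν (c • φ)) : ∃ φ ≠ 0, C χ φ := by
  obtain ⟨φ, t, h0, h1, rfl⟩ := exists_of_degenerates h
    (hC.and (ClosedCond.eq AlgPoly.param (AlgPoly.const 0))) fun ν hν => by
      obtain ⟨φ, h0, h1⟩ := hμ ν hν
      exact ⟨φ, 0, .inl h0, fun c => ⟨h1 c, by simp⟩⟩
  exact ⟨φ, by simpa using h0, h1⟩

theorem closed_of_degenerates (h : degenerates μ χ)
    {C : AlgStr k n → Prop} (hC : ClosedCond fun ν _ _ => C ν)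
    (hμ : ∀ ν ∈ orbit μ, C ν) : C χ := by
  obtain ⟨φ, t, h0, h1⟩ := exists_of_degenerates h hC fun ν hν =>
    ⟨0, 1, .inr one_ne_zero, fun _ => hμ ν hν⟩
  exact h1

theorem mem_of_degenerates (h : degenerates μ χ) (S : Submodule k (AlgStr k n))
    (hμ : ∀ ν ∈ orbit μ, ν ∈ S) : χ ∈ S := by
  by_contra hχ
  obtain ⟨f, hf, hS⟩ := Submodule.exists_le_ker_of_notMem (K := k) (V := AlgStr k n) (p := S) hχ
  exact hf (closed_of_degenerates (C := fun ν => f ν = 0) h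
    (.eq (AlgPoly.self.map f) (.const 0)) fun ν hν => hS (hμ ν hν))

end ClosedTools

section Closure

variable {n : ℕ} {μ χ : AlgStr k n}

theorem exists_dual_pair {φ ψ : (Fin n → k) →ₗ[k] k} (h : LinearIndependent k ![φ, ψ]) :
    ∃ x y, φ x = 1 ∧ φ y = 0 ∧ ψ x = 0 ∧ ψ y = 1 := by
  obtain ⟨v, hv⟩ := exists_dual_vectors h
  exact ⟨v 0, v 1, by simpa using hv 0 0, by simpa using hv 0 1, by simpa using hv 1 0,
    by simpa using hv 1 1⟩

theorem exists_dual_triple {φ ψ χ : (Fin n → k) →ₗ[k] k} (h : LinearIndependent k ![φ, ψ, χ]) :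
    ∃ x y z, (φ x = 1 ∧ φ y = 0 ∧ φ z = 0) ∧ (ψ x = 0 ∧ ψ y = 1 ∧ ψ z = 0) ∧
      χ x = 0 ∧ χ y = 0 ∧ χ z = 1 := by
  obtain ⟨v, hv⟩ := exists_dual_vectors h
  refine ⟨v 0, v 1, v 2, ⟨?_, ?_, ?_⟩, ⟨?_, ?_, ?_⟩, ?_, ?_, ?_⟩
  · simpa using hv 0 0
  · simpa using hv 0 1
  · simpa using hv 0 2
  · simpa using hv 1 0
  · simpa using hv 1 1
  · simpa using hv 1 2
  · simpa using hv 2 0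
  · simpa using hv 2 1
  · simpa using hv 2 2

theorem eq_zero_or_isA3_of_rank_one {φ : (Fin n → k) →ₗ[k] k} {v : Fin n → k}
    (hχ : ∀ x y, χ x y = (φ x * φ y) • v) (h : ∀ x y z, χ (χ x y) z = 0) : χ = 0 ∨ IsA3 χ := by
  by_cases hφ : φ = 0
  · exact .inl (LinearMap.ext₂ fun x y => by simp [hχ, hφ])
  by_cases hv : v = 0
  · exact .inl (LinearMap.ext₂ fun x y => by simp [hχ, hv])
  obtain ⟨e, he⟩ := exists_apply_eq_one hφ
  refine .inr ⟨φ, v, hφ, hv, ?_, hχ⟩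
  simpa [hχ, he, hv] using h e e e

theorem eq_zero_or_isA3 (h : ∀ (f g : (Fin n → k) →ₗ[k] k) (x y z w : Fin n → k),
      f (χ x y) * g (χ z w) = f (χ x z) * g (χ y w))
    (h0 : ∀ x y z, χ (χ x y) z = 0) : χ = 0 ∨ IsA3 χ := by
  obtain ⟨φ, v, hχ⟩ := exists_symmetric_rank_one h
  exact eq_zero_or_isA3_of_rank_one hχ h0

theorem eq_zero_or_isT_of_alternating (hb : ∀ x, χ x x = 0)
    (h : ∀ (f g : (Fin n → k) →ₗ[k] k) (x y z w : Fin n → k),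
      f (χ x y) * g (χ z w) - f (χ x z) * g (χ y w) + f (χ x w) * g (χ y z) = 0)
    (h0 : ∀ x y z, χ (χ x y) z = 0) : χ = 0 ∨ IsT 0 0 0 χ := by
  refine (eq_zero_or_exists_alternating_rank_one hb h).imp_right ?_
  rintro ⟨φ, ψ, v, hli, hv, hχ⟩
  obtain ⟨x, y, h1, h2, h3, h4⟩ := exists_dual_pair hli
  refine ⟨φ, ψ, v, hli, hv, ?_, ?_, fun x y => by simp [hχ]⟩
  · simpa [hχ, h1, h2, h3, h4, hv] using h0 x y y
  · simpa [hχ, h1, h2, h3, h4, hv] using h0 x y x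

theorem isLow_of_scalar {φ : (Fin n → k) →ₗ[k] k} (a b : k)
    (h : ∀ x y, χ x y = (a * φ x) • y + (b * φ y) • x) : χ = 0 ∨ IsScalar a b χ := by
  by_cases hφ : φ = 0
  · exact .inl (LinearMap.ext₂ fun x y => by simp [h, hφ])
  · exact .inr ⟨φ, hφ, h⟩

variable [IsAlgClosed k]

theorem IsA3.degenerates (h : IsA3 μ) (hd : degenerates μ χ) : χ = 0 ∨ IsA3 χ := by
  have key : (∀ (f g : (Fin n → k) →ₗ[k] k) (x y z w : Fin n → k),
      f (χ x y) * g (χ z w) = f (χ x z) * g (χ y w)) ∧ ∀ x y z, χ (χ x y) z = 0 := by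
    refine closed_of_degenerates (C := fun χ => (∀ (f g : (Fin n → k) →ₗ[k] k)
      (x y z w : Fin n → k), f (χ x y) * g (χ z w) = f (χ x z) * g (χ y w)) ∧
      ∀ x y z, χ (χ x y) z = 0) hd ?_ fun ν hν => ?_
    · repeat' first
        | exact AlgPoly.const _ | refine ClosedCond.and ?_ ?_
        | refine ClosedCond.all fun _ => ?_ | refine ClosedCond.eq ?_ ?_ | apply AlgPoly.mul
        | apply AlgPoly.str | apply AlgPoly.map
    · obtain ⟨φ, v, hφ, hv, h0, hν⟩ := h.of_mem_orbit hν
      refine ⟨fun f g x y z w => ?_, fun x y z => by simp [hν, h0]⟩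
      simp only [hν, map_smul, smul_eq_mul]
      ring
  exact eq_zero_or_isA3 key.1 key.2

theorem IsT.degenerates_zero (h : IsT 0 0 0 μ) (hd : degenerates μ χ) :
    χ = 0 ∨ IsT 0 0 0 χ := by
  have key : (∀ x, χ x x = 0) ∧ (∀ (f g : (Fin n → k) →ₗ[k] k) (x y z w : Fin n → k),
      f (χ x y) * g (χ z w) - f (χ x z) * g (χ y w) + f (χ x w) * g (χ y z) = 0) ∧
      ∀ x y z, χ (χ x y) z = 0 := by
    refine closed_of_degenerates (C := fun χ => (∀ x, χ x x = 0) ∧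
      (∀ (f g : (Fin n → k) →ₗ[k] k) (x y z w : Fin n → k),
      f (χ x y) * g (χ z w) - f (χ x z) * g (χ y w) + f (χ x w) * g (χ y z) = 0) ∧
      ∀ x y z, χ (χ x y) z = 0) hd ?_ fun ν hν => ?_
    · repeat' first
        | exact AlgPoly.const _ | refine ClosedCond.and ?_ ?_
        | refine ClosedCond.all fun _ => ?_ | refine ClosedCond.eq ?_ ?_ | apply AlgPoly.add
        | apply AlgPoly.sub | apply AlgPoly.mul | apply AlgPoly.str | apply AlgPoly.map
    · obtain ⟨φ, ψ, v, hφ, hv, h0, h1, hν⟩ := h.of_mem_orbit hν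
      refine ⟨fun x => by simp [hν, mul_comm], fun f g x y z w => ?_,
        fun x y z => by simp [hν, h0, h1]⟩
      simp only [hν, map_smul, map_add, smul_eq_mul]
      ring
  exact eq_zero_or_isT_of_alternating key.1 key.2.1 key.2.2

theorem IsScalar.degenerates {a b : k} (h : IsScalar a b μ) (hd : degenerates μ χ) :
    χ = 0 ∨ IsScalar a b χ := by
  let S : Submodule k (AlgStr k n) :=
    { carrier := {ν | ∃ φ : (Fin n → k) →ₗ[k] k, ∀ x y, ν x y = (a * φ x) • y + (b * φ y) • x}
      add_mem' := by
        rintro ν ν' ⟨φ, hφ⟩ ⟨ψ, hψ⟩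
        refine ⟨φ + ψ, fun x y => ?_⟩
        simp only [LinearMap.add_apply, hφ, hψ]
        module
      zero_mem' := ⟨0, by simp⟩
      smul_mem' := by
        rintro c ν ⟨φ, hφ⟩
        refine ⟨c • φ, fun x y => ?_⟩
        simp only [LinearMap.smul_apply, hφ, smul_eq_mul]
        module }
  obtain ⟨φ, hφ⟩ : χ ∈ S := mem_of_degenerates hd S fun ν hν => by
    obtain ⟨φ, -, hφ⟩ := h.of_mem_orbit hν
    exact ⟨φ, hφ⟩
  exact isLow_of_scalar a b hφ

theorem IsE4.degenerates (h : IsE4 μ) (hd : degenerates μ χ) : IsE4 χ ∨ IsLow χ := by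
  let S : Submodule k (AlgStr k n) :=
    { carrier := {ν | ∃ φ ψ : (Fin n → k) →ₗ[k] k, ∀ x y, ν x y = φ x • y + ψ y • x}
      add_mem' := by
        rintro ν ν' ⟨φ, ψ, hφ⟩ ⟨φ', ψ', hψ⟩
        refine ⟨φ + φ', ψ + ψ', fun x y => ?_⟩
        simp only [LinearMap.add_apply, hφ, hψ]
        module
      zero_mem' := ⟨0, 0, by simp⟩
      smul_mem' := by
        rintro c ν ⟨φ, ψ, hφ⟩
        refine ⟨c • φ, c • ψ, fun x y => ?_⟩
        simp only [LinearMap.smul_apply, hφ, smul_eq_mul]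
        module }
  obtain ⟨φ, ψ, hφ⟩ : χ ∈ S := mem_of_degenerates hd S fun ν hν => by
    obtain ⟨φ, ψ, -, hφ⟩ := h.of_mem_orbit hν
    exact ⟨φ, ψ, hφ⟩
  refine or_iff_not_imp_left.2 fun hE => ?_
  have hli : ¬ LinearIndependent k ![φ, ψ] := fun hli => hE ⟨φ, ψ, hli, hφ⟩
  rw [LinearIndependent.pair_iff] at hli
  push Not at hli
  obtain ⟨s, t, hst, hne⟩ := hli
  by_cases hs : s = 0
  · have h0 : ψ = 0 := by simpa [hs, hne hs] using hst
    exact (isLow_of_scalar 1 0 (φ := φ) (by simp [hφ, h0])).imp_right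
      fun h => .inr (.inr ⟨_, _, h⟩)
  · have h0 : φ = (-s⁻¹ * t) • ψ := by
      rw [add_eq_zero_iff_eq_neg] at hst
      rw [mul_smul, neg_smul, ← smul_neg, ← hst, smul_smul, inv_mul_cancel₀ hs, one_smul]
    exact (isLow_of_scalar (-s⁻¹ * t) 1 (φ := ψ) (by simp [hφ, h0])).imp_right
      fun h => .inr (.inr ⟨_, _, h⟩)

end Closure

section Closure

variable {n : ℕ} {μ χ : AlgStr k n}

theorem exists_ne_zero_forall_apply_eq_zero {r : ℕ} (φ : Fin r → (Fin n → k) →ₗ[k] k)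
    (h : r < n) : ∃ y ≠ 0, ∀ i, φ i y = 0 := by
  have := LinearMap.ker_ne_bot_of_finrank_lt (f := LinearMap.pi φ) (by simpa using h)
  obtain ⟨y, hy, h0⟩ := Submodule.exists_mem_ne_zero_of_ne_bot this
  exact ⟨y, h0, fun i => congr_fun hy i⟩

/-- The bilinear map `tν(x, y) - αφ(x)y - βφ(y)x`. -/
def subScalar (α β : k) (ν : AlgStr k n) (φ : (Fin n → k) →ₗ[k] k) (t : k) : AlgStr k n :=
  t • ν - α • leftMul φ - β • (leftMul φ).flip

theorem subScalar_apply (α β : k) (ν : AlgStr k n) (φ : (Fin n → k) →ₗ[k] k) (t : k)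
    (x y : Fin n → k) :
    subScalar α β ν φ t x y = t • ν x y - (α * φ x) • y - (β * φ y) • x := by
  simp [subScalar, smul_smul]

theorem AlgPoly.subScalar {f g : AlgStr k n → ((Fin n → k) →ₗ[k] k) → k → (Fin n → k)} (α β : k)
    (hf : AlgPoly f) (hg : AlgPoly g) :
    AlgPoly fun ν φ t => subScalar α β ν φ t (f ν φ t) (g ν φ t) := by
  simp only [subScalar_apply]
  exact ((AlgPoly.param.smul (hf.str hg)).sub (((AlgPoly.const α).mul hf.functional).smul hg)).sub
    (((AlgPoly.const β).mul hg.functional).smul hf)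

theorem apply_eq_of_subScalar {α β t : k} {φ : (Fin n → k) →ₗ[k] k} (ht : t ≠ 0)
    (x y : Fin n → k) : χ x y = (α * (t⁻¹ • φ) x) • y + (β * (t⁻¹ • φ) y) • x +
      t⁻¹ • subScalar α β χ φ t x y := by
  rw [subScalar_apply, smul_sub, smul_sub, smul_smul, inv_mul_cancel₀ ht]
  simp only [LinearMap.smul_apply, smul_eq_mul]
  module

theorem subScalar_zero_left {α β t : k} : subScalar α β χ 0 t = t • χ := by
  refine LinearMap.ext₂ fun x y => ?_
  simp [subScalar_apply]

variable [IsAlgClosed k]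

theorem IsGamma.degenerates {α β γ : k} (hn : 2 ≤ n) (h : IsGamma α β γ μ) (h0 : (α, β, γ) ≠ 0)
    (hd : degenerates μ χ) : IsGamma α β γ χ ∨ IsLow χ := by
  obtain ⟨φ, t, hne, h1, h2, h3, h4⟩ := exists_of_degenerates (C := fun χ φ t =>
    (∀ (f g : (Fin n → k) →ₗ[k] k) (x y z w : Fin n → k),
      f (subScalar α β χ φ t x y) * g (subScalar α β χ φ t z w) =
        f (subScalar α β χ φ t x z) * g (subScalar α β χ φ t y w)) ∧
    (∀ x y z, φ z • subScalar α β χ φ t x y = φ x • subScalar α β χ φ t z y) ∧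
    (∀ x y, φ (subScalar α β χ φ t x y) = γ * (φ x * φ y)) ∧
    ∀ x y z, subScalar α β χ φ t (subScalar α β χ φ t x y) z =
      (γ * φ z) • subScalar α β χ φ t x y) hd (by
    repeat' first
      | exact AlgPoly.const _ | refine ClosedCond.and ?_ ?_
      | refine ClosedCond.all fun _ => ?_ | refine ClosedCond.eq ?_ ?_ | apply AlgPoly.mul
      | apply AlgPoly.smul | apply AlgPoly.subScalar | apply AlgPoly.functional
      | apply AlgPoly.map) fun ν hν => by
      obtain ⟨φ, w, hφ, hw, hφw, hν⟩ := h.of_mem_orbit hν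
      refine ⟨φ, 1, .inl hφ, fun c => ?_⟩
      have hσ : ∀ x y, subScalar α β ν (c • φ) (c * 1) x y = (c * (φ x * φ y)) • w := fun x y => by
        simp only [subScalar_apply, hν, LinearMap.smul_apply, smul_eq_mul]
        module
      simp only [hσ, map_smul, smul_eq_mul, LinearMap.smul_apply, hφw]
      refine ⟨fun f g x y z w => by ring, fun x y z => by module, fun x y => by ring,
        fun x y z => by module⟩
  by_cases hφ : φ = 0
  · have ht : t ≠ 0 := hne.resolve_left (by simpa using hφ)
    subst hφ
    simp only [subScalar_zero_left, LinearMap.smul_apply, map_smul, smul_eq_mul,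
      LinearMap.zero_apply, mul_zero, zero_smul, smul_eq_zero, ht, false_or] at h1 h4
    refine .inr ((eq_zero_or_isA3 (fun f g x y z w => ?_) h4).imp_right .inl)
    refine mul_left_cancel₀ (mul_ne_zero ht ht) ?_
    linear_combination h1 f g x y z w
  obtain ⟨e, he⟩ := exists_apply_eq_one hφ
  obtain ⟨φ', v, hv⟩ := exists_symmetric_rank_one h1
  have hσ : ∀ x y, subScalar α β χ φ t x y = (φ x * φ y) • subScalar α β χ φ t e e := fun x y => by
    have h5 := h2 x y e
    have h6 := h2 y e e
    rw [he, one_smul] at h5 h6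
    rw [h5, mul_smul, ← h6, hv e y, hv y e, mul_comm (φ' e)]
  set w := subScalar α β χ φ t e e with hw
  have hγ : φ w = γ := by rw [hw, h3, he, mul_one, mul_one]
  have ht : t ≠ 0 := by
    rintro rfl
    obtain ⟨y, hy, hφy⟩ := exists_ne_zero_forall_apply_eq_zero ![φ] hn
    replace hφy : φ y = 0 := hφy 0
    have h5 := hσ e y
    have h6 := hσ y e
    simp only [subScalar_apply, hφy, he] at h5 h6
    have hα : α = 0 := by simpa [hy] using h5
    have hβ : β = 0 := by simpa [hy] using h6
    have h7 := hσ e e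
    rw [subScalar_apply, he, hα, hβ] at h7
    have hw0 : w = 0 := by simpa using h7.symm
    exact h0 (by simp [hα, hβ, ← hγ, hw0])
  have hχ := fun x y => apply_eq_of_subScalar (χ := χ) (α := α) (β := β) (φ := φ) ht x y
  simp only [hσ] at hχ
  have hφ' : t⁻¹ • φ ≠ 0 := smul_ne_zero (inv_ne_zero ht) hφ
  by_cases hw0 : w = 0
  · exact .inr (.inr (.inr (.inr ⟨α, β, _, hφ',
      by simpa only [hw0, smul_zero, add_zero] using hχ⟩)))
  · refine .inl ⟨t⁻¹ • φ, t • w, hφ', smul_ne_zero ht hw0, ?_, fun x y => ?_⟩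
    · rw [LinearMap.smul_apply, map_smul, smul_eq_mul, smul_eq_mul, hγ, inv_mul_cancel_left₀ ht]
    · rw [hχ]
      simp only [LinearMap.smul_apply, smul_eq_mul, smul_smul]
      congr 2
      field_simp

theorem IsT.degenerates {α β δ : k} (hn : 3 ≤ n) (h : IsT α β δ μ) (h0 : (α, β) ≠ 0)
    (hd : degenerates μ χ) : IsT α β δ χ ∨ IsLow χ := by
  obtain ⟨φ, t, hne, h1, h2, h3, h4, h5⟩ := exists_of_degenerates (C := fun χ φ t =>
    (∀ x, subScalar α β χ φ t x x = 0) ∧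
    (∀ (f g : (Fin n → k) →ₗ[k] k) (x y z w : Fin n → k),
      f (subScalar α β χ φ t x y) * g (subScalar α β χ φ t z w) -
        f (subScalar α β χ φ t x z) * g (subScalar α β χ φ t y w) +
        f (subScalar α β χ φ t x w) * g (subScalar α β χ φ t y z) = 0) ∧
    (∀ x y z, φ x • subScalar α β χ φ t y z + φ y • subScalar α β χ φ t z x +
      φ z • subScalar α β χ φ t x y = 0) ∧
    (∀ x y, φ (subScalar α β χ φ t x y) = 0) ∧
    ∀ x y z, subScalar α β χ φ t (subScalar α β χ φ t x y) z =
      (-δ * φ z) • subScalar α β χ φ t x y) hd (by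
    repeat' first
      | exact AlgPoly.const _ | refine ClosedCond.and ?_ ?_
      | refine ClosedCond.all fun _ => ?_ | refine ClosedCond.eq ?_ ?_ | apply AlgPoly.subScalar
      | apply AlgPoly.add | apply AlgPoly.sub | apply AlgPoly.mul | apply AlgPoly.smul
      | apply AlgPoly.functional | apply AlgPoly.map) fun ν hν => by
      obtain ⟨φ, ψ, w, hli, hw, hφw, hψw, hν⟩ := h.of_mem_orbit hν
      refine ⟨φ, 1, .inl (hli.ne_zero 0), fun c => ?_⟩
      have hσ : ∀ x y, subScalar α β ν (c • φ) (c * 1) x y = (c * (φ x * ψ y - φ y * ψ x)) • w :=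
        fun x y => by
        simp only [subScalar_apply, hν, LinearMap.smul_apply, smul_eq_mul]
        module
      simp only [hσ, map_smul, smul_eq_mul, LinearMap.smul_apply, hφw, hψw]
      refine ⟨fun x => by module, fun f g x y z w => by ring, fun x y z => by module,
        fun x y => by ring, fun x y z => by module⟩
  by_cases hφ : φ = 0
  · have ht : t ≠ 0 := hne.resolve_left (by simpa using hφ)
    subst hφ
    simp only [subScalar_zero_left, LinearMap.smul_apply, map_smul, smul_eq_mul,
      LinearMap.zero_apply, mul_zero, zero_smul, smul_eq_zero, ht, false_or] at h1 h2 h5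
    refine .inr ((eq_zero_or_isT_of_alternating h1 (fun f g x y z w => ?_) h5).imp_right
      fun h => .inr (.inl h))
    refine mul_left_cancel₀ (mul_ne_zero ht ht) ?_
    linear_combination h2 f g x y z w
  obtain ⟨e, he⟩ := exists_apply_eq_one hφ
  have hneg : ∀ x y, subScalar α β χ φ t x y = -subScalar α β χ φ t y x := fun x y => by
    have := h1 (x + y)
    simp only [map_add, LinearMap.add_apply, h1, zero_add, add_zero] at this
    rwa [add_comm, add_eq_zero_iff_eq_neg] at this
  obtain ⟨ψ, v, hτ, hv⟩ : ∃ (ψ : (Fin n → k) →ₗ[k] k) (v : Fin n → k),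
      (∀ x y, subScalar α β χ φ t x y = (φ x * ψ y - φ y * ψ x) • v) ∧
      (v ≠ 0 ∧ (∃ y z, φ y * ψ z - φ z * ψ y ≠ 0) ∨ v = 0) := by
    rcases eq_zero_or_exists_alternating_rank_one h1 h2 with h6 | ⟨φ₁, ψ₁, v, hli, hv, h6⟩
    · exact ⟨0, 0, by simp [h6], .inr rfl⟩
    · have h7 : ∀ x y, subScalar α β χ φ t x y =
          (φ x * (φ₁ e • ψ₁ - ψ₁ e • φ₁) y - φ y * (φ₁ e • ψ₁ - ψ₁ e • φ₁) x) • v := fun x y => by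
        have := h3 e x y
        rw [he, one_smul, add_assoc, add_eq_zero_iff_eq_neg, hneg y e] at this
        rw [this, h6, h6]
        simp only [LinearMap.sub_apply, LinearMap.smul_apply, smul_eq_mul]
        module
      refine ⟨_, v, h7, .inl ⟨hv, ?_⟩⟩
      by_contra! hcon
      obtain ⟨x, y, h8, h9, h10, h11⟩ := exists_dual_pair hli
      have := h7 x y
      rw [hcon, h6, h8, h9, h10, h11] at this
      simp [hv] at this
  have ht : t ≠ 0 := by
    rintro rfl
    obtain ⟨y, hy, hφy⟩ := exists_ne_zero_forall_apply_eq_zero ![φ, ψ] hn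
    have hψy : ψ y = 0 := hφy 1
    replace hφy : φ y = 0 := hφy 0
    have h5 := hτ e y
    have h6 := hτ y e
    simp only [subScalar_apply, hφy, hψy, he] at h5 h6
    have hα : α = 0 := by simpa [hy] using h5
    have hβ : β = 0 := by simpa [hy] using h6
    exact h0 (by simp [hα, hβ])
  have hχ := fun x y => apply_eq_of_subScalar (χ := χ) (α := α) (β := β) (φ := φ) ht x y
  simp only [hτ] at hχ
  have hφ' : t⁻¹ • φ ≠ 0 := smul_ne_zero (inv_ne_zero ht) hφ
  rcases hv with ⟨hv, y, z, hyz⟩ | hv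
  · have h6 := h4 y z
    have h7 := h5 y z e
    rw [hτ, map_smul, smul_eq_mul] at h6
    have h8 := (mul_eq_zero.1 h6).resolve_left hyz
    rw [hτ y z, map_smul, LinearMap.smul_apply, hτ, he, h8, smul_smul, smul_smul] at h7
    have h9 : ψ v = δ := mul_left_cancel₀ hyz (by
      linear_combination -smul_left_injective k hv h7)
    refine .inl ⟨t⁻¹ • φ, ψ, v, linearIndependent_pair_of_apply_ne (x := y) (y := z) ?_, hv, ?_,
      h9, fun x y => ?_⟩
    · simp only [LinearMap.smul_apply, smul_eq_mul, mul_assoc, ← mul_sub]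
      exact mul_ne_zero (inv_ne_zero ht) hyz
    · rw [LinearMap.smul_apply, h8, smul_zero]
    · rw [hχ]
      simp only [LinearMap.smul_apply, smul_eq_mul, smul_smul]
      congr 2
      ring
  · exact .inr (.inr (.inr (.inr ⟨α, β, _, hφ', by simpa only [hv, smul_zero, add_zero] using hχ⟩)))

theorem IsT.degenerates_of_ne_zero {δ : k} (h : IsT 0 0 δ μ) (h0 : δ ≠ 0)
    (hd : _root_.degenerates μ χ) : IsT 0 0 δ χ ∨ IsLow χ := by
  have key : (∀ x, χ x x = 0) ∧ (∀ (f g : (Fin n → k) →ₗ[k] k) (x y z w : Fin n → k),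
      f (χ x y) * g (χ z w) - f (χ x z) * g (χ y w) + f (χ x w) * g (χ y z) = 0) := by
    refine closed_of_degenerates (C := fun χ => (∀ x, χ x x = 0) ∧
      (∀ (f g : (Fin n → k) →ₗ[k] k) (x y z w : Fin n → k),
      f (χ x y) * g (χ z w) - f (χ x z) * g (χ y w) + f (χ x w) * g (χ y z) = 0)) hd ?_
      fun ν hν => ?_
    · repeat' first
        | exact AlgPoly.const _ | refine ClosedCond.and ?_ ?_
        | refine ClosedCond.all fun _ => ?_ | refine ClosedCond.eq ?_ ?_ | apply AlgPoly.add
        | apply AlgPoly.sub | apply AlgPoly.mul | apply AlgPoly.str | apply AlgPoly.map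
    · obtain ⟨φ, ψ, v, hφ, hv, -, -, hν⟩ := h.of_mem_orbit hν
      refine ⟨fun x => by simp [hν, mul_comm], fun f g x y z w => ?_⟩
      simp only [hν, map_smul, map_add, smul_eq_mul]
      ring
  rcases eq_zero_or_exists_alternating_rank_one key.1 key.2 with h1 | ⟨φ, ψ, v, hli, hv, hχ⟩
  · exact .inr (.inl h1)
  obtain ⟨x, y, h1, h2, h3, h4⟩ := exists_dual_pair hli
  suffices h : IsT 0 0 1 χ ∨ IsLow χ by
    refine h.imp_left fun h => ?_
    simpa using h.smul h0
  by_cases hb : ψ v = 0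
  · by_cases ha : φ v = 0
    · exact .inr (.inr (.inr (.inl ⟨φ, ψ, v, hli, hv, ha, hb, fun x y => by simp [hχ]⟩)))
    · refine .inl ⟨-(φ v • ψ), (φ v)⁻¹ • φ, v,
        linearIndependent_pair_of_apply_ne (x := x) (y := y) ?_, hv, by simp [hb], by simp [ha],
        fun x y => ?_⟩
      · simp [h1, h2, h3, h4, ha]
      · simp only [hχ, LinearMap.neg_apply, LinearMap.smul_apply, smul_eq_mul]
        rw [zero_mul, zero_mul, zero_smul, zero_smul, zero_add, zero_add]
        congr 1
        field_simp
        ring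
  · refine .inl ⟨ψ v • φ - φ v • ψ, (ψ v)⁻¹ • ψ, v,
      linearIndependent_pair_of_apply_ne (x := x) (y := y) ?_, hv, by simp [mul_comm],
      by simp [hb], fun x y => ?_⟩
    · simp [h1, h2, h3, h4, hb]
    · simp only [hχ, LinearMap.sub_apply, LinearMap.smul_apply, smul_eq_mul]
      rw [zero_mul, zero_mul, zero_smul, zero_smul, zero_add, zero_add]
      congr 1
      field_simp
      ring

end Closure

section Closure

variable {n : ℕ} {μ χ : AlgStr k n}

theorem IsF.closure_aux {α β : k} (h0 : (α, β) ≠ 0) {φ : (Fin n → k) →ₗ[k] k} (hφ : φ ≠ 0)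
    (h1 : ∀ (f g : (Fin n → k) →ₗ[k] k) (x y z w : Fin n → k),
      f (χ x y) * g (χ z w) = g (χ x y) * f (χ z w))
    (h2 : ∀ x y z, χ (χ x y) z = 0) (h3 : ∀ x y z, χ z (χ x y) = 0)
    (h4 : ∀ x y z w, χ (φ x • y - φ y • x) (φ z • w - φ w • z) = 0)
    (h5 : ∀ x z w, β • χ x (φ z • w - φ w • z) = α • χ (φ z • w - φ w • z) x) :
    IsF α β χ ∨ IsLow χ := by
  by_cases hχ0 : χ = 0
  · exact .inr (.inl hχ0)
  obtain ⟨p, hp⟩ := DFunLike.ne_iff.1 hχ0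
  obtain ⟨q, hq⟩ := DFunLike.ne_iff.1 hp
  set v := χ p q with hv
  replace hq : v ≠ 0 := by simpa using hq
  obtain ⟨f, hf⟩ := exists_dual_eq_one (k := k) hq
  obtain ⟨e, he⟩ := exists_apply_eq_one hφ
  have hχv : ∀ x y, χ x y = f (χ x y) • v := fun x y => eq_of_forall_dual (k := k) fun g => by
    have := h1 g f x y p q
    rw [← hv, hf, mul_one] at this
    rw [this, map_smul, smul_eq_mul]
  obtain ⟨ψ, hψ1, hψ2, hψe⟩ : ∃ ψ : (Fin n → k) →ₗ[k] k,
      (∀ y, f (χ e (y - φ y • e)) = α * ψ y) ∧ (∀ y, f (χ (y - φ y • e) e) = β * ψ y) ∧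
      ψ e = 0 := by
    have h6 : ∀ y, β * f (χ e (y - φ y • e)) = α * f (χ (y - φ y • e) e) := fun y => by
      have := congr_arg f (h5 e e y)
      simpa [he] using this
    by_cases hα : α = 0
    · have hβ : β ≠ 0 := fun hβ => h0 (by simp [hα, hβ])
      refine ⟨β⁻¹ • (f ∘ₗ χ.flip e ∘ₗ (LinearMap.id - φ.smulRight e)), fun y => ?_, fun y => ?_,
        by simp [he]⟩
      · have := h6 y
        rw [hα, zero_mul, mul_eq_zero] at this
        rw [this.resolve_left hβ, hα, zero_mul]
      · simp [hβ]
    · refine ⟨α⁻¹ • (f ∘ₗ χ e ∘ₗ (LinearMap.id - φ.smulRight e)), fun y => ?_, fun y => ?_,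
        by simp [he]⟩
      · simp [hα]
      · refine mul_left_cancel₀ hα ?_
        rw [← h6]
        simp only [LinearMap.smul_apply, LinearMap.comp_apply, LinearMap.sub_apply,
          LinearMap.id_apply, LinearMap.smulRight_apply, smul_eq_mul]
        field_simp
  have hB : ∀ x y, f (χ x y) = f (χ e e) * (φ x * φ y) + α * (φ x * ψ y) + β * (ψ x * φ y) :=
    fun x y => by
    have h6 := congr_arg f (h4 e x e y)
    have h7 := hψ1 y
    have h8 := hψ2 x
    simp only [he, map_sub, map_smul, LinearMap.sub_apply, LinearMap.smul_apply, smul_eq_mul,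
      one_smul, map_zero] at h6 h7 h8
    linear_combination h6 + φ x * h7 + φ y * h8
  set c := f (χ e e)
  have hχ : ∀ x y, χ x y = (c * (φ x * φ y) + α * (φ x * ψ y) + β * (ψ x * φ y)) • v :=
    fun x y => by rw [hχv x y, hB]
  by_cases hψ : ψ = 0
  · refine .inr ((eq_zero_or_isA3_of_rank_one (φ := φ) (v := c • v) (fun x y => ?_) h2).imp_right
      .inl)
    rw [hχ, hψ]
    simp only [LinearMap.zero_apply]
    module
  obtain ⟨u, hu⟩ := exists_apply_eq_one hψ
  have hli : ∀ s : k, s ≠ 0 → ∀ r : k, LinearIndependent k ![φ, s • ψ - r • φ] := fun s hs r => by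
    refine linearIndependent_pair_of_apply_ne (x := e) (y := u) ?_
    simp only [LinearMap.sub_apply, LinearMap.smul_apply, smul_eq_mul, hψe, he, hu]
    ring_nf
    exact hs
  have h6 : ∀ y, c * (φ v * φ y) + α * (φ v * ψ y) + β * (ψ v * φ y) = 0 := fun y => by
    have := h2 p q y
    rw [← hv, hχ] at this
    exact (smul_eq_zero.1 this).resolve_right hq
  have h7 : ∀ y, c * (φ y * φ v) + α * (φ y * ψ v) + β * (ψ y * φ v) = 0 := fun y => by
    have := h3 p q y
    rw [← hv, hχ] at this
    exact (smul_eq_zero.1 this).resolve_right hq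
  have hab : ∀ z : k, α * z = 0 → β * z = 0 → z = 0 := fun z h8 h9 => by
    by_contra hz
    exact h0 (by simp [(mul_eq_zero.1 h8).resolve_right hz, (mul_eq_zero.1 h9).resolve_right hz])
  have hφv : φ v = 0 := by
    refine hab _ ?_ ?_
    · have h8 := h6 (u - φ u • e)
      simp only [map_sub, map_smul, smul_eq_mul, he, hu, hψe] at h8
      linear_combination h8
    · have h8 := h7 (u - φ u • e)
      simp only [map_sub, map_smul, smul_eq_mul, he, hu, hψe] at h8
      linear_combination h8
  have hψv : ψ v = 0 := by
    refine hab _ ?_ ?_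
    · simpa [hφv, he] using h7 e
    · simpa [hφv, he] using h6 e
  by_cases hc : c = 0
  · by_cases hs : α + β = 0
    · have hα : α ≠ 0 := fun hα => h0 (by rw [hα, zero_add] at hs; simp [hα, hs])
      refine .inr (.inr (.inr (.inl ⟨φ, (1 : k) • ψ - (0 : k) • φ, α • v, hli 1 one_ne_zero 0,
        smul_ne_zero hα hq, by simp [hφv], by simp [hψv], fun x y => ?_⟩)))
      rw [hχ, hc, eq_neg_of_add_eq_zero_right hs]
      simp only [LinearMap.sub_apply, LinearMap.smul_apply, smul_eq_mul]
      module
    · refine .inl ⟨φ, (1 : k) • ψ - (α + β)⁻¹ • φ, v, hli 1 one_ne_zero _, hq, hφv,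
        by simp [hφv, hψv], fun x y => ?_⟩
      rw [hχ, hc]
      simp only [LinearMap.sub_apply, LinearMap.smul_apply, smul_eq_mul]
      congr 1
      field_simp
      ring
  · refine .inl ⟨φ, c⁻¹ • ψ - (0 : k) • φ, c • v, hli _ (inv_ne_zero hc) 0, smul_ne_zero hc hq,
      by simp [hφv], by simp [hψv], fun x y => ?_⟩
    rw [hχ, smul_smul]
    simp only [LinearMap.sub_apply, LinearMap.smul_apply, smul_eq_mul]
    congr 1
    field_simp
    ring

theorem exists_alternating_split {V : Type*} [AddCommGroup V] [Module k V]
    {ω : V →ₗ[k] V →ₗ[k] k} (hω : ∀ x, ω x x = 0) (h0 : ω ≠ 0) :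
    ∃ (p q : V) (ω' : V →ₗ[k] V →ₗ[k] k), ω p q = 1 ∧ (∀ x, ω' x x = 0) ∧ ω' p = 0 ∧ ω' q = 0 ∧
      ∀ x y, ω x y = ω x q * ω p y - ω y q * ω p x + ω' x y := by
  obtain ⟨p, hp⟩ := DFunLike.ne_iff.1 h0
  obtain ⟨q, hq⟩ := DFunLike.ne_iff.1 hp
  replace hq : ω p q ≠ 0 := by simpa using hq
  set q' := (ω p q)⁻¹ • q with hq'
  have h1 : ω p q' = 1 := by simp [hq', hq]
  have hneg : ω q' p = -1 := by
    have := hω (p + q')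
    simp only [map_add, LinearMap.add_apply, hω, h1] at this
    linear_combination this
  refine ⟨p, q', ω - ((ω.flip q').smulRight (ω p) - (ω p).smulRight (ω.flip q')), h1, fun x => ?_,
    LinearMap.ext fun x => ?_, LinearMap.ext fun x => ?_, fun x y => ?_⟩
  · simp [hω, mul_comm]
  · simp [hω, h1]
  · have := hω (x + q')
    simp only [map_add, LinearMap.add_apply, hω] at this
    simp [hω, h1]
    linear_combination this
  · simp
    ring

theorem IsEta.closure_aux (hb : ∀ x, χ x x = 0)
    (h1 : ∀ (f g : (Fin n → k) →ₗ[k] k) (x y z w : Fin n → k),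
      f (χ x y) * g (χ z w) = g (χ x y) * f (χ z w))
    (h2 : ∀ x y z, χ (χ x y) z = 0)
    (h3 : ∀ (f : (Fin n → k) →ₗ[k] k) (a b c d x y : Fin n → k),
      f (χ a b) * (f (χ c d) * f (χ x y) - f (χ c x) * f (χ d y) + f (χ c y) * f (χ d x)) -
      f (χ a c) * (f (χ b d) * f (χ x y) - f (χ b x) * f (χ d y) + f (χ b y) * f (χ d x)) +
      f (χ a d) * (f (χ b c) * f (χ x y) - f (χ b x) * f (χ c y) + f (χ b y) * f (χ c x)) -
      f (χ a x) * (f (χ b c) * f (χ d y) - f (χ b d) * f (χ c y) + f (χ b y) * f (χ c d)) +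
      f (χ a y) * (f (χ b c) * f (χ d x) - f (χ b d) * f (χ c x) + f (χ b x) * f (χ c d)) = 0) :
    IsEta χ ∨ IsLow χ := by
  by_cases hχ0 : χ = 0
  · exact .inr (.inl hχ0)
  obtain ⟨p₀, hp⟩ := DFunLike.ne_iff.1 hχ0
  obtain ⟨q₀, hq⟩ := DFunLike.ne_iff.1 hp
  set v := χ p₀ q₀ with hv
  replace hq : v ≠ 0 := by simpa using hq
  obtain ⟨f, hf⟩ := exists_dual_eq_one (k := k) hq
  have hχv : ∀ x y, χ x y = f (χ x y) • v := fun x y => eq_of_forall_dual (k := k) fun g => by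
    have := h1 g f x y p₀ q₀
    rw [← hv, hf, mul_one] at this
    rw [this, map_smul, smul_eq_mul]
  obtain ⟨ω, hω⟩ : ∃ ω : (Fin n → k) →ₗ[k] (Fin n → k) →ₗ[k] k, ∀ x y, ω x y = f (χ x y) :=
    ⟨χ.compr₂ f, fun _ _ => rfl⟩
  simp only [← hω] at hχv
  have hωb : ∀ x, ω x x = 0 := fun x => by rw [hω, hb, map_zero]
  have hneg : ∀ x y, ω x y = -ω y x := fun x y => by
    have := hωb (x + y)
    simp only [map_add, LinearMap.add_apply, hωb] at this
    linear_combination this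
  have hωv : ∀ x, ω v x = 0 := fun x => by rw [hω, h2, map_zero]
  have hωv' : ∀ x, ω x v = 0 := fun x => by rw [hneg, hωv, neg_zero]
  obtain ⟨p, q, ω', hpq, hωb', hp', hq', hsp⟩ := exists_alternating_split hωb fun h =>
    one_ne_zero (by rw [← hf, hv, ← hω, h]; rfl)
  have hqp : ω q p = -1 := by rw [hneg, hpq]
  by_cases h0 : ω' = 0
  · refine .inr (.inr (.inr (.inl ⟨ω.flip q, ω p, v, linearIndependent_pair_of_apply_ne (x := p)
      (y := q) (by simp [hpq, hωb]), hq, hωv q, hωv' p, fun x y => ?_⟩)))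
    rw [hχv, hsp, h0]
    simp
  · obtain ⟨r, s, ω'', hrs, hωb'', hr', hs', hsp'⟩ := exists_alternating_split hωb' h0
    have hneg' : ∀ x y, ω' x y = -ω' y x := fun x y => by
      have := hωb' (x + y)
      simp only [map_add, LinearMap.add_apply, hωb'] at this
      linear_combination this
    have hω'' : ∀ x y, ω'' x y = 0 := fun x y => by
      have hPf := h3 f p q r s x y
      simp only [← hω, hpq] at hPf
      rw [hneg q r, hneg q s, hneg q x, hneg q y, hsp r s, hsp r x, hsp r y, hsp s x, hsp s y,
        hsp x y] at hPf
      have h5 := hsp' x y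
      rw [hrs] at hPf
      rw [hneg' x s, hneg' y s] at h5
      linear_combination hPf - h5
    have hωv₁ : ∀ x, ω' x v = 0 := fun x => by
      have := hsp x v
      rw [hωv', hωv', hωv] at this
      linear_combination -this
    refine .inl ⟨![ω.flip q, ω p, ω'.flip s, ω' r], v, ?_, hq, fun i => ?_, fun x y => ?_⟩
    · rw [Fintype.linearIndependent_iff]
      intro g hg
      simp only [Fin.sum_univ_four] at hg
      have e1 := LinearMap.congr_fun hg p
      have e2 := LinearMap.congr_fun hg q
      have e3 := LinearMap.congr_fun hg r
      have e4 := LinearMap.congr_fun hg s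
      simp [hpq, hqp, hωb, hp', hq', hneg' r p, hneg' r q] at e1 e2
      simp [e1, e2, hrs, hωb'] at e3 e4
      intro i
      fin_cases i <;> assumption
    · fin_cases i
      · exact hωv q
      · exact hωv' p
      · show ω' v s = 0
        rw [hneg', hωv₁, neg_zero]
      · exact hωv₁ r
    · rw [hχv, hsp, hsp', hω'']
      simp

end Closure

section Closure

variable {n : ℕ} {μ χ : AlgStr k n}

theorem exists_adjoint_form {φ : (Fin n → k) →ₗ[k] k} (hφ : φ ≠ 0) (h1 : ∀ x, χ x x = 0)
    (h2 : ∀ x y z w, χ (φ x • y - φ y • x) (φ z • w - φ w • z) = 0) :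
    ∃ (e : Fin n → k) (D : (Fin n → k) →ₗ[k] (Fin n → k)), φ e = 1 ∧ D e = 0 ∧
      (∀ y, D y = χ e y) ∧ ∀ x y, χ x y = φ x • D y - φ y • D x := by
  obtain ⟨e, he⟩ := exists_apply_eq_one hφ
  refine ⟨e, χ e, he, h1 e, fun _ => rfl, fun x y => ?_⟩
  have h3 := h2 e x e y
  have h4 : χ x e = -χ e x := by
    have := h1 (x + e)
    simp only [map_add, LinearMap.add_apply, h1, zero_add, add_zero] at this
    exact eq_neg_of_add_eq_zero_right this
  simp only [he, one_smul, map_sub, map_smul, LinearMap.sub_apply, LinearMap.smul_apply, h1,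
    h4, smul_zero, sub_zero, smul_neg, sub_neg_eq_add] at h3
  linear_combination (exp := 1) h3

theorem pairing_eq_zero_of_sq_eq_zero {r : ℕ} {D : (Fin n → k) →ₗ[k] (Fin n → k)}
    {φ : Fin r → (Fin n → k) →ₗ[k] k} {v : Fin r → Fin n → k} (hφ : LinearIndependent k φ)
    (hv : LinearIndependent k v) (hD : ∀ x, D x = ∑ i, φ i x • v i) (h : ∀ x, D (D x) = 0)
    (i j : Fin r) : φ i (v j) = 0 := by
  obtain ⟨w, hw⟩ := exists_dual_vectors hφ
  have h1 : D (w j) = v j := by simp [hD, hw]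
  have h2 := h (w j)
  rw [h1, hD] at h2
  exact Fintype.linearIndependent_iff.1 hv _ h2 i

/-- The pairings between the data describing `xy = φ(x)Dy - φ(y)Dx` for a square-zero `D`. -/
theorem adjoint_form_pairing {φ : (Fin n → k) →ₗ[k] k} {e : Fin n → k}
    {D : (Fin n → k) →ₗ[k] (Fin n → k)} (he : φ e = 1) (hDe : D e = 0) (hφD : ∀ x, φ (D x) = 0)
    (hDD : ∀ x, D (D x) = 0) : ∃ (r : ℕ) (ψ : Fin r → (Fin n → k) →ₗ[k] k) (v : Fin r → Fin n → k),
      LinearIndependent k (Fin.cons φ ψ : Fin (r + 1) → (Fin n → k) →ₗ[k] k) ∧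
      LinearIndependent k v ∧ (∀ j, φ (v j) = 0) ∧ (∀ i j, ψ i (v j) = 0) ∧
      ∀ x, D x = ∑ i, ψ i x • v i := by
  obtain ⟨r, ψ, v, hψ, hv, hD⟩ := exists_rank_decomposition D
  refine ⟨r, ψ, v, ?_, hv, fun j => ?_, pairing_eq_zero_of_sq_eq_zero hψ hv hD hDD, hD⟩
  · rw [linearIndependent_finCons]
    refine ⟨hψ, fun hmem => ?_⟩
    have h1 : ∀ i, ψ i e = 0 := by
      rw [hD] at hDe
      exact Fintype.linearIndependent_iff.1 hv _ hDe
    have h2 : Submodule.span k (Set.range ψ) ≤ LinearMap.ker (LinearMap.applyₗ (R := k) e) := by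
      rw [Submodule.span_le]
      rintro _ ⟨i, rfl⟩
      exact h1 i
    have h3 : φ e = 0 := h2 hmem
    exact one_ne_zero (he.symm.trans h3)
  · obtain ⟨w, hw⟩ := exists_dual_vectors hψ
    have h1 : D (w j) = v j := by simp [hD, hw]
    rw [← h1, hφD]

theorem isT_of_adjoint_form_rank_one {φ : (Fin n → k) →ₗ[k] k} {ψ : Fin 1 → (Fin n → k) →ₗ[k] k}
    {v : Fin 1 → Fin n → k} {D : (Fin n → k) →ₗ[k] (Fin n → k)}
    (hli : LinearIndependent k (Fin.cons φ ψ : Fin 2 → (Fin n → k) →ₗ[k] k))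
    (hv : LinearIndependent k v) (hφv : ∀ j, φ (v j) = 0) (hψv : ∀ i j, ψ i (v j) = 0)
    (hD : ∀ x, D x = ∑ i, ψ i x • v i) (hχ : ∀ x y, χ x y = φ x • D y - φ y • D x) :
    IsT 0 0 0 χ := by
  refine ⟨φ, ψ 0, v 0, ?_, hv.ne_zero 0, hφv 0, hψv 0 0, fun x y => ?_⟩
  · convert hli using 1
    ext i : 1
    fin_cases i <;> rfl
  · simp only [hχ, hD, Fin.sum_univ_one]
    module

theorem IsT022.closure_aux {φ : (Fin n → k) →ₗ[k] k} (hφ : φ ≠ 0) (h1 : ∀ x, χ x x = 0)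
    (h2 : ∀ x y z w, χ (φ x • y - φ y • x) (φ z • w - φ w • z) = 0) (h3 : ∀ x y, φ (χ x y) = 0)
    (h4 : ∀ x y z, χ z (χ x y) = 0)
    (h5 : ∀ (f g h : (Fin n → k) →ₗ[k] k) (x y z x' y' z' : Fin n → k),
      f (χ x x') * (g (χ y y') * h (χ z z') - g (χ z z') * h (χ y y')) -
      f (χ y y') * (g (χ x x') * h (χ z z') - g (χ z z') * h (χ x x')) +
      f (χ z z') * (g (χ x x') * h (χ y y') - g (χ y y') * h (χ x x')) = 0) :
    IsT022 χ ∨ IsLow χ := by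
  obtain ⟨e, D, he, hDe, hDχ, hχ⟩ := exists_adjoint_form hφ h1 h2
  obtain ⟨r, ψ, v, hli, hv, hφv, hψv, hD⟩ := adjoint_form_pairing he hDe
    (fun x => by rw [hDχ, h3]) (fun x => by rw [hDχ, hDχ, h4])
  rcases r with _ | _ | _ | r
  · refine .inr (.inl (LinearMap.ext₂ fun x y => ?_))
    simp [hχ, hD]
  · exact .inr (.inr (.inr (.inl (isT_of_adjoint_form_rank_one hli hv hφv hψv hD hχ))))
  · refine .inl ⟨φ, ψ 0, ψ 1, v 0, v 1, ?_, ?_, hφv 0, hφv 1, hψv 0 0, hψv 0 1, hψv 1 0, hψv 1 1,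
      fun x y => ?_⟩
    · convert hli using 1
      ext i : 1
      fin_cases i <;> rfl
    · convert hv using 1
      ext i : 1
      fin_cases i <;> rfl
    · have hD' : ∀ x, D x = ψ 0 x • v 0 + ψ 1 x • v 1 := fun x => (hD x).trans (Fin.sum_univ_two _)
      rw [hχ, hD', hD']
      module
  · exfalso
    obtain ⟨f, hf⟩ := exists_dual_family hv
    have hψ : LinearIndependent k ψ := (linearIndependent_finCons.1 hli).1
    obtain ⟨w, hw⟩ := exists_dual_vectors hψ
    have hDw : ∀ j, χ e (w j) = v j := fun j => by simp [← hDχ, hD, hw]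
    have := h5 (f ⟨0, by omega⟩) (f ⟨1, by omega⟩) (f ⟨2, by omega⟩) e e e
      (w ⟨0, by omega⟩) (w ⟨1, by omega⟩) (w ⟨2, by omega⟩)
    simp [hDw, hf, Fin.ext_iff] at this

theorem IsT03.closure_aux (hn : n = 4) {φ : (Fin n → k) →ₗ[k] k} (hφ : φ ≠ 0)
    (h1 : ∀ x, χ x x = 0)
    (h2 : ∀ x y z w, χ (φ x • y - φ y • x) (φ z • w - φ w • z) = 0) (h3 : ∀ x y, φ (χ x y) = 0)
    (h4 : ∀ x y, χ x (χ x (χ x y)) = 0) : IsT03 χ ∨ IsLow χ := by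
  obtain ⟨e, D, he, hDe, hDχ, hχ⟩ := exists_adjoint_form hφ h1 h2
  have hφD : ∀ x, φ (D x) = 0 := fun x => by rw [hDχ, h3]
  have hD3 : ∀ x, D (D (D x)) = 0 := fun x => by rw [hDχ, hDχ, hDχ, h4]
  by_cases hDD : ∀ x, D (D x) = 0
  · obtain ⟨r, ψ, v, hli, hv, hφv, hψv, hD⟩ := adjoint_form_pairing he hDe hφD hDD
    have hr : r + 1 + r ≤ n := add_le_of_pairing_eq_zero hli hv fun i j => by
      refine Fin.cases ?_ (fun i => ?_) i
      · simpa using hφv j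
      · simpa using hψv i j
    rcases r with _ | _ | r
    · refine .inr (.inl (LinearMap.ext₂ fun x y => ?_))
      simp [hχ, hD]
    · exact .inr (.inr (.inr (.inl (isT_of_adjoint_form_rank_one hli hv hφv hψv hD hχ))))
    · omega
  · push Not at hDD
    obtain ⟨p, hp⟩ := hDD
    set p' := p - φ p • e with hp'
    have hDp' : D p' = D p := by rw [hp', map_sub, map_smul, hDe, smul_zero, sub_zero]
    have hφp' : φ p' = 0 := by simp [hp', he]
    have hb : LinearIndependent k ![e, p', D p, D (D p)] := by
      rw [Fintype.linearIndependent_iff]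
      intro g hg
      simp only [Fin.sum_univ_four] at hg
      have e0 := congr_arg φ hg
      simp [he, hφp', hφD] at e0
      have e1 := congr_arg (fun x => D (D x)) hg
      simp [hDe, hDp', hD3, hp] at e1
      have e2 := congr_arg D hg
      simp [hDe, hDp', hD3, hp, e1] at e2
      simp [e0, e1, e2, hp] at hg
      intro i
      fin_cases i <;> assumption
    subst hn
    let b := basisOfLinearIndependentOfCardEqFinrank hb (by simp)
    have hbv : ⇑b = ![e, p', D p, D (D p)] := coe_basisOfLinearIndependentOfCardEqFinrank ..
    have hb0 : b 0 = e := by rw [hbv]; rfl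
    have hb1 : b 1 = p' := by rw [hbv]; rfl
    have hb2 : b 2 = D p := by rw [hbv]; rfl
    have hb3 : b 3 = D (D p) := by rw [hbv]; rfl
    have hφ0 : φ = b.coord 0 := b.ext fun i => by
      fin_cases i <;> simp [Finsupp.single_apply]
      · simpa [hb0] using he
      · simpa [hb1] using hφp'
      · simpa [hb2] using hφD _
      · simpa [hb3] using hφD _
    have hDb : D = (b.coord 1).smulRight (D p) + (b.coord 2).smulRight (D (D p)) :=
      b.ext fun i => by
        fin_cases i <;> simp [Finsupp.single_apply]
        · simpa [hb0] using hDe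
        · simpa [hb1] using hDp'
        · simp [hb2]
        · simpa [hb3] using hD3 _
    refine .inl ⟨φ, b.coord 1, b.coord 2, D p, D (D p), ?_, ?_, hφD _, hφD _, ?_, ?_, ?_, ?_,
      fun x y => ?_⟩
    · have h6 := b.linearIndependent_coord.comp (![0, 1, 2] : Fin 3 → Fin 4) (by decide)
      have h7 : ![φ, b.coord 1, b.coord 2] = b.coord ∘ ![0, 1, 2] := by
        ext i : 1
        fin_cases i <;> simp [hφ0]
      rwa [h7]
    · have h6 := hb.comp (![2, 3] : Fin 2 → Fin 4) (by decide)
      have h7 : ![D p, D (D p)] = ![e, p', D p, D (D p)] ∘ ![2, 3] := by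
        ext i : 1
        fin_cases i <;> simp
      rwa [h7]
    · rw [← hb2]; simp
    · rw [← hb3]; simp
    · rw [← hb2]; simp
    · rw [← hb3]; simp
    · rw [hχ]
      have h6 := LinearMap.congr_fun hDb x
      have h7 := LinearMap.congr_fun hDb y
      simp only [LinearMap.add_apply, LinearMap.smulRight_apply] at h6 h7
      rw [h6, h7]
      module

end Closure

section Closure

variable {n : ℕ} {μ χ : AlgStr k n} [IsAlgClosed k]

theorem IsF.degenerates {α β : k} (h : IsF α β μ) (h0 : (α, β) ≠ 0) (hd : degenerates μ χ) :
    IsF α β χ ∨ IsLow χ := by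
  obtain ⟨φ, hφ, h1, h2, h3, h4, h5⟩ := exists_functional_of_degenerates (C := fun χ φ =>
    (∀ (f g : (Fin n → k) →ₗ[k] k) (x y z w : Fin n → k),
      f (χ x y) * g (χ z w) = g (χ x y) * f (χ z w)) ∧
    (∀ x y z, χ (χ x y) z = 0) ∧ (∀ x y z, χ z (χ x y) = 0) ∧
    (∀ x y z w, χ (φ x • y - φ y • x) (φ z • w - φ w • z) = 0) ∧
    (∀ x z w, β • χ x (φ z • w - φ w • z) = α • χ (φ z • w - φ w • z) x)) hd (by
    repeat' first
      | exact AlgPoly.const _ | refine ClosedCond.and ?_ ?_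
      | refine ClosedCond.all fun _ => ?_ | refine ClosedCond.eq ?_ ?_ | apply AlgPoly.add
      | apply AlgPoly.sub | apply AlgPoly.mul | apply AlgPoly.smul | apply AlgPoly.str
      | apply AlgPoly.functional | apply AlgPoly.map) fun ν hν => by
      obtain ⟨φ, ψ, v, hli, hv, hφv, hψv, hν⟩ := h.of_mem_orbit hν
      refine ⟨φ, hli.ne_zero 0, fun c => ⟨fun f g x y z w => ?_, fun x y z => ?_, fun x y z => ?_,
        fun x y z w => ?_, fun x z w => ?_⟩⟩
      · simp only [hν, map_smul, smul_eq_mul]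
        ring
      · simp [hν, hφv, hψv]
      · simp [hν, hφv, hψv]
      · rw [hν]
        simp only [LinearMap.smul_apply, map_sub, map_smul, smul_eq_mul]
        module
      · rw [hν, hν]
        simp only [LinearMap.smul_apply, map_sub, map_smul, smul_eq_mul]
        module
  exact IsF.closure_aux h0 hφ h1 h2 h3 h4 h5

theorem IsEta.degenerates (h : IsEta μ) (hd : _root_.degenerates μ χ) : IsEta χ ∨ IsLow χ := by
  obtain ⟨h1, h2, h3, h4⟩ := closed_of_degenerates (C := fun χ => (∀ x, χ x x = 0) ∧
      (∀ (f g : (Fin n → k) →ₗ[k] k) (x y z w : Fin n → k),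
      f (χ x y) * g (χ z w) = g (χ x y) * f (χ z w)) ∧ (∀ x y z, χ (χ x y) z = 0) ∧
    (∀ (f : (Fin n → k) →ₗ[k] k) (a b c d x y : Fin n → k),
      f (χ a b) * (f (χ c d) * f (χ x y) - f (χ c x) * f (χ d y) + f (χ c y) * f (χ d x)) -
      f (χ a c) * (f (χ b d) * f (χ x y) - f (χ b x) * f (χ d y) + f (χ b y) * f (χ d x)) +
      f (χ a d) * (f (χ b c) * f (χ x y) - f (χ b x) * f (χ c y) + f (χ b y) * f (χ c x)) -
      f (χ a x) * (f (χ b c) * f (χ d y) - f (χ b d) * f (χ c y) + f (χ b y) * f (χ c d)) +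
      f (χ a y) * (f (χ b c) * f (χ d x) - f (χ b d) * f (χ c x) + f (χ b x) * f (χ c d)) = 0)) hd
          (by
    repeat' first
      | exact AlgPoly.const _ | refine ClosedCond.and ?_ ?_
      | refine ClosedCond.all fun _ => ?_ | refine ClosedCond.eq ?_ ?_ | apply AlgPoly.add
      | apply AlgPoly.sub | apply AlgPoly.mul | apply AlgPoly.smul | apply AlgPoly.str
      | apply AlgPoly.functional | apply AlgPoly.map) fun ν hν => by
      obtain ⟨φ, v, hφ, hv, hφv, hν⟩ := h.of_mem_orbit hν
      refine ⟨fun x => by simp [hν, mul_comm], fun f g x y z w => ?_, fun x y z => ?_,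
        fun f a b c d x y => ?_⟩
      · simp only [hν, map_smul, smul_eq_mul]
        ring
      · simp [hν, hφv]
      · simp only [hν, map_smul, smul_eq_mul]
        ring
  exact IsEta.closure_aux h1 h2 h3 h4

theorem IsT03.degenerates (hn : n = 4) (h : IsT03 μ) (hd : _root_.degenerates μ χ) :
    IsT03 χ ∨ IsLow χ := by
  obtain ⟨φ, hφ, h1, h2, h3, h4⟩ := exists_functional_of_degenerates (C := fun χ φ =>
    (∀ x, χ x x = 0) ∧ (∀ x y z w, χ (φ x • y - φ y • x) (φ z • w - φ w • z) = 0) ∧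
    (∀ x y, φ (χ x y) = 0) ∧ ∀ x y, χ x (χ x (χ x y)) = 0) hd (by
    repeat' first
      | exact AlgPoly.const _ | refine ClosedCond.and ?_ ?_
      | refine ClosedCond.all fun _ => ?_ | refine ClosedCond.eq ?_ ?_ | apply AlgPoly.add
      | apply AlgPoly.sub | apply AlgPoly.mul | apply AlgPoly.smul | apply AlgPoly.str
      | apply AlgPoly.functional) fun ν hν => by
      obtain ⟨φ, ψ, χ, v, u, hli, -, hφv, hφu, hψv, hψu, hχv, hχu, hν⟩ := h.of_mem_orbit hν
      refine ⟨φ, hli.ne_zero 0, fun c => ⟨fun x => ?_, fun x y z w => ?_, fun x y => ?_,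
        fun x y => ?_⟩⟩
      · simp [hν, mul_comm]
      · rw [hν]
        simp only [LinearMap.smul_apply, map_sub, map_smul, smul_eq_mul]
        module
      · simp [hν, hφv, hφu]
      · simp [hν, hφv, hφu, hψv, hψu, hχv, hχu]
  exact IsT03.closure_aux hn hφ h1 h2 h3 h4

theorem IsT022.degenerates (h : IsT022 μ) (hd : _root_.degenerates μ χ) :
    IsT022 χ ∨ IsLow χ := by
  obtain ⟨φ, hφ, h1, h2, h3, h4, h5⟩ := exists_functional_of_degenerates (C := fun χ φ =>
    (∀ x, χ x x = 0) ∧ (∀ x y z w, χ (φ x • y - φ y • x) (φ z • w - φ w • z) = 0) ∧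
    (∀ x y, φ (χ x y) = 0) ∧ (∀ x y z, χ z (χ x y) = 0) ∧
    ∀ (f g h : (Fin n → k) →ₗ[k] k) (x y z x' y' z' : Fin n → k),
      f (χ x x') * (g (χ y y') * h (χ z z') - g (χ z z') * h (χ y y')) -
      f (χ y y') * (g (χ x x') * h (χ z z') - g (χ z z') * h (χ x x')) +
      f (χ z z') * (g (χ x x') * h (χ y y') - g (χ y y') * h (χ x x')) = 0) hd (by
    repeat' first
      | exact AlgPoly.const _ | refine ClosedCond.and ?_ ?_
      | refine ClosedCond.all fun _ => ?_ | refine ClosedCond.eq ?_ ?_ | apply AlgPoly.add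
      | apply AlgPoly.sub | apply AlgPoly.mul | apply AlgPoly.smul | apply AlgPoly.str
      | apply AlgPoly.functional | apply AlgPoly.map) fun ν hν => by
      obtain ⟨φ, ψ, χ, v, u, hli, -, hφv, hφu, hψv, hψu, hχv, hχu, hν⟩ := h.of_mem_orbit hν
      refine ⟨φ, hli.ne_zero 0, fun c => ⟨fun x => ?_, fun x y z w => ?_, fun x y => ?_,
        fun x y z => ?_, fun f g h x y z x' y' z' => ?_⟩⟩
      · simp [hν, mul_comm]
      · rw [hν]
        simp only [LinearMap.smul_apply, map_sub, map_smul, smul_eq_mul]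
        module
      · simp [hν, hφv, hφu]
      · simp [hν, hφv, hφu, hψv, hψu, hχv, hχu]
      · simp only [hν, map_add, map_smul, smul_eq_mul]
        ring
  exact IsT022.closure_aux hφ h1 h2 h3 h4 h5

end Closure

section Contractions

variable {n : ℕ} {μ χ : AlgStr k n}

/-- Contraction onto the multiplication of the span of `p`, with values in the span of `q`. -/
theorem exists_degenerates_span [Infinite k] (μ : AlgStr k n) {r s : ℕ} {p : Fin r → Fin n → k}
    {q : Fin s → Fin n → k} {θ : Fin s → (Fin n → k) →ₗ[k] k} (hp : LinearIndependent k p)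
    (hθq : ∀ i j, θ i (q j) = if i = j then 1 else 0) (hθp : ∀ i j, θ i (p j) = 0) :
    ∃ φ : Fin r → (Fin n → k) →ₗ[k] k, (∀ i j, φ i (p j) = if i = j then 1 else 0) ∧
      (∀ i j, φ i (q j) = 0) ∧ ∃ χ, degenerates μ χ ∧ ∀ x y, χ x y =
        ∑ l, θ l (μ (∑ i, φ i x • p i) (∑ j, φ j y • p j)) • q l := by
  obtain ⟨φ₀, hφ₀⟩ := exists_dual_family hp
  let φ : Fin r → (Fin n → k) →ₗ[k] k := fun i => φ₀ i - ∑ l, φ₀ i (q l) • θ l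
  have h1 : ∀ i j, φ i (p j) = if i = j then 1 else 0 := fun i j => by
    simp [φ, hφ₀, hθp]
  have h2 : ∀ i j, φ i (q j) = 0 := fun i j => by simp [φ, hθq]
  refine ⟨φ, h1, h2, ?_⟩
  obtain ⟨χ, hχ, h⟩ := exists_degenerates_proj μ (P := ∑ i, (φ i).smulRight (p i))
    (Q := ∑ l, (θ l).smulRight (q l)) (fun x => by simp [h1]) (fun x => by simp [hθq])
    (fun x => by simp [h2]) (fun x => by simp [hθp])
  exact ⟨χ, hχ, fun x y => by simp only [h, LinearMap.sum_apply, LinearMap.smulRight_apply]⟩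

theorem exists_degenerates_line [Infinite k] (μ : AlgStr k n) {x m : Fin n → k}
    {θ : (Fin n → k) →ₗ[k] k} (hx : x ≠ 0) (hθx : θ x = 0) (hθm : θ m = 1) :
    ∃ φ : (Fin n → k) →ₗ[k] k, φ ≠ 0 ∧ φ m = 0 ∧ ∃ χ, degenerates μ χ ∧
      ∀ a b, χ a b = (θ (μ x x) * (φ a * φ b)) • m := by
  obtain ⟨φ, h1, h2, χ, hχ, h⟩ := exists_degenerates_span μ (p := ![x]) (q := ![m]) (θ := ![θ])
    (by rw [linearIndependent_unique_iff]; simpa using hx)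
    (fun i j => by simp [Subsingleton.elim i j, hθm]) (fun i j => by simp [hθx])
  refine ⟨φ 0, fun h0 => ?_, h2 0 0, χ, hχ, fun a b => ?_⟩
  · simpa [h0] using h1 0 0
  · simp only [h, Fin.sum_univ_one, Matrix.cons_val_fin_one, map_smul, LinearMap.smul_apply,
      smul_eq_mul]
    congr 1
    ring

theorem exists_degenerates_plane [Infinite k] (μ : AlgStr k n) {x y m : Fin n → k}
    {θ : (Fin n → k) →ₗ[k] k} (hxy : LinearIndependent k ![x, y]) (hθx : θ x = 0) (hθy : θ y = 0)
    (hθm : θ m = 1) :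
    ∃ φ ψ : (Fin n → k) →ₗ[k] k, LinearIndependent k ![φ, ψ] ∧ φ m = 0 ∧ ψ m = 0 ∧
      ∃ χ, degenerates μ χ ∧ ∀ a b, χ a b = (θ (μ x x) * (φ a * φ b) + θ (μ x y) * (φ a * ψ b) +
        θ (μ y x) * (ψ a * φ b) + θ (μ y y) * (ψ a * ψ b)) • m := by
  obtain ⟨φ, h1, h2, χ, hχ, h⟩ := exists_degenerates_span μ (q := ![m]) (θ := ![θ]) hxy
    (fun i j => by simp [Subsingleton.elim i j, hθm])
    (fun i j => by fin_cases j <;> simp [hθx, hθy])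
  have h00 := h1 0 0
  have h01 := h1 0 1
  have h10 := h1 1 0
  have h11 := h1 1 1
  simp only [Matrix.cons_val_zero, Matrix.cons_val_one, if_true, zero_ne_one, one_ne_zero,
    if_false] at h00 h01 h10 h11
  refine ⟨φ 0, φ 1, linearIndependent_pair_of_apply_ne (x := x) (y := y) ?_, h2 0 0, h2 1 0, χ, hχ,
    fun a b => ?_⟩
  · simp [h00, h01, h10, h11]
  · simp only [h, Fin.sum_univ_one, Fin.sum_univ_two, Matrix.cons_val_fin_one,
      Matrix.cons_val_zero, Matrix.cons_val_one, map_smul, map_add, LinearMap.add_apply,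
      LinearMap.smul_apply, smul_eq_mul]
    congr 1
    ring

theorem exists_degenerates_isA3 [Infinite k] {x m : Fin n → k} {θ : (Fin n → k) →ₗ[k] k}
    (hx : x ≠ 0) (hθx : θ x = 0) (hθm : θ m = 1) (h : θ (μ x x) = 1) :
    ∃ χ, degenerates μ χ ∧ IsA3 χ := by
  obtain ⟨φ, hφ, hφm, χ, hχ, h2⟩ := exists_degenerates_line μ hx hθx hθm
  refine ⟨χ, hχ, φ, m, hφ, ?_, hφm, fun a b => by rw [h2, h, one_mul]⟩
  rintro rfl
  simp at hθm

theorem exists_degenerates_isF [Infinite k] {x y m : Fin n → k} {θ : (Fin n → k) →ₗ[k] k}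
    (hxy : LinearIndependent k ![x, y]) (hθx : θ x = 0) (hθy : θ y = 0)
    (hθm : θ m = 1) (hxx : θ (μ x x) = 1) (hyy : θ (μ y y) = 0) :
    ∃ χ, degenerates μ χ ∧ IsF (θ (μ x y)) (θ (μ y x)) χ := by
  obtain ⟨φ, ψ, hli, hφm, hψm, χ, hχ, h⟩ := exists_degenerates_plane μ hxy hθx hθy hθm
  refine ⟨χ, hχ, φ, ψ, m, hli, ?_, hφm, hψm, fun a b => by rw [h, hxx, hyy]; congr 1; ring⟩
  rintro rfl
  simp at hθm

theorem exists_degenerates_isT_zero [Infinite k] {x y m : Fin n → k} {θ : (Fin n → k) →ₗ[k] k}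
    (hxy : LinearIndependent k ![x, y]) (hθx : θ x = 0) (hθy : θ y = 0)
    (hθm : θ m = 1) (hxx : θ (μ x x) = 0) (hyy : θ (μ y y) = 0) (h1 : θ (μ x y) = 1)
    (h2 : θ (μ y x) = -1) : ∃ χ, degenerates μ χ ∧ IsT 0 0 0 χ := by
  obtain ⟨φ, ψ, hli, hφm, hψm, χ, hχ, h⟩ := exists_degenerates_plane μ hxy hθx hθy hθm
  refine ⟨χ, hχ, φ, ψ, m, hli, ?_, hφm, hψm, fun a b => ?_⟩
  · rintro rfl
    simp at hθm
  · rw [h, hxx, hyy, h1, h2]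
    module

theorem linearIndependent_pair_of_dual {φ ψ : (Fin n → k) →ₗ[k] k} {x y : Fin n → k}
    (h : φ x * ψ y - φ y * ψ x ≠ 0) : LinearIndependent k ![x, y] := by
  rw [LinearIndependent.pair_iff]
  intro s t hst
  have h1 := congr_arg φ hst
  have h2 := congr_arg ψ hst
  simp only [map_add, map_smul, smul_eq_mul, map_zero] at h1 h2
  constructor
  · exact (mul_eq_zero.1 (by linear_combination ψ y * h1 - φ y * h2 :
      s * (φ x * ψ y - φ y * ψ x) = 0)).resolve_right h
  · exact (mul_eq_zero.1 (by linear_combination φ x * h2 - ψ x * h1 :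
      t * (φ x * ψ y - φ y * ψ x) = 0)).resolve_right h

theorem exists_separating_functional {φ ψ : (Fin n → k) →ₗ[k] k} {x y v : Fin n → k}
    (h1 : φ x = 1) (h2 : φ y = 0) (h3 : ψ x = 0) (h4 : ψ y = 1) (hv : v ≠ 0) (hφv : φ v = 0)
    (hψv : ψ v = 0) : ∃ θ : (Fin n → k) →ₗ[k] k, θ x = 0 ∧ θ y = 0 ∧ θ v = 1 := by
  obtain ⟨f, hf⟩ := exists_dual_eq_one (k := k) hv
  exact ⟨f - f x • φ - f y • ψ, by simp [h1, h3], by simp [h2, h4], by simp [hf, hφv, hψv]⟩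

theorem exists_apply_eq_one_linearIndependent (hn : 2 ≤ n) {φ : (Fin n → k) →ₗ[k] k} (hφ : φ ≠ 0)
    {w : Fin n → k} (hw : w ≠ 0) : ∃ e, φ e = 1 ∧ LinearIndependent k ![e, w] := by
  obtain ⟨e, he⟩ := exists_apply_eq_one hφ
  have he0 : e ≠ 0 := by
    rintro rfl
    simp at he
  by_cases h : LinearIndependent k ![e, w]
  · exact ⟨e, he, h⟩
  · obtain ⟨y, hy, hφy⟩ := exists_ne_zero_forall_apply_eq_zero ![φ] hn
    replace hφy : φ y = 0 := hφy 0
    rw [LinearIndependent.pair_iff' he0] at h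
    push Not at h
    obtain ⟨c, rfl⟩ := h
    refine ⟨e + y, by simp [he, hφy], ?_⟩
    rw [LinearIndependent.pair_iff' (fun h0 => by simpa [he, hφy] using congr_arg φ h0)]
    intro a ha
    have hac := congr_arg φ ha
    simp [he, hφy] at hac
    subst hac
    simp [hy] at ha
    exact hw (by simp [ha])

theorem IsT.ne_zero (h : IsT 0 0 0 μ) : μ ≠ 0 := by
  obtain ⟨φ, ψ, v, hli, hv, hφv, hψv, hμ⟩ := h
  obtain ⟨x, y, h1, h2, h3, h4⟩ := exists_dual_pair hli
  rintro rfl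
  exact hv (by simpa [h1, h2, h3, h4] using (hμ x y).symm)

end Contractions

section Proper

variable {n : ℕ} {μ χ : AlgStr k n} [Infinite k]

theorem IsGamma.exists_proper {α β γ : k} (hn : 2 ≤ n) (h : IsGamma α β γ μ)
    (h0 : (α, β, γ) ≠ 0) : ∃ χ ≠ 0, properlyDegenerates μ χ := by
  obtain ⟨φ, w, hφ, hw, hφw, hμ⟩ := h
  obtain ⟨e, he, hew⟩ := exists_apply_eq_one_linearIndependent hn hφ hw
  obtain ⟨f, hf⟩ := exists_dual_family hew
  have hf0 : f 1 e = 0 := by simpa using hf 1 0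
  have hf1 : f 1 w = 1 := by simpa using hf 1 1
  obtain ⟨χ, hχ, h3⟩ := exists_degenerates_isA3 (μ := μ) (hew.ne_zero 0) hf0 hf1
    (by simp [hμ, he, hf0, hf1])
  refine ⟨χ, ?_, hχ, fun hmem => h0 ?_⟩
  · obtain ⟨φ', v, hφ', hv, -, hχ'⟩ := h3
    obtain ⟨x, hx⟩ := exists_apply_eq_one hφ'
    rintro rfl
    simpa [hx, hv] using (hχ' x x).symm
  · obtain ⟨φ', v, hφ', hv, hφv, hμ'⟩ := h3.of_mem_orbit (mem_orbit_symm hmem)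
    obtain ⟨y, hy, hφy⟩ := exists_ne_zero_forall_apply_eq_zero ![φ] hn
    replace hφy : φ y = 0 := hφy 0
    have h1 : ∀ x y z, μ (μ x y) z = 0 := fun x y z => by simp [hμ', hφv]
    have h2 : ∀ x y z, μ z (μ x y) = 0 := fun x y z => by simp [hμ', hφv]
    have hα : α = 0 := by simpa [hμ, he, hφy, hy] using h2 e y e
    have hβ : β = 0 := by simpa [hμ, he, hφy, hy] using h1 y e e
    have hγ : γ = 0 := by simpa [hμ, he, hα, hβ, hφw, hw] using h1 e e e
    simp [hα, hβ, hγ]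

theorem IsF.exists_proper {α β : k} (h : IsF α β μ) (h0 : (α, β) ≠ 0) :
    ∃ χ ≠ 0, properlyDegenerates μ χ := by
  obtain ⟨φ, ψ, v, hli, hv, hφv, hψv, hμ⟩ := h
  obtain ⟨x, y, h1, h2, h3, h4⟩ := exists_dual_pair hli
  obtain ⟨θ, hθx, hθy, hθv⟩ := exists_separating_functional h1 h2 h3 h4 hv hφv hψv
  obtain ⟨χ, hχ, h5⟩ := exists_degenerates_isA3 (μ := μ) (x := x)
    (by rintro rfl; simp at h1) hθx hθv (by simp [hμ, h1, h3, hθv])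
  refine ⟨χ, ?_, hχ, fun hmem => h0 ?_⟩
  · obtain ⟨φ', v, hφ', hv, -, hχ'⟩ := h5
    obtain ⟨x, hx⟩ := exists_apply_eq_one hφ'
    rintro rfl
    simpa [hx, hv] using (hχ' x x).symm
  · obtain ⟨φ', v', hφ', hv', hφv', hμ'⟩ := h5.of_mem_orbit (mem_orbit_symm hmem)
    have h6 : ∀ a b c d, θ (μ a b) * θ (μ c d) = θ (μ a c) * θ (μ b d) := fun a b c d => by
      simp only [hμ', map_smul, smul_eq_mul]
      ring
    have hα : α = 0 := by simpa [hμ, h1, h2, h3, h4, hθv] using h6 x x y y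
    have hβ : β = 0 := by simpa [hμ, h1, h2, h3, h4, hθv] using h6 y y x x
    simp [hα, hβ]

theorem IsT.exists_proper {β₁ β₂ δ : k} (hn : 3 ≤ n) (h : IsT β₁ β₂ δ μ)
    (h0 : (β₁, β₂, δ) ≠ 0) : ∃ χ ≠ 0, properlyDegenerates μ χ := by
  obtain ⟨φ, ψ, v, hli, hv, hφv, hψv, hμ⟩ := h
  obtain ⟨x, y₀, h1, h2, h3, h4⟩ := exists_dual_pair hli
  obtain ⟨z, hz, hφz⟩ := exists_ne_zero_forall_apply_eq_zero ![φ, ψ] hn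
  have hφz' : φ z = 0 := hφz 0
  have hψz : ψ z = 0 := hφz 1
  obtain ⟨y, h2, h4, hy⟩ : ∃ y, φ y = 0 ∧ ψ y = 1 ∧ v - δ • y ≠ 0 := by
    by_cases hy : v - δ • y₀ = 0
    · refine ⟨y₀ + z, by simp [h2, hφz'], by simp [h4, hψz], fun h5 => ?_⟩
      have h6 : δ • z = 0 := by
        rw [smul_add] at h5
        linear_combination (exp := 1) hy - h5
      have h7 : δ = 0 := by simpa [hz] using h6
      simp [h7, hv] at hy
    · exact ⟨y₀, h2, h4, hy⟩
  obtain ⟨θ, hθx, hθy, hθv⟩ := exists_separating_functional h1 h2 h3 h4 hy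
    (by simp [hφv, h2]) (by simp [hψv, h4])
  replace hθv : θ v = 1 := by simpa [hθy] using hθv
  obtain ⟨χ, hχ, h5⟩ := exists_degenerates_isT_zero (μ := μ) (x := x) (y := y) (m := v) (θ := θ)
    (linearIndependent_pair_of_dual (φ := φ) (ψ := ψ) (by simp [h1, h2, h3, h4])) hθx hθy hθv
    (by simp [hμ, h1, h3, hθx]) (by simp [hμ, h2, h4])
    (by simp [hμ, h1, h2, h3, h4, hθx, hθy, hθv]) (by simp [hμ, h1, h2, h3, h4, hθx, hθy, hθv])
  refine ⟨χ, h5.ne_zero, hχ, fun hmem => h0 ?_⟩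
  obtain ⟨φ', ψ', v', hli', hv', hφv', hψv', hμ'⟩ := h5.of_mem_orbit (mem_orbit_symm hmem)
  have h6 : ∀ x y z, μ (μ x y) z = 0 := fun x y z => by simp [hμ', hφv', hψv']
  have h7 : ∀ x y z, μ z (μ x y) = 0 := fun x y z => by simp [hμ', hφv', hψv']
  have hβ₁ : β₁ = 0 := by simpa [hμ, h1, h3, hφz', hψz, hz] using h7 x z x
  have hβ₂ : β₂ = 0 := by simpa [hμ, h1, h3, hφz', hψz, hz] using h6 z x x
  have hδ : δ = 0 := by simpa [hμ, h1, h3, hφv, hψv, hv, hβ₁, hβ₂] using h7 x v x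
  simp [hβ₁, hβ₂, hδ]

theorem exists_proper_of_rank_two {φ ψ χ : (Fin n → k) →ₗ[k] k} {v u : Fin n → k}
    (hli : LinearIndependent k ![φ, ψ, χ]) (hvu : LinearIndependent k ![v, u]) (hφv : φ v = 0)
    (hψv : ψ v = 0)
    (hμ : ∀ x y, μ x y = (φ x * ψ y - φ y * ψ x) • v + (φ x * χ y - φ y * χ x) • u) :
    ∃ χ ≠ 0, properlyDegenerates μ χ := by
  obtain ⟨x, y, z, ⟨h1, h2, h3⟩, ⟨h4, h5, h6⟩, h7, h8, h9⟩ := exists_dual_triple hli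
  obtain ⟨θ, hθx, hθy, hθv⟩ := exists_separating_functional h1 h2 h4 h5 (hvu.ne_zero 0) hφv hψv
  replace hθv : θ v = 1 := hθv
  obtain ⟨χ', hχ, h10⟩ := exists_degenerates_isT_zero (μ := μ) (x := x) (y := y) (m := v) (θ := θ)
    (linearIndependent_pair_of_dual (φ := φ) (ψ := ψ) (by simp [h1, h2, h4, h5])) hθx hθy hθv
    (by simp [hμ, h1, h4, h7]) (by simp [hμ, h2]) (by simp [hμ, h1, h2, h4, h5, h8, hθv])
    (by simp [hμ, h1, h2, h4, h5, h8, hθv])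
  refine ⟨χ', h10.ne_zero, hχ, fun hmem => ?_⟩
  obtain ⟨φ', ψ', v', -, -, -, -, hμ'⟩ := h10.of_mem_orbit (mem_orbit_symm hmem)
  obtain ⟨f, hf⟩ := exists_dual_family hvu
  have hf00 : f 0 v = 1 := by simpa using hf 0 0
  have hf01 : f 0 u = 0 := by simpa using hf 0 1
  have hf10 : f 1 v = 0 := by simpa using hf 1 0
  have hf11 : f 1 u = 1 := by simpa using hf 1 1
  have h11 : f 0 (μ x y) * f 1 (μ x z) = f 1 (μ x y) * f 0 (μ x z) := by
    simp only [hμ', map_smul, map_add, smul_eq_mul]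
    ring
  simp [hμ, h1, h2, h3, h4, h5, h6, h7, h8, h9, hf00, hf01, hf10, hf11] at h11

theorem IsT022.exists_proper (h : IsT022 μ) : ∃ χ ≠ 0, properlyDegenerates μ χ := by
  obtain ⟨φ, ψ, χ, v, u, hli, hvu, hφv, hφu, hψv, hψu, hχv, hχu, hμ⟩ := h
  exact exists_proper_of_rank_two hli hvu hφv hψv hμ

theorem IsT03.exists_proper (h : IsT03 μ) : ∃ χ ≠ 0, properlyDegenerates μ χ := by
  obtain ⟨φ, ψ, χ, v, u, hli, hvu, hφv, hφu, hψv, hψu, hχv, hχu, hμ⟩ := h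
  exact exists_proper_of_rank_two hli hvu hφv hψv hμ

theorem IsEta.exists_proper (h : IsEta μ) : ∃ χ ≠ 0, properlyDegenerates μ χ := by
  obtain ⟨φ, v, hφ, hv, hφv, hμ⟩ := h
  obtain ⟨p, hp⟩ := exists_dual_vectors hφ
  obtain ⟨θ, hθx, hθy, hθv⟩ := exists_separating_functional (φ := φ 0) (ψ := φ 1) (x := p 0)
    (y := p 1) (by simp [hp]) (by simp [hp]) (by simp [hp]) (by simp [hp]) hv (hφv 0) (hφv 1)
  obtain ⟨χ, hχ, h5⟩ := exists_degenerates_isT_zero (μ := μ) (x := p 0) (y := p 1) (m := v) (θ := θ)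
    (linearIndependent_pair_of_dual (φ := φ 0) (ψ := φ 1) (by simp [hp])) hθx hθy hθv
    (by simp [hμ, hp]) (by simp [hμ, hp]) (by simp [hμ, hp, hθv]) (by simp [hμ, hp, hθv])
  refine ⟨χ, h5.ne_zero, hχ, fun hmem => ?_⟩
  obtain ⟨φ', ψ', v', -, -, -, -, hμ'⟩ := h5.of_mem_orbit (mem_orbit_symm hmem)
  have h6 : θ (μ (p 0) (p 1)) * θ (μ (p 2) (p 3)) - θ (μ (p 0) (p 2)) * θ (μ (p 1) (p 3)) +
      θ (μ (p 0) (p 3)) * θ (μ (p 1) (p 2)) = 0 := by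
    simp only [hμ', map_smul, map_add, smul_eq_mul]
    ring
  simp [hμ, hp, hθv] at h6

theorem IsE4.exists_proper (h : IsE4 μ) : ∃ χ ≠ 0, properlyDegenerates μ χ := by
  obtain ⟨φ, ψ, hli, hμ⟩ := h
  obtain ⟨x, y, h1, h2, h3, h4⟩ := exists_dual_pair hli
  obtain ⟨χ, hχ, h⟩ := exists_degenerates_IW μ h1 (a := 1) (by simp [hμ, h1, h3])
  have hχ' : IsScalar 1 0 χ := ⟨φ, hli.ne_zero 0, fun a b => by
    rw [h, hμ, hμ]
    simp only [map_sub, map_add, map_smul, h1, h3, smul_eq_mul]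
    module⟩
  refine ⟨χ, ?_, hχ, fun hmem => ?_⟩
  · rintro rfl
    obtain ⟨φ', hφ', hμ'⟩ := hχ'
    obtain ⟨e, he⟩ := exists_apply_eq_one hφ'
    have h5 : e = 0 := by simpa [he] using (hμ' e e).symm
    simp [h5] at he
  · obtain ⟨φ', hφ', hμ'⟩ := hχ'.of_mem_orbit (mem_orbit_symm hmem)
    have h5 : φ' y = 0 := by simpa [hμ, h1, h2, h3, h4] using (congr_arg φ (hμ' y x)).symm
    have h6 := congr_arg ψ (hμ' y y)
    simp [hμ, h2, h4, h5] at h6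

end Proper

section Covering

variable {n : ℕ} {μ : AlgStr k n}

/-- Structures of level at most one or degenerating to one of the structures of level two. -/
def IsCovered (μ : AlgStr k n) : Prop := IsLow μ ∨ ∃ ν, IsListed ν ∧ degenerates μ ν

theorem IsCovered.of_isF {ν : AlgStr k n} {α β : k} (h : IsF α β ν) (h0 : (α, β) ≠ 0)
    (hd : degenerates μ ν) : IsCovered μ :=
  .inr ⟨ν, .inr (.inr (.inl ⟨α, β, h0, h⟩)), hd⟩

theorem exists_quadratic_root [IsAlgClosed k] (b c : k) : ∃ s : k, s * s + b * s + c = 0 := by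
  obtain ⟨s, hs⟩ := IsAlgClosed.exists_root
    (Polynomial.C 1 * Polynomial.X ^ 2 + Polynomial.C b * Polynomial.X + Polynomial.C c)
    (by rw [Polynomial.degree_quadratic one_ne_zero]; decide)
  refine ⟨s, ?_⟩
  simp [Polynomial.IsRoot] at hs
  linear_combination hs

theorem linearIndependent_pair_add_smul {x y : Fin n → k}
    (h : LinearIndependent k ![x, y]) (s : k) : LinearIndependent k ![x, y + s • x] := by
  rw [LinearIndependent.pair_iff] at h ⊢
  intro a b hab
  obtain ⟨h1, h2⟩ := h (a + b * s) b (by rw [← hab]; module)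
  subst h2
  simpa using h1

theorem square_of_not_isCovered [IsAlgClosed k] (h : ¬ IsCovered μ) {θ : (Fin n → k) →ₗ[k] k}
    {x y : Fin n → k} (hx : θ x = 0) (hxx : θ (μ x x) = 1) (hy : θ y = 0) :
    θ (μ x y) = θ (μ y x) ∧ θ (μ y y) = θ (μ x y) ^ 2 := by
  have hx0 : x ≠ 0 := by
    rintro rfl
    simp at hxx
  by_cases hxy : LinearIndependent k ![x, y]
  · have := IsAlgClosed.instInfinite (K := k)
    obtain ⟨s, hs⟩ := exists_quadratic_root (θ (μ x y) + θ (μ y x)) (θ (μ y y))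
    obtain ⟨χ, hχ, hF⟩ := exists_degenerates_isF (μ := μ) (linearIndependent_pair_add_smul hxy s) hx
      (by simp [hx, hy]) hxx hxx (by
        simp only [map_add, map_smul, LinearMap.add_apply, LinearMap.smul_apply, smul_eq_mul, hxx]
        linear_combination hs)
    by_cases h0 : (θ (μ x (y + s • x)), θ (μ (y + s • x) x)) = 0
    · simp only [Prod.mk_eq_zero, map_add, map_smul, LinearMap.add_apply, LinearMap.smul_apply,
        smul_eq_mul, hxx, mul_one] at h0
      obtain ⟨h1, h2⟩ := h0
      refine ⟨by linear_combination h1 - h2, ?_⟩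
      linear_combination hs - s * h2 - θ (μ x y) * h1
    · exact absurd (IsCovered.of_isF hF h0 hχ) h
  · rw [LinearIndependent.pair_iff' hx0] at hxy
    push Not at hxy
    obtain ⟨c, rfl⟩ := hxy
    simp only [map_smul, LinearMap.smul_apply, smul_eq_mul, hxx, mul_one]
    exact ⟨trivial, by ring⟩

theorem rank_one_of_not_isCovered [IsAlgClosed k] (h : ¬ IsCovered μ) {θ : (Fin n → k) →ₗ[k] k}
    {x y z : Fin n → k} (hx : θ x = 0) (hxx : θ (μ x x) ≠ 0) (hy : θ y = 0) (hz : θ z = 0) :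
    θ (μ x y) = θ (μ y x) ∧ θ (μ x x) * θ (μ y z) = θ (μ x y) * θ (μ x z) := by
  suffices H : ∀ {θ : (Fin n → k) →ₗ[k] k}, θ x = 0 → θ (μ x x) = 1 → θ y = 0 → θ z = 0 →
      θ (μ x y) = θ (μ y x) ∧ θ (μ y z) = θ (μ x y) * θ (μ x z) by
    obtain ⟨h1, h2⟩ := H (θ := (θ (μ x x))⁻¹ • θ) (by simp [hx]) (by simp [hxx]) (by simp [hy])
      (by simp [hz])
    simp only [LinearMap.smul_apply, smul_eq_mul] at h1 h2
    field_simp at h1 h2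
    exact ⟨h1, by linear_combination h2⟩
  clear hx hxx hy hz θ
  intro θ hx hxx hy hz
  refine ⟨(square_of_not_isCovered h hx hxx hy).1, ?_⟩
  obtain ⟨y', hy'⟩ : ∃ y', y' = y - θ (μ x y) • x := ⟨_, rfl⟩
  obtain ⟨z', hz'⟩ : ∃ z', z' = z - θ (μ x z) • x := ⟨_, rfl⟩
  have hθy' : θ y' = 0 := by simp [hy', hx, hy]
  have hθz' : θ z' = 0 := by simp [hz', hx, hz]
  have h1 : θ (μ x y') = 0 := by simp [hy', hxx]
  have h2 : θ (μ x z') = 0 := by simp [hz', hxx]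
  obtain ⟨h3, h4⟩ := square_of_not_isCovered h hx hxx hθy'
  obtain ⟨h5, h6⟩ := square_of_not_isCovered h hx hxx hθz'
  obtain ⟨h7, h8⟩ := square_of_not_isCovered h (x := x + y') (y := z') (by simp [hx, hθy'])
    (by simp [hxx, ← h3, h1, h4]) hθz'
  rw [h6, h2] at h8
  simp only [map_add, LinearMap.add_apply, h2, zero_add] at h8
  have h9 : θ (μ y' z') = 0 := by simpa using h8.symm
  rw [h1] at h3
  simp only [hy', hz', map_sub, map_smul, LinearMap.sub_apply, LinearMap.smul_apply, smul_eq_mul,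
    hxx] at h3 h9
  linear_combination h9 - θ (μ x z) * h3

theorem eq_zero_of_incidence_dense [Infinite k] {G : ((Fin n → k) →ₗ[k] k) → (Fin n → k) →
      (Fin n → k) → (Fin n → k) → k}
    (hG : ∀ (θ : k → (Fin n → k) →ₗ[k] k) (x y z : k → Fin n → k), PolyCurve θ → PolyCurve x →
      PolyCurve y → PolyCurve z → PolyCurve fun s => G (θ s) (x s) (y s) (z s))
    (h : ∀ (θ : (Fin n → k) →ₗ[k] k) x y z, θ (μ x x) ≠ 0 → θ x = 0 → θ y = 0 → θ z = 0 →
      G θ x y z = 0)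
    {θ₀ : (Fin n → k) →ₗ[k] k} {x₀ : Fin n → k} (hθ₀ : θ₀ x₀ = 0) (hμ₀ : θ₀ (μ x₀ x₀) ≠ 0)
    {θ : (Fin n → k) →ₗ[k] k} {x y z : Fin n → k} (hθ : θ ≠ 0) (hx : θ x = 0) (hy : θ y = 0)
    (hz : θ z = 0) : G θ x y z = 0 := by
  by_contra hne
  obtain ⟨p, hp⟩ := exists_apply_eq_one hθ
  obtain ⟨p₀, hp₀⟩ := exists_apply_eq_one (φ := θ₀) (by rintro rfl; simp at hμ₀)
  let Θ : k → (Fin n → k) →ₗ[k] k := fun s => θ₀ + s • (θ - θ₀)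
  let P : k → Fin n → k := fun s => p₀ + s • (p - p₀)
  let X : (Fin n → k) → (Fin n → k) → k → Fin n → k := fun u v s =>
    Θ s (P s) • (u + s • (v - u)) - Θ s (u + s • (v - u)) • P s
  have hΘ : PolyCurve Θ := (PolyCurve.const _).add (PolyCurve.const _).smul
  have hP : PolyCurve P := (PolyCurve.const _).add (PolyCurve.const _).smul
  have hev : ∀ {v : k → Fin n → k}, PolyCurve v → PolyCurve fun s => Θ s (v s) := fun hv =>
    hΘ.bilin hv LinearMap.id
  have hX : ∀ u v, PolyCurve (X u v) := fun u v =>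
    have huv : PolyCurve fun s : k => u + s • (v - u) :=
      (PolyCurve.const _).add (PolyCurve.const _).smul
    ((hev hP).smul' huv).sub ((hev huv).smul' hP)
  have hΘX : ∀ u v s, Θ s (X u v s) = 0 := fun u v s => by
    simp only [X, map_sub, map_smul, smul_eq_mul]
    ring
  have hΘ0 : Θ 0 = θ₀ := by simp [Θ]
  have hΘ1 : Θ 1 = θ := by simp [Θ]
  have hX0 : ∀ v, X x₀ v 0 = x₀ := fun v => by simp [X, hΘ0, P, hp₀, hθ₀]
  have hX1 : ∀ u v, θ v = 0 → X u v 1 = v := fun u v hv => by simp [X, hΘ1, P, hp, hv]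
  have e1 := (hev ((hX x₀ x).bilin (hX x₀ x) μ)).eventually_ne (s := 0)
    (by simpa only [hΘ0, hX0] using hμ₀)
  have e2 := (hG Θ (X x₀ x) (X x₀ y) (X x₀ z) hΘ (hX _ _) (hX _ _) (hX _ _)).eventually_ne (s := 1)
    (by simpa only [hΘ1, hX1 _ x hx, hX1 _ y hy, hX1 _ z hz] using hne)
  obtain ⟨s, h1, h2⟩ := (e1.and e2).exists
  exact h2 (h _ _ _ _ h1 (hΘX _ _ _) (hΘX _ _ _) (hΘX _ _ _))

theorem commutator_of_not_isCovered [IsAlgClosed k] (h : ¬ IsCovered μ)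
    {θ₀ : (Fin n → k) →ₗ[k] k} {x₀ : Fin n → k} (hθ₀ : θ₀ x₀ = 0) (hμ₀ : θ₀ (μ x₀ x₀) ≠ 0)
    {θ : (Fin n → k) →ₗ[k] k} {x y : Fin n → k} (hx : θ x = 0) (hy : θ y = 0) :
    θ (μ x y - μ y x) = 0 := by
  have := IsAlgClosed.instInfinite (K := k)
  by_cases hθ : θ = 0
  · simp [hθ]
  refine eq_zero_of_incidence_dense (μ := μ) (G := fun θ x y _ => θ (μ x y - μ y x))
    (fun Θ X Y Z hΘ hX hY _ => hΘ.bilin ((hX.bilin hY μ).sub (hY.bilin hX μ)) LinearMap.id)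
    (fun θ x y z h1 h2 h3 h4 => ?_) hθ₀ hμ₀ hθ hx hy hy
  rw [map_sub, (rank_one_of_not_isCovered h h2 h1 h3 h4).1, sub_self]

theorem rank_le_one_of_not_isCovered [IsAlgClosed k] (h : ¬ IsCovered μ)
    {θ₀ : (Fin n → k) →ₗ[k] k} {x₀ : Fin n → k} (hθ₀ : θ₀ x₀ = 0) (hμ₀ : θ₀ (μ x₀ x₀) ≠ 0)
    {θ : (Fin n → k) →ₗ[k] k} {x y z : Fin n → k} (hx : θ x = 0) (hy : θ y = 0) (hz : θ z = 0) :
    θ (μ x x) * θ (μ y z) = θ (μ x y) * θ (μ x z) := by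
  have := IsAlgClosed.instInfinite (K := k)
  by_cases hθ : θ = 0
  · simp [hθ]
  rw [← sub_eq_zero]
  refine eq_zero_of_incidence_dense (μ := μ)
    (G := fun θ x y z => θ (μ x x) * θ (μ y z) - θ (μ x y) * θ (μ x z))
    (fun Θ X Y Z hΘ hX hY hZ => ?_) (fun θ x y z h1 h2 h3 h4 => ?_) hθ₀ hμ₀ hθ hx hy hz
  · have hev : ∀ {v : k → Fin n → k}, PolyCurve v → PolyCurve fun s => Θ s (v s) := fun hv =>
      hΘ.bilin hv LinearMap.id
    exact ((hev (hX.bilin hX μ)).mul (hev (hY.bilin hZ μ))).sub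
      ((hev (hX.bilin hY μ)).mul (hev (hX.bilin hZ μ)))
  · rw [(rank_one_of_not_isCovered h h2 h1 h3 h4).2, sub_self]

/-- An alternating structure in which every two vectors span a subalgebra. -/
theorem exists_wedge_id {τ : AlgStr k n} (ha : ∀ x, τ x x = 0)
    (h : ∀ (θ : (Fin n → k) →ₗ[k] k) x y, θ x = 0 → θ y = 0 → θ (τ x y) = 0) :
    ∃ ρ : (Fin n → k) →ₗ[k] k, ∀ x y, τ x y = ρ x • y - ρ y • x := by
  classical
  let b := Pi.basisFun k (Fin n)
  let t : Fin n → Fin n → Fin n → k := fun i j l => τ (b i) (b j) l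
  have hanti : ∀ x y, τ x y = -τ y x := fun x y => by
    have h1 := ha (x + y)
    simp only [map_add, LinearMap.add_apply, ha, zero_add, add_zero] at h1
    exact eq_neg_of_add_eq_zero_right h1
  have hb : ∀ i j, b i j = if i = j then 1 else 0 := fun i j => by
    simp [b, Pi.single_apply, eq_comm]
  have h1 : ∀ i j l, l ≠ i → l ≠ j → t i j l = 0 := fun i j l hi hj =>
    h (LinearMap.proj l) _ _ (by simp [hb, hi.symm]) (by simp [hb, hj.symm])
  have h2 : ∀ i j l, i ≠ j → i ≠ l → t i j j = t i l l := fun i j l hij hil => by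
    by_cases hjl : j = l
    · rw [hjl]
    obtain ⟨θ, hθ⟩ : ∃ θ : (Fin n → k) →ₗ[k] k, ∀ x, θ x = x j - x l :=
      ⟨(LinearMap.proj j : (Fin n → k) →ₗ[k] k) - LinearMap.proj l, fun _ => rfl⟩
    have h3 := h θ (b i) (b j + b l) (by rw [hθ, hb, hb, if_neg hij, if_neg hil, sub_zero])
      (by simp [hθ, hb, hjl, Ne.symm hjl])
    have h4 := h1 i j l hil.symm (Ne.symm hjl)
    have h5 := h1 i l j hij.symm hjl
    simp only [t] at h4 h5
    simp only [map_add, hθ, Pi.add_apply, h4, h5] at h3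
    simp only [t]
    linear_combination h3
  let ρ₀ : Fin n → k := fun i => if hi : ∃ j, i ≠ j then t i hi.choose hi.choose else 0
  have hρ₀ : ∀ i j, i ≠ j → ρ₀ i = t i j j := fun i j hij => by
    have hi : ∃ j, i ≠ j := ⟨j, hij⟩
    simp only [ρ₀, dif_pos hi]
    exact h2 i _ j hi.choose_spec hij
  refine ⟨b.constr k ρ₀, fun x y => ?_⟩
  have key : τ = leftMul (b.constr k ρ₀) - (leftMul (b.constr k ρ₀)).flip := by
    refine b.ext fun i => b.ext fun j => ?_
    by_cases hij : i = j
    · subst hij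
      simp [ha]
    · ext l
      simp only [LinearMap.sub_apply, LinearMap.flip_apply, leftMul_apply,
          Module.Basis.constr_basis,
        Pi.sub_apply, Pi.smul_apply, hb, smul_eq_mul]
      by_cases hli : i = l
      · subst hli
        rw [hρ₀ j i (Ne.symm hij), hanti]
        simp [t, Ne.symm hij]
      · by_cases hlj : j = l
        · subst hlj
          rw [hρ₀ i j hij]
          simp [t, hij]
        · simpa [hli, hlj] using h1 i j l (Ne.symm hli) (Ne.symm hlj)
  rw [key]
  rfl

end Covering

section Pencil

variable {n : ℕ} {μ : AlgStr k n}

/-- Commutative structures all of whose scalar valued forms `θ(xy)` on `ker θ` have rank at most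
one. -/
def IsRankOne (μ : AlgStr k n) : Prop :=
  (∀ x y, μ x y = μ y x) ∧ ∀ (θ : (Fin n → k) →ₗ[k] k) (x y z : Fin n → k), θ x = 0 → θ y = 0 →
    θ z = 0 → θ (μ x x) * θ (μ y z) = θ (μ x y) * θ (μ x z)

theorem IsRankOne.sub (h : IsRankOne μ) (α : (Fin n → k) →ₗ[k] k) :
    IsRankOne (μ - leftMul α - (leftMul α).flip) := by
  refine ⟨fun x y => ?_, fun θ x y z hx hy hz => ?_⟩
  · simp only [LinearMap.sub_apply, LinearMap.flip_apply, leftMul_apply]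
    rw [h.1 x y]
    abel
  · simpa [hx, hy, hz] using h.2 θ x y z hx hy hz

theorem IsRankOne.pencil (h : IsRankOne μ) {θ η : (Fin n → k) →ₗ[k] k} {w : Fin n → k}
    (hw : θ w = 1) (hη : η w = 0) {q : k → (Fin n → k) → (Fin n → k) → k}
    (hq : ∀ s x y, q s x y = θ (μ x y) + s * (η (μ x y) - η x * θ (μ w y) - η y * θ (μ w x))
      + s ^ 2 * (η x * η y * θ (μ w w) - η x * η (μ w y) - η y * η (μ w x))
      + s ^ 3 * (η x * η y * η (μ w w)))
    {x y z : Fin n → k} (hx : θ x = 0) (hy : θ y = 0) (hz : θ z = 0) (s : k) :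
    q s x x * q s y z = q s x y * q s x z := by
  have key : ∀ x y, q s x y = (θ + s • η) (μ (x - (s * η x) • w) (y - (s * η y) • w)) := by
    intro x y
    rw [hq]
    simp only [map_sub, map_smul, LinearMap.sub_apply, LinearMap.smul_apply, LinearMap.add_apply,
      smul_eq_mul, h.1 x w]
    ring
  simp only [key]
  apply h.2 <;> simp [hx, hy, hz, hw, hη]

theorem cubic_coeff_eq_zero [Infinite k] {a₁ a₂ a₃ b₁ b₂ b₃ c₁ c₂ c₃ d₁ d₂ d₃ : k}
    (h : ∀ s, (1 + s * a₁ + s ^ 2 * a₂ + s ^ 3 * a₃) * (s * b₁ + s ^ 2 * b₂ + s ^ 3 * b₃) =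
      (s * c₁ + s ^ 2 * c₂ + s ^ 3 * c₃) * (s * d₁ + s ^ 2 * d₂ + s ^ 3 * d₃)) : b₁ = 0 := by
  have hc := PolyCurve.const (k := k) (V := k)
  have hid := PolyCurve.id (k := k)
  have h0 := PolyCurve.eq_zero_of_ne (F := fun s : k =>
    (1 + s * a₁ + s ^ 2 * a₂ + s ^ 3 * a₃) * (b₁ + s * b₂ + s ^ 2 * b₃) -
      s * ((c₁ + s * c₂ + s ^ 2 * c₃) * (d₁ + s * d₂ + s ^ 2 * d₃)))
    ((((((hc _).add (hid.mul (hc _))).add ((hid.pow 2).mul (hc _))).add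
      ((hid.pow 3).mul (hc _))).mul (((hc _).add (hid.mul (hc _))).add
      ((hid.pow 2).mul (hc _)))).sub (hid.mul ((((hc _).add (hid.mul (hc _))).add
      ((hid.pow 2).mul (hc _))).mul (((hc _).add (hid.mul (hc _))).add
      ((hid.pow 2).mul (hc _)))))) (fun s hs => mul_left_cancel₀ hs (by linear_combination h s)) 0
  simpa using h0

theorem IsRankOne.mul_eq_of_orthogonal [Infinite k] (h : IsRankOne μ)
    {θ : (Fin n → k) →ₗ[k] k} {w e u v : Fin n → k} (hw : θ w = 1) (he : θ e = 0)
    (hee : θ (μ e e) = 1) (hu : θ u = 0) (hv : θ v = 0) (heu : θ (μ e u) = 0)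
    (hev : θ (μ e v) = 0) : μ u v = θ (μ w v) • u + θ (μ w u) • v := by
  have huv : θ (μ u v) = 0 := by
    have := h.2 θ e u v he hu hv
    rwa [hee, heu, one_mul, zero_mul] at this
  refine eq_of_forall_dual (k := k) fun f => ?_
  have hη : (f - f w • θ) w = 0 := by simp [hw]
  have hp := h.pencil hw hη (q := _) (fun s x y => rfl) he hu hv
  simp only [hee, huv, heu, hev, zero_add] at hp
  have := cubic_coeff_eq_zero hp
  simp only [LinearMap.sub_apply, LinearMap.smul_apply, smul_eq_mul, huv, hu, hv, mul_zero,
    sub_zero] at this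
  simp only [map_add, map_smul, smul_eq_mul]
  linear_combination this

theorem exists_smul_of_forall_dual {u v : Fin n → k} (h : ∀ f : (Fin n → k) →ₗ[k] k, f u = 0 →
    f v = 0) : ∃ c : k, v = c • u := by
  by_cases hu : u = 0
  · refine ⟨0, eq_of_forall_dual (k := k) fun f => ?_⟩
    simpa using h f (by simp [hu])
  obtain ⟨f, hf⟩ := exists_dual_eq_one (k := k) hu
  refine ⟨f v, eq_of_forall_dual (k := k) fun g => ?_⟩
  have := h (g - g u • f) (by simp [hf])
  simp only [LinearMap.sub_apply, LinearMap.smul_apply, smul_eq_mul] at this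
  rw [map_smul, smul_eq_mul]
  linear_combination this

theorem exists_scalar_of_forall {V : Type*} [AddCommGroup V] [Module k V] (K : Submodule k V)
    (T : V →ₗ[k] V) (h : ∀ u ∈ K, ∃ c : k, T u = c • u) : ∃ c : k, ∀ u ∈ K, T u = c • u := by
  by_cases hK : ∃ u₀ ∈ K, u₀ ≠ 0
  · obtain ⟨u₀, hu₀, hne⟩ := hK
    obtain ⟨c, hc⟩ := h u₀ hu₀
    refine ⟨c, fun u hu => ?_⟩
    by_cases hli : LinearIndependent k ![u₀, u]
    · obtain ⟨d, hd⟩ := h u hu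
      obtain ⟨f, hf⟩ := h (u₀ + u) (K.add_mem hu₀ hu)
      rw [LinearIndependent.pair_iff] at hli
      obtain ⟨h1, h2⟩ := hli (c - f) (d - f) (by
        rw [map_add, hc, hd] at hf
        rw [smul_add] at hf
        rw [show (c - f) • u₀ + (d - f) • u = c • u₀ + d • u - (f • u₀ + f • u) by module, hf,
          sub_self])
      rw [hd, sub_eq_zero.mp h1, sub_eq_zero.mp h2]
    · rw [LinearIndependent.pair_iff' hne] at hli
      push Not at hli
      obtain ⟨a, rfl⟩ := hli
      rw [map_smul, hc, smul_comm]
  · push Not at hK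
    exact ⟨0, fun u hu => by simp [hK u hu]⟩

theorem IsRankOne.mul_eq_smul_of_orthogonal [Infinite k] (h : IsRankOne μ)
    {θ : (Fin n → k) →ₗ[k] k} {w e u : Fin n → k} (hw : θ w = 1) (he : θ e = 0) (hu : θ u = 0)
        (heu : θ (μ e u) = 0) (hwu : θ (μ w u) = 0)
    (huu : μ u u = 0) : ∃ c : k, μ e u = c • u := by
  refine exists_smul_of_forall_dual fun f hf => ?_
  have hη : (f - f w • θ) w = 0 := by simp [hw]
  have hηu : (f - f w • θ) u = 0 := by simp [hf, hu]
  have hp := h.pencil hw hη (q := _) (fun s x y => rfl) hu he he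
  simp only [huu, hηu, h.1 u e, heu, map_zero, hwu, zero_mul, mul_zero, sub_zero, add_zero,
    zero_add, zero_sub, zero_eq_mul_self, mul_neg] at hp
  have h0 := PolyCurve.eq_zero_of_ne (F := fun s : k => (f - f w • θ) (μ e u) +
    s * -((f - f w • θ) e * (f - f w • θ) (μ w u)))
    ((PolyCurve.const _).add (PolyCurve.id.mul (PolyCurve.const _)))
    (fun s hs => mul_left_cancel₀ hs (by
      linear_combination hp s)) 0
  simpa [heu] using h0

end Pencil

section NormalForm

variable {n : ℕ} {μ : AlgStr k n}

theorem quadratic_coeff_eq_zero [Infinite k] {a b c : k}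
    (h : ∀ s, s ≠ 0 → a + s * (b + s * c) = 0) : a = 0 ∧ b = 0 ∧ c = 0 := by
  have hc := PolyCurve.const (k := k) (V := k)
  have hid := PolyCurve.id (k := k)
  have ha := PolyCurve.eq_zero_of_ne ((hc a).add (hid.mul ((hc b).add (hid.mul (hc c))))) h 0
  simp only [zero_mul, add_zero] at ha
  subst ha
  have hb := PolyCurve.eq_zero_of_ne ((hc b).add (hid.mul (hc c)))
    (fun s hs => mul_left_cancel₀ hs (by linear_combination h s hs)) 0
  simp only [zero_mul, add_zero] at hb
  subst hb
  have h1 := PolyCurve.eq_zero_of_ne (hc c)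
    (fun s hs => mul_left_cancel₀ (mul_ne_zero hs hs) (by linear_combination h s hs)) 0
  exact ⟨rfl, rfl, h1⟩

theorem IsRankOne.pencil_coeff [Infinite k] (h : IsRankOne μ) {θ η : (Fin n → k) →ₗ[k] k}
    {w e u : Fin n → k} (hw : θ w = 1) (he : θ e = 0) (hee : μ e e = w) (hηw : η w = 0)
    (hηe : η e = 0) (hu : θ u = 0) (huu : μ u u = 0) (heu : μ e u = 0) (hwu : θ (μ w u) = 0)
    (hηu : η u = 1) :
    η (μ w e) = 0 ∧ η (μ w w) = 0 ∧ θ (μ w w) = θ (μ w e) ^ 2 + 2 * η (μ w u) := by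
  have hp := h.pencil hw hηw (q := _) (fun s x y => rfl) he hu hu
  simp only [hee, heu, huu, hwu, hηe, hηu, hηw, hw, map_zero] at hp
  obtain ⟨h1, h2, h3⟩ := quadratic_coeff_eq_zero (a := θ (μ w w) - 2 * η (μ w u) - θ (μ w e) ^ 2)
    (b := η (μ w w) - 2 * θ (μ w e) * η (μ w e)) (c := - η (μ w e) ^ 2) (fun s hs =>
      mul_left_cancel₀ (mul_ne_zero hs hs) (by linear_combination hp s))
  have h4 : η (μ w e) = 0 := by simpa using h3
  rw [h4] at h2
  exact ⟨h4, by simpa using h2, by linear_combination h1⟩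

theorem eq_add_of_forall_dual {θ φ : (Fin n → k) →ₗ[k] k} {w e v : Fin n → k} (hθw : θ w = 1)
    (hθe : θ e = 0) (hφw : φ w = 0) (hφe : φ e = 1)
    (h : ∀ η : (Fin n → k) →ₗ[k] k, η w = 0 → η e = 0 → η v = 0) : v = θ v • w + φ v • e := by
  refine eq_of_forall_dual (k := k) fun f => ?_
  have := h (f - f w • θ - f e • φ) (by simp [hθw, hφw]) (by simp [hθe, hφe])
  simp only [LinearMap.sub_apply, LinearMap.smul_apply, smul_eq_mul] at this
  simp only [map_add, map_smul, smul_eq_mul]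
  linear_combination this

theorem IsRankOne.mul_eq_of_mul_self [Infinite k] (h : IsRankOne μ)
    {θ φ : (Fin n → k) →ₗ[k] k} {w e : Fin n → k} (hθw : θ w = 1) (hθe : θ e = 0) (hφw : φ w = 0)
    (hφe : φ e = 1) (hee : μ e e = w) (heu : ∀ u, θ u = 0 → φ u = 0 → μ e u = 0)
    (hwu : ∀ u, θ u = 0 → φ u = 0 → θ (μ w u) = 0)
    (huv : ∀ u v, θ u = 0 → φ u = 0 → θ v = 0 → φ v = 0 → μ u v = 0)
    (hne : ∃ u, u ≠ 0 ∧ θ u = 0 ∧ φ u = 0) :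
    ∃ κ : k, ∀ x y, μ x y = (κ * θ x) • y + (κ * θ y) • x +
      ((φ x + θ (μ w e) * θ x) * (φ y + θ (μ w e) * θ y)) • w := by
  have hdec : ∀ x, θ (x - θ x • w - φ x • e) = 0 ∧ φ (x - θ x • w - φ x • e) = 0 := fun x => by
    simp [hθw, hθe, hφw, hφe]
  have hann : ∀ (η : (Fin n → k) →ₗ[k] k) v, θ v = 0 → φ v = 0 → η w = 0 → η (e + v) = 0 →
      η (μ w (e + v)) = 0 ∧ η (μ w w) = 0 := by
    intro η v hv hv' hηw hηe
    by_cases hη : ∃ u, θ u = 0 ∧ φ u = 0 ∧ η u ≠ 0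
    · obtain ⟨u, hu, hu', hηu⟩ := hη
      have h1 : μ (e + v) (e + v) = w := by
        simp [hee, heu v hv hv', h.1 v e, huv v v hv hv' hv hv']
      have := h.pencil_coeff (η := η) (u := (η u)⁻¹ • u) hθw (by simp [hθe, hv]) h1 hηw hηe
        (by simp [hu]) (by simp [huv u u hu hu' hu hu'])
        (by simp [heu u hu hu', huv v u hv hv' hu hu']) (by simp [hwu u hu hu']) (by simp [hηu])
      exact ⟨this.1, this.2.1⟩
    · push Not at hη
      have h2 : ∀ x, η x = 0 := fun x => by
        have h3 := hη _ (hdec x).1 (hdec x).2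
        have h4 := hη v hv hv'
        rw [map_add, h4, add_zero] at hηe
        simpa [hηw, hηe] using h3
      exact ⟨h2 _, h2 _⟩
  obtain ⟨u, hu0, hu, hu'⟩ := hne
  obtain ⟨f, hf⟩ := exists_dual_eq_one (k := k) hu0
  obtain ⟨η, hη⟩ : ∃ η : (Fin n → k) →ₗ[k] k, η = f - f w • θ - f e • φ := ⟨_, rfl⟩
  have hηw : η w = 0 := by simp [hη, hθw, hφw]
  have hηe : η e = 0 := by simp [hη, hθe, hφe]
  have hηu : η u = 1 := by simp [hη, hu, hu', hf]
  have hwe := eq_add_of_forall_dual hθw hθe hφw hφe (v := μ w e) fun ζ h1 h2 => by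
    simpa using (hann ζ 0 (by simp) (by simp) h1 (by simpa using h2)).1
  have hww := eq_add_of_forall_dual hθw hθe hφw hφe (v := μ w w) fun ζ h1 h2 =>
    (hann ζ 0 (by simp) (by simp) h1 (by simpa using h2)).2
  have hφww : φ (μ w w) = 0 := by
    have h1 := (hann (φ - η) u hu hu' (by simp [hφw, hηw]) (by simp [hφe, hηe, hu', hηu])).2
    rw [hww] at h1
    simpa [hφw, hηw, hφe, hηe] using h1
  obtain ⟨κ, hκ⟩ : ∃ κ, κ = φ (μ w e) := ⟨_, rfl⟩
  have hwv' : ∀ v, θ v = 0 → φ v = 0 → μ w v - κ • v = φ (μ w v - κ • v) • (e + v) := by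
    intro v hv hv'
    have := eq_add_of_forall_dual (e := e + v) hθw (by simp [hθe, hv]) hφw (by simp [hφe, hv'])
      (v := μ w v - κ • v) fun ζ h1 h2 => by
        have h3 := (hann ζ v hv hv' h1 h2).1
        rw [map_add, hwe, ← hκ] at h3
        rw [map_add] at h2
        simp only [map_add, map_smul, smul_eq_mul, h1] at h3
        simp only [map_sub, map_smul, smul_eq_mul]
        linear_combination h3 - κ * h2
    simpa [hwu v hv hv', hv] using this
  have hwv : ∀ v, θ v = 0 → φ v = 0 → μ w v = κ • v := by
    intro v hv hv'
    by_cases hv0 : v = 0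
    · simp [hv0]
    obtain ⟨c, hc⟩ := ((eventually_cofinite_ne (0 : k)).and (eventually_cofinite_ne (1 : k))).exists
    have h1 := hwv' v hv hv'
    have h2 := hwv' (c • v) (by simp [hv]) (by simp [hv'])
    simp only [map_smul, map_sub, hv', smul_eq_mul, mul_zero, sub_zero] at h1 h2
    rw [smul_comm κ c v, ← smul_sub, h1] at h2
    have h3 : (c * φ (μ w v) * (1 - c)) • v = 0 := by
      rw [show (c * φ (μ w v) * (1 - c)) • v = c • φ (μ w v) • (e + v) -
        (c * φ (μ w v)) • (e + c • v) by module, h2, sub_self]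
    have h4 : φ (μ w v) = 0 := by
      simpa [hv0, hc.1, sub_eq_zero, Ne.symm hc.2] using h3
    rw [h4, zero_smul, sub_eq_zero] at h1
    exact h1
  have hκ' : θ (μ w w) = θ (μ w e) ^ 2 + 2 * κ := by
    have := (h.pencil_coeff hθw hθe hee hηw hηe hu (huv u u hu hu' hu hu') (heu u hu hu')
      (hwu u hu hu') hηu).2.2
    rwa [hwv u hu hu', map_smul, hηu, smul_eq_mul, mul_one] at this
  refine ⟨κ, fun x y => ?_⟩
  obtain ⟨x', hx'⟩ : ∃ x', x' = x - θ x • w - φ x • e := ⟨_, rfl⟩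
  obtain ⟨y', hy'⟩ : ∃ y', y' = y - θ y • w - φ y • e := ⟨_, rfl⟩
  obtain ⟨h1, h2⟩ := hx' ▸ hdec x
  obtain ⟨h3, h4⟩ := hy' ▸ hdec y
  have hx : x = θ x • w + φ x • e + x' := by rw [hx']; abel
  have hy : y = θ y • w + φ y • e + y' := by rw [hy']; abel
  have e1 : μ x y = μ (θ x • w + φ x • e + x') (θ y • w + φ y • e + y') := by rw [← hx, ← hy]
  rw [e1]
  simp only [map_add, map_smul, LinearMap.add_apply, LinearMap.smul_apply, h.1 e w, h.1 x' w,
    h.1 x' e, hwv x' h1 h2, hwv y' h3 h4, heu x' h1 h2, heu y' h3 h4, huv x' y' h1 h2 h3 h4, hee]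
  rw [hww, hφww, hκ']
  generalize θ (μ w e) = g at hwe ⊢
  rw [hwe, ← hκ, hx', hy']
  module

theorem IsRankOne.mul_eq [Infinite k] (hn : 3 ≤ n) (h : IsRankOne μ)
    {θ : (Fin n → k) →ₗ[k] k} {e : Fin n → k} (hθe : θ e = 0) (hee : θ (μ e e) = 1) :
    ∃ (α φ : (Fin n → k) →ₗ[k] k) (w : Fin n → k), ∀ x y,
      μ x y = α x • y + α y • x + (φ x * φ y) • w := by
  obtain ⟨w, hw⟩ := exists_apply_eq_one (φ := θ) (by rintro rfl; simp at hee)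
  obtain ⟨φ, hφ⟩ : ∃ φ : (Fin n → k) →ₗ[k] k, ∀ x, φ x = θ (μ e x) - θ x * θ (μ e w) :=
    ⟨θ.comp (μ e) - θ (μ e w) • θ, fun x => by simp [mul_comm]⟩
  have hφw : φ w = 0 := by simp [hφ, hw]
  have hφe : φ e = 1 := by simp [hφ, hθe, hee]
  have hφu : ∀ x, θ x = 0 → φ x = θ (μ e x) := fun x hx => by simp [hφ, hx]
  obtain ⟨α, hα⟩ : ∃ α : (Fin n → k) →ₗ[k] k, ∀ x, α x = θ (μ w x) - θ x * θ (μ w w) :=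
    ⟨θ.comp (μ w) - θ (μ w w) • θ, fun x => by simp [mul_comm]⟩
  have hαw : α w = 0 := by simp [hα, hw]
  obtain ⟨μ₁, hμ₁⟩ : ∃ μ₁, μ₁ = μ - leftMul α - (leftMul α).flip := ⟨_, rfl⟩
  have h₁ : IsRankOne μ₁ := hμ₁ ▸ h.sub α
  have e₁ : ∀ x y, μ₁ x y = μ x y - α x • y - α y • x := fun x y => by simp [hμ₁, leftMul_apply]
  have hwx₁ : ∀ x, θ x = 0 → θ (μ₁ w x) = 0 := fun x hx => by simp [e₁, hαw, hx, hα, hw]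
  have hθ₁ : ∀ x y, θ x = 0 → θ y = 0 → θ (μ₁ x y) = θ (μ x y) := fun x y hx hy => by
    simp [e₁, hx, hy]
  have huv₁ : ∀ u v, θ u = 0 → φ u = 0 → θ v = 0 → φ v = 0 → μ₁ u v = 0 := by
    intro u v hu hu' hv hv'
    rw [h₁.mul_eq_of_orthogonal hw hθe (by rw [hθ₁ e e hθe hθe, hee]) hu hv
      (by rw [hθ₁ e u hθe hu, ← hφu u hu, hu']) (by rw [hθ₁ e v hθe hv, ← hφu v hv, hv']),
      hwx₁ u hu, hwx₁ v hv, zero_smul, zero_smul, add_zero]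
  obtain ⟨f, hf⟩ := exists_scalar_of_forall (LinearMap.ker θ ⊓ LinearMap.ker φ) (μ₁ e) (by
    rintro u ⟨hu, hu'⟩
    rw [SetLike.mem_coe, LinearMap.mem_ker] at hu hu'
    exact h₁.mul_eq_smul_of_orthogonal hw hθe hu
      (by rw [hθ₁ e u hθe hu, ← hφu u hu, hu']) (hwx₁ u hu) (huv₁ u u hu hu' hu hu'))
  obtain ⟨μ₂, hμ₂⟩ : ∃ μ₂, μ₂ = μ₁ - leftMul (f • φ) - (leftMul (f • φ)).flip := ⟨_, rfl⟩
  have h₂ : IsRankOne μ₂ := hμ₂ ▸ h₁.sub (f • φ)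
  have e₂ : ∀ x y, μ₂ x y = μ₁ x y - (f * φ x) • y - (f * φ y) • x := fun x y => by
    simp [hμ₂, leftMul_apply]
  have hθ₂ : ∀ x y, θ x = 0 → θ y = 0 → θ (μ₂ x y) = θ (μ x y) := fun x y hx hy => by
    rw [← hθ₁ x y hx hy]
    simp [e₂, hx, hy]
  have hθw : θ (μ₂ e e) = 1 := by rw [hθ₂ e e hθe hθe, hee]
  have heu₂ : ∀ u, θ u = 0 → φ u = 0 → μ₂ e u = 0 := fun u hu hu' => by
    rw [e₂, hf u ⟨hu, hu'⟩, hφe, hu']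
    module
  obtain ⟨ψ, hψ⟩ : ∃ ψ : (Fin n → k) →ₗ[k] k, ψ = φ - φ (μ₂ e e) • θ := ⟨_, rfl⟩
  have hker : ∀ u, θ u = 0 → ψ u = 0 → φ u = 0 := fun u hu hu' => by simpa [hψ, hu] using hu'
  obtain ⟨y, hy0, hy⟩ := exists_ne_zero_forall_apply_eq_zero ![θ, φ] (by omega)
  have hy1 : θ y = 0 := by simpa using hy 0
  have hy2 : φ y = 0 := by simpa using hy 1
  obtain ⟨κ, hκ⟩ := h₂.mul_eq_of_mul_self (φ := ψ) (w := μ₂ e e) (e := e) hθw hθe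
    (by simp [hψ, hθw])
    (by simp [hψ, hφe, hθe]) rfl (fun u hu hu' => heu₂ u hu (hker u hu hu'))
    (fun u hu hu' => by
      replace hu' := hker u hu hu'
      have h3 : θ (μ₂ (μ₂ e e - w) u) = 0 := by
        have h4 := h₂.2 θ e (μ₂ e e - w) u hθe (by simp [hθw, hw]) hu
        rwa [hθw, heu₂ u hu hu', map_zero, mul_zero, one_mul] at h4
      have h5 : θ (μ₂ w u) = 0 := by simp [e₂, hwx₁ u hu, hφw, hu', hu]
      rw [map_sub, LinearMap.sub_apply, map_sub, h5, sub_zero] at h3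
      exact h3)
    (fun u v hu hu' hv hv' => by
      replace hu' := hker u hu hu'
      replace hv' := hker v hv hv'
      rw [e₂, huv₁ u v hu hu' hv hv', hu', hv']
      module) ⟨y, hy0, hy1, by simp [hψ, hy1, hy2]⟩
  refine ⟨α + f • φ + κ • θ, ψ + θ (μ₂ (μ₂ e e) e) • θ, μ₂ e e, fun x y => ?_⟩
  have h6 : μ x y = μ₂ x y + (α x + f * φ x) • y + (α y + f * φ y) • x := by
    rw [e₂, e₁]
    module
  rw [h6, hκ]
  simp only [LinearMap.add_apply, LinearMap.smul_apply, smul_eq_mul]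
  module

end NormalForm

section Forms

variable {n : ℕ} {μ : AlgStr k n}

theorem IsCovered.of_isGamma {ν : AlgStr k n} {α β γ : k} (h : IsGamma α β γ ν)
    (h0 : (α, β, γ) ≠ 0) (hd : degenerates μ ν) : IsCovered μ :=
  .inr ⟨ν, .inl ⟨α, β, γ, h0, h⟩, hd⟩

theorem isCovered_of_wedge {α β : (Fin n → k) →ₗ[k] k} (hμ : ∀ x y, μ x y = α x • y + β y • x) :
    IsCovered μ := by
  by_cases hli : LinearIndependent k ![α, β]
  · exact .inr ⟨μ, .inr (.inl ⟨α, β, hli, hμ⟩), degenerates_self μ⟩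
  left
  by_cases hα : α = 0
  · by_cases hβ : β = 0
    · exact .inl (LinearMap.ext₂ fun x y => by simp [hμ, hα, hβ])
    · exact .inr (.inr (.inr ⟨0, 1, β, hβ, fun x y => by simp [hμ, hα]⟩))
  · rw [LinearIndependent.pair_iff' hα] at hli
    push Not at hli
    obtain ⟨c, rfl⟩ := hli
    exact .inr (.inr (.inr ⟨1, c, α, hα, fun x y => by simp [hμ]⟩))

theorem isCovered_of_form_of_apply_ne [Infinite k] {α β φ : (Fin n → k) →ₗ[k] k} {w : Fin n → k}
    (hμ : ∀ x y, μ x y = α x • y + β y • x + (φ x * φ y) • w) (hφ : φ w ≠ 0) : IsCovered μ := by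
  obtain ⟨f, hf⟩ : ∃ f, f = (φ w)⁻¹ • w := ⟨_, rfl⟩
  have hφf : φ f = 1 := by simp [hf, hφ]
  have hw : w = φ w • f := by rw [hf, smul_inv_smul₀ hφ]
  obtain ⟨χ, hχ, h⟩ := exists_degenerates_IW μ hφf (a := α f + β f + φ w) (by
    rw [hμ, hφf, one_mul, one_smul]
    conv_lhs => rw [hw]
    rw [add_smul, add_smul])
  refine IsCovered.of_isGamma (α := α f) (β := β f) (γ := φ w) ⟨φ, w, ?_, ?_, rfl, fun x y => ?_⟩
    (by simp [hφ]) hχ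
  · rintro rfl
    simp at hφ
  · rintro rfl
    simp at hφ
  · rw [h, hμ, hμ]
    simp only [map_sub, map_add, map_smul, smul_eq_mul, hφf]
    generalize φ w = c at hw ⊢
    rw [hw]
    module

theorem isCovered_of_form_of_apply_zero [Infinite k] {α β φ ψ : (Fin n → k) →ₗ[k] k}
    {w e : Fin n → k} (hμ : ∀ x y, μ x y = α x • y + β y • x + (φ x * φ y) • w)
    (hφw : φ w = 0) (hφe : φ e = 1) (hψw : ψ w = 1) (hψe : ψ e = 0) (hα : α w = 0) (hβ : β w = 0)
    (h0 : (α e, β e) ≠ 0) : IsCovered μ := by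
  let P : (Fin n → k) →ₗ[k] (Fin n → k) := φ.smulRight e + ψ.smulRight w
  have hP : ∀ x, P x = φ x • e + ψ x • w := fun x => rfl
  let h : k → (Fin n → k) →ₗ[k] (Fin n → k) := fun t => P + t • (LinearMap.id - P)
  have hh : ∀ t x, h t x = P x + t • (x - P x) := fun t x => rfl
  have hφh : ∀ t x, φ (h t x) = φ x := fun t x => by simp [hh, hP, hφw, hφe]
  have hψh : ∀ t x, ψ (h t x) = ψ x := fun t x => by simp [hh, hP, hψw, hψe]
  have hhw : ∀ t, h t w = w := fun t => by simp [hh, hP, hψw, hφw]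
  have hhα : ∀ (α : (Fin n → k) →ₗ[k] k), α w = 0 → ∀ t x,
      α (h t x) = φ x * α e + t * (α x - φ x * α e) := fun α hα t x => by
    simp [hh, hP, hα]
  have hid := PolyCurve.id (k := k)
  obtain ⟨χ, hχ, hχ'⟩ := exists_degenerates_of_family (μ := μ) h
    (fun t x y => (φ x * α e + t * (α x - φ x * α e)) • y +
      (φ y * β e + t * (β y - φ y * β e)) • x + (φ x * φ y) • w)
    (fun x y => ((((PolyCurve.const _).add (hid.mul (PolyCurve.const _))).smul'
      (PolyCurve.const _)).add (((PolyCurve.const _).add (hid.mul (PolyCurve.const _))).smul'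
      (PolyCurve.const _))).add (PolyCurve.const _))
    (fun t ht => (injective_iff_map_eq_zero _).2 fun x hx => by
      have h1 := hφh t x
      have h2 := hψh t x
      rw [hx, map_zero] at h1 h2
      simpa [hh, hP, ← h1, ← h2, ht] using hx)
    (fun t ht x y => by
      rw [hμ, hφh, hφh, hhα α hα, hhα β hβ]
      simp only [map_add, map_smul, hhw])
  refine IsCovered.of_isGamma (α := α e) (β := β e) (γ := 0) ⟨φ, w, ?_, ?_, hφw, fun x y => ?_⟩
    (by simpa using h0) hχ
  · rintro rfl
    simp at hφe
  · rintro rfl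
    simp at hψw
  · rw [hχ']
    module

theorem isCovered_of_form_of_pair_ne [Infinite k] {α β φ ψ : (Fin n → k) →ₗ[k] k}
    {w e : Fin n → k} (hμ : ∀ x y, μ x y = α x • y + β y • x + (φ x * φ y) • w)
    (hφw : φ w = 0) (hφe : φ e = 1) (hψw : ψ w = 1) (hψe : ψ e = 0)
    (h0 : (α w, β w) ≠ 0) : IsCovered μ := by
  let h : k → (Fin n → k) →ₗ[k] (Fin n → k) := fun t => ψ.smulRight (w + t • e) +
    (t ^ 3 • φ).smulRight e + t • (LinearMap.id - φ.smulRight e - ψ.smulRight w)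
  have hh : ∀ t x, h t x = ψ x • (w + t • e) + (t ^ 3 * φ x) • e +
    t • (x - φ x • e - ψ x • w) := fun t x => rfl
  have hφh : ∀ t x, φ (h t x) = t * (ψ x + t ^ 2 * φ x) := fun t x => by
    simp [hh, hφw, hφe]
    ring
  have hψh : ∀ t x, ψ (h t x) = ψ x := fun t x => by simp [hh, hψw, hψe]
  have hhw : ∀ t, h t (t ^ 2 • w - e) = t ^ 2 • w := fun t => by
    rw [map_sub, map_smul, hh, hh]
    simp only [hψw, hψe, hφw, hφe]
    module
  have hid := PolyCurve.id (k := k)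
  obtain ⟨χ, hχ, hχ'⟩ := exists_degenerates_of_family (μ := μ) h
    (fun t x y => α (h t x) • y + β (h t y) • x +
      ((ψ x + t ^ 2 * φ x) * (ψ y + t ^ 2 * φ y)) • (t ^ 2 • w - e))
    (fun x y => by
      have hc := PolyCurve.const (k := k) (V := Fin n → k)
      have hck := PolyCurve.const (k := k) (V := k)
      have h1 : ∀ x, PolyCurve fun t => h t x := fun x =>
        (((hc _).add (hid.smul' (hc _))).map (LinearMap.lsmul k (Fin n → k) (ψ x)) |>.add
          (((hid.pow 3).mul (hck _)).smul' (hc _))).add (hid.smul' (hc _))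
      have h2 : ∀ x, PolyCurve fun t : k => ψ x + t ^ 2 * φ x := fun x =>
        (hck _).add ((hid.pow 2).mul (hck _))
      exact ((((h1 x).map α).smul' (hc _)).add (((h1 y).map β).smul' (hc _))).add
        (((h2 x).mul (h2 y)).smul' (((hid.pow 2).smul' (hc _)).sub (hc _))))
    (fun t ht => (injective_iff_map_eq_zero _).2 fun x hx => by
      have h1 := hφh t x
      have h2 := hψh t x
      rw [hx, map_zero] at h1 h2
      rw [← h2, zero_add] at h1
      have h3 : φ x = 0 := by simpa [ht] using h1.symm
      simpa [hh, h3, ← h2, ht] using hx)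
    (fun t ht x y => by
      rw [hμ, hφh, hφh, map_add, map_add, map_smul, map_smul, map_smul, hhw]
      module)
  refine IsCovered.of_isGamma (α := α w) (β := β w) (γ := 0) ⟨ψ, -e, ?_, ?_, by simp [hψe],
    fun x y => ?_⟩ (by simpa using h0) hχ
  · rintro rfl
    simp at hψw
  · rw [neg_ne_zero]
    rintro rfl
    simp at hφe
  · rw [hχ', hh, hh]
    simp only [zero_smul, add_zero, map_smul, smul_eq_mul, ne_eq, OfNat.ofNat_ne_zero,
      not_false_eq_true, zero_pow, zero_mul]
    module

theorem isCovered_of_form [Infinite k] {α β φ : (Fin n → k) →ₗ[k] k} {w : Fin n → k}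
    (hμ : ∀ x y, μ x y = α x • y + β y • x + (φ x * φ y) • w) : IsCovered μ := by
  by_cases hφw : φ w ≠ 0
  · exact isCovered_of_form_of_apply_ne hμ hφw
  rw [not_not] at hφw
  by_cases hφ : φ = 0
  · exact isCovered_of_wedge (α := α) (β := β) fun x y => by simp [hμ, hφ]
  by_cases hw : w = 0
  · exact isCovered_of_wedge (α := α) (β := β) fun x y => by simp [hμ, hw]
  by_cases hαβ : α = 0 ∧ β = 0
  · exact .inl (.inr (.inl ⟨φ, w, hφ, hw, hφw, fun x y => by simp [hμ, hαβ]⟩))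
  obtain ⟨e, he, he'⟩ : ∃ e, φ e = 1 ∧ ((α w, β w) ≠ 0 ∨ (α e, β e) ≠ 0) := by
    obtain ⟨e, he⟩ := exists_apply_eq_one hφ
    by_contra hcon
    push Not at hcon
    have h1 : ∀ x, α x = 0 ∧ β x = 0 := fun x => by
      have h2 := (hcon e he).2
      have h3 := (hcon (x + (1 - φ x) • e) (by simp [he])).2
      simp only [Prod.mk_eq_zero] at h2
      simpa [h2] using h3
    exact hαβ ⟨LinearMap.ext fun x => (h1 x).1, LinearMap.ext fun x => (h1 x).2⟩
  obtain ⟨f, hf⟩ := exists_dual_eq_one (k := k) hw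
  by_cases h0 : (α w, β w) = 0
  · rw [Prod.mk_eq_zero] at h0
    exact isCovered_of_form_of_apply_zero (ψ := f - f e • φ) (e := e) hμ hφw he (by simp [hf, hφw])
      (by simp [he]) h0.1 h0.2 (he'.resolve_left (by simp [h0]))
  · exact isCovered_of_form_of_pair_ne (ψ := f - f e • φ) (e := e) hμ hφw he (by simp [hf, hφw])
      (by simp [he]) h0

theorem isCovered_of_linearIndependent_sq [IsAlgClosed k] (hn : 3 ≤ n) {x : Fin n → k}
    (hx : LinearIndependent k ![x, μ x x]) : IsCovered μ := by
  by_contra h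
  have := IsAlgClosed.instInfinite (K := k)
  obtain ⟨f, hf⟩ := exists_dual_family hx
  have hθx : f 1 x = 0 := by simpa using hf 1 0
  have hθxx : f 1 (μ x x) = 1 := by simpa using hf 1 1
  have hne : f 1 (μ x x) ≠ 0 := by simp [hθxx]
  obtain ⟨ρ, hρ⟩ := exists_wedge_id (τ := μ - μ.flip) (fun x => by simp) fun θ x y h1 h2 =>
    commutator_of_not_isCovered h hθx hne h1 h2
  have hr : IsRankOne (μ - leftMul ρ) := by
    refine ⟨fun x y => ?_, fun θ x y z h1 h2 h3 => ?_⟩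
    · have := hρ x y
      simp only [LinearMap.sub_apply, LinearMap.flip_apply] at this
      simp only [LinearMap.sub_apply, leftMul_apply]
      rw [sub_eq_iff_eq_add] at this
      rw [this]
      abel
    · simpa [leftMul_apply, h1, h2, h3] using rank_le_one_of_not_isCovered h hθx hne h1 h2 h3
  obtain ⟨α, φ, w, hα⟩ := hr.mul_eq hn hθx (by simp [leftMul_apply, hθx, hθxx])
  refine h (isCovered_of_form (α := α + ρ) (β := α) (φ := φ) (w := w) fun x y => ?_)
  have := hα x y
  rw [LinearMap.sub_apply, LinearMap.sub_apply, leftMul_apply, sub_eq_iff_eq_add] at this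
  rw [this, LinearMap.add_apply]
  module

end Forms

section DimensionTwo

variable {μ : AlgStr k 2}

theorem exists_cubic_root [IsAlgClosed k] {a : k} (ha : a ≠ 0) (b c d : k) :
    ∃ t : k, a * t ^ 3 + b * t ^ 2 + c * t + d = 0 := by
  obtain ⟨t, ht⟩ := IsAlgClosed.exists_root
    (Polynomial.C a * Polynomial.X ^ 3 + Polynomial.C b * Polynomial.X ^ 2 +
      Polynomial.C c * Polynomial.X + Polynomial.C d)
    (by rw [Polynomial.degree_cubic ha]; decide)
  exact ⟨t, by simpa [Polynomial.IsRoot] using ht⟩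

/-- A basis of the plane with given first vector, together with its dual basis. -/
theorem exists_basis_pair {f : Fin 2 → k} (hf : f ≠ 0) :
    ∃ (y : Fin 2 → k) (φ ψ : (Fin 2 → k) →ₗ[k] k), φ f = 1 ∧ φ y = 0 ∧ ψ f = 0 ∧ ψ y = 1 ∧
      ∀ x, x = φ x • f + ψ x • y := by
  obtain ⟨φ, hφ⟩ := exists_dual_eq_one (k := k) hf
  obtain ⟨y, hy0, hy⟩ := exists_ne_zero_forall_apply_eq_zero ![φ] (by omega)
  have hφy : φ y = 0 := by simpa using hy 0
  obtain ⟨g, hg⟩ := exists_dual_eq_one (k := k) hy0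
  obtain ⟨ψ, hψ⟩ : ∃ ψ : (Fin 2 → k) →ₗ[k] k, ψ = g - g f • φ := ⟨_, rfl⟩
  have hψf : ψ f = 0 := by simp [hψ, hφ]
  have hψy : ψ y = 1 := by simp [hψ, hg, hφy]
  refine ⟨y, φ, ψ, hφ, hφy, hψf, hψy, fun x => ?_⟩
  by_contra hne
  have hz : x - φ x • f - ψ x • y ≠ 0 := by
    rwa [sub_sub, sub_ne_zero]
  have hli : LinearIndependent k ![φ, ψ] :=
    linearIndependent_pair_of_apply_ne (x := f) (y := y) (by simp [hφ, hφy, hψf, hψy])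
  have hz' : LinearIndependent k ![x - φ x • f - ψ x • y] := by
    rw [linearIndependent_unique_iff]
    exact hz
  have := add_le_of_pairing_eq_zero hli hz' fun i j => by
    fin_cases i <;> fin_cases j <;> simp [hφ, hφy, hψf, hψy]
  omega

theorem exists_mul_self_eq_smul [IsAlgClosed k] (μ : AlgStr k 2) :
    ∃ (f : Fin 2 → k) (a : k), f ≠ 0 ∧ μ f f = a • f := by
  have hp : (Pi.single 0 1 : Fin 2 → k) ≠ 0 := by simp
  obtain ⟨y, φ, ψ, h1, h2, h3, h4, hx⟩ := exists_basis_pair hp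
  generalize (Pi.single 0 1 : Fin 2 → k) = p at *
  by_cases hD : ψ (μ p p) = 0
  · refine ⟨p, φ (μ p p), hp, ?_⟩
    conv_lhs => rw [hx (μ p p), hD, zero_smul, add_zero]
  · obtain ⟨t, ht⟩ := exists_cubic_root hD (ψ (μ p y) + ψ (μ y p) - φ (μ p p))
      (ψ (μ y y) - φ (μ p y) - φ (μ y p)) (-φ (μ y y))
    refine ⟨t • p + y, ψ (μ (t • p + y) (t • p + y)), fun h => ?_, ?_⟩
    · simpa [h3, h4] using congr_arg ψ h
    · have h5 : φ (μ (t • p + y) (t • p + y)) = t * ψ (μ (t • p + y) (t • p + y)) := by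
        simp only [map_add, map_smul, LinearMap.add_apply, LinearMap.smul_apply, smul_eq_mul]
        linear_combination -ht
      conv_lhs => rw [hx (μ (t • p + y) (t • p + y)), h5]
      module

theorem isCovered_of_mul_self [Infinite k] {φ ψ : (Fin 2 → k) →ₗ[k] k} {f y : Fin 2 → k} {a : k}
    (hφf : φ f = 1) (hψf : ψ f = 0)
    (hx : ∀ x, x = φ x • f + ψ x • y) (hff : μ f f = a • f)
    (h : a - ψ (μ f y) - ψ (μ y f) ≠ 0) : IsCovered μ := by
  obtain ⟨χ, hχ, hχ'⟩ := exists_degenerates_IW μ hφf hff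
  have hf0 : f ≠ 0 := by
    rintro rfl
    simp at hφf
  refine IsCovered.of_isGamma (α := ψ (μ f y)) (β := ψ (μ y f))
    (γ := a - ψ (μ f y) - ψ (μ y f)) ⟨φ, (a - ψ (μ f y) - ψ (μ y f)) • f, ?_, smul_ne_zero h hf0,
      by simp [hφf], fun u v => ?_⟩ (by simp [h]) hχ
  · rintro rfl
    simp at hφf
  · have e1 : ∀ v, v - φ v • f = ψ v • y := fun v => by
      rw [sub_eq_iff_eq_add, add_comm]
      exact hx v
    have e2 : ∀ v, μ f (v - φ v • f) - φ (μ f (v - φ v • f)) • f = (ψ v * ψ (μ f y)) • y :=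
      fun v => by rw [e1 (μ f _), e1 v, map_smul, map_smul, smul_eq_mul]
    have e3 : ∀ v, μ (v - φ v • f) f - φ (μ (v - φ v • f) f) • f = (ψ v * ψ (μ y f)) • y :=
      fun v => by rw [e1 (μ _ f), e1 v, map_smul, LinearMap.smul_apply, map_smul, smul_eq_mul]
    rw [hχ', e2, e3]
    have e4 : ∀ v (c : k), c • v = (c * φ v) • f + (c * ψ v) • y := fun v c => by
      conv_lhs => rw [hx v]
      module
    rw [e4 v, e4 u]
    module

theorem isCovered_two [IsAlgClosed k] (μ : AlgStr k 2) : IsCovered μ := by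
  have := IsAlgClosed.instInfinite (K := k)
  obtain ⟨f, a, hf, hff⟩ := exists_mul_self_eq_smul μ
  obtain ⟨y, φ, ψ, hφf, hφy, hψf, hψy, hx⟩ := exists_basis_pair hf
  by_cases h1 : a - ψ (μ f y) - ψ (μ y f) = 0
  swap
  · exact isCovered_of_mul_self hφf hψf hx hff h1
  by_cases h2 : ψ (μ y y) - φ (μ f y) - φ (μ y f) = 0
  · refine isCovered_of_form (α := ψ (μ f y) • φ + φ (μ y f) • ψ)
      (β := ψ (μ y f) • φ + φ (μ f y) • ψ) (φ := ψ) (w := φ (μ y y) • f) fun u v => ?_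
    have e1 : μ u v = μ (φ u • f + ψ u • y) (φ v • f + ψ v • y) := by rw [← hx u, ← hx v]
    have e2 : ∀ v (c : k), c • v = (c * φ v) • f + (c * ψ v) • y := fun v c => by
      conv_lhs => rw [hx v]
      module
    have e3 : a = ψ (μ f y) + ψ (μ y f) := by linear_combination h1
    have e4 : ψ (μ y y) = φ (μ f y) + φ (μ y f) := by linear_combination h2
    rw [e1]
    simp only [map_add, map_smul, LinearMap.add_apply, LinearMap.smul_apply, hff, smul_eq_mul]
    rw [e2 v, e2 u, e2 (μ f y), e2 (μ y f), e2 (μ y y), e4, e3]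
    simp only [smul_add, smul_smul, mul_add, add_mul, add_smul]
    module
  · obtain ⟨t, ht⟩ : ∃ t, t = ψ (μ y y) - φ (μ f y) - φ (μ y f) := ⟨_, rfl⟩
    obtain ⟨p, hp⟩ : ∃ p, p = φ (μ y y) := ⟨_, rfl⟩
    have ht0 : t ≠ 0 := ht ▸ h2
    have e3 : a = ψ (μ f y) + ψ (μ y f) := by linear_combination h1
    have e5 : ∀ v, v = (t⁻¹ * ψ v) • (p • f + t • y) + (φ v - p * t⁻¹ * ψ v) • f := fun v => by
      conv_lhs => rw [hx v]
      match_scalars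
      · ring
      · field_simp
    refine isCovered_of_mul_self (φ := t⁻¹ • ψ) (ψ := φ - (p * t⁻¹) • ψ) (f := p • f + t • y)
      (y := f) (a := p * a + t * ψ (μ y y)) ?_ ?_ (fun v => e5 v) ?_ ?_
    · simp [hψf, hψy, ht0]
    · simp [hψf, hψy, hφf, hφy, ht0]
    · have e6 : ψ (μ y y) = t + φ (μ f y) + φ (μ y f) := by linear_combination -ht
      simp only [map_add, map_smul, LinearMap.add_apply, LinearMap.smul_apply, hff]
      rw [hx (μ f y), hx (μ y f), hx (μ y y), ← hp, e6, e3]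
      simp only [map_add, map_smul, hφf, hφy, hψf, hψy, smul_eq_mul]
      module
    · have : p * a + t * ψ (μ y y) - (φ - (p * t⁻¹) • ψ) (μ f (p • f + t • y)) -
          (φ - (p * t⁻¹) • ψ) (μ (p • f + t • y) f) = t * t := by
        simp only [map_add, map_smul, LinearMap.add_apply, LinearMap.smul_apply,
          LinearMap.sub_apply, hff, hφf, hψf, smul_eq_mul]
        field_simp
        linear_combination (-t * p) * h1 - t ^ 2 * ht
      rw [sub_right_comm, this]
      exact mul_ne_zero ht0 ht0

end DimensionTwo

section RankOnePerturbation

variable {W Q : Type*} [AddCommGroup W] [Module k W] [AddCommGroup Q] [Module k Q]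

theorem mem_span_of_not_linearIndependent_cons {r : ℕ} {v : Fin r → W} {x : W}
    (hv : LinearIndependent k v) (h : ¬ LinearIndependent k (Fin.cons x v : Fin (r + 1) → W)) :
    x ∈ Submodule.span k (Set.range v) := by
  by_contra hx
  exact h (linearIndependent_finCons.2 ⟨hv, hx⟩)

theorem linearIndependent_cons_of_map {r : ℕ} {v : Fin r → W} {x : W} (f : W →ₗ[k] Q) (hx : x ≠ 0)
    (hfx : f x = 0) (hv : LinearIndependent k fun i => f (v i)) :
    LinearIndependent k (Fin.cons x v : Fin (r + 1) → W) := by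
  refine linearIndependent_finCons.2 ⟨hv.of_comp _, fun hmem => hx ?_⟩
  obtain ⟨c, hc⟩ := (Submodule.mem_span_range_iff_exists_fun k).1 hmem
  have h0 : ∑ i, c i • f (v i) = 0 := by
    simp only [← map_smul, ← map_sum, hc, hfx]
  have h1 := Fintype.linearIndependent_iff.1 hv c h0
  rw [← hc]
  simp [h1]

theorem exists_eq_smul_of_forall_ne {T π : W →ₗ[k] Q} {z₁ z₂ : W}
    (hz : LinearIndependent k ![π z₁, π z₂]) (h : ∀ u, π u ≠ 0 → ∃ c : k, T u = c • π u) :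
    ∃ β : k, ∀ u, T u = β • π u := by
  have hz₁ : π z₁ ≠ 0 := hz.ne_zero 0
  have hz₂ : π z₂ ≠ 0 := hz.ne_zero 1
  have key : ∀ {u z : W} {c d : k}, LinearIndependent k ![π z, π u] → T u = c • π u →
      T z = d • π z → c = d := by
    intro u z c d hli hc hd
    obtain ⟨e, he⟩ := h (z + u) (by
      rw [map_add]
      intro h0
      have := LinearIndependent.pair_iff.1 hli 1 1 (by simpa using h0)
      simp at this)
    have h1 := LinearIndependent.pair_iff.1 hli (d - e) (c - e) (by
      rw [map_add, map_add, hc, hd] at he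
      rw [show (d - e) • π z + (c - e) • π u = (d • π z + c • π u) - e • (π z + π u) by module, he,
        sub_self])
    linear_combination h1.2 - h1.1
  obtain ⟨β, hβ⟩ := h z₁ hz₁
  obtain ⟨β', hβ'⟩ := h z₂ hz₂
  obtain rfl := key hz hβ' hβ
  refine ⟨β', fun u => ?_⟩
  by_cases hu : π u = 0
  · obtain ⟨c, hc⟩ := h (u + z₁) (by simpa [hu] using hz₁)
    have hcβ : c = β' := by
      refine key (u := u + z₁) (z := z₂) ?_ hc hβ'
      rw [map_add, hu, zero_add]
      exact LinearIndependent.pair_symm_iff.1 hz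
    rw [hu, smul_zero]
    rw [map_add, map_add, hu, zero_add, hβ, hcβ] at hc
    simpa using hc
  · obtain ⟨c, hc⟩ := h u hu
    by_cases h1 : LinearIndependent k ![π z₁, π u]
    · rw [hc, key h1 hc hβ]
    · have h2 : LinearIndependent k ![π z₂, π u] := by
        rw [LinearIndependent.pair_iff' hz₁] at h1
        push Not at h1
        obtain ⟨a, ha⟩ := h1
        rw [LinearIndependent.pair_iff' hz₂]
        intro b hb
        have h3 := LinearIndependent.pair_iff.1 hz a (-b) (by rw [ha, neg_smul, hb]; simp)
        exact hu (by rw [← ha, h3.1, zero_smul])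
      rw [hc, key h2 hc hβ']

/-- For every vector `v` which is not an eigenvector of `M`, the vectors `v` and `Mv` span an
invariant subspace modulo which `M` is scalar. -/
def IsScalarModulo (M : W →ₗ[k] W) : Prop :=
  ∀ v, LinearIndependent k ![v, M v] → M (M v) ∈ Submodule.span k {v, M v} ∧
    ∃ β : k, ∀ u, M u - β • u ∈ Submodule.span k {v, M v}

theorem isScalarModulo_of_quadruple [FiniteDimensional k W] {M : W →ₗ[k] W}
    (hd : 4 ≤ Module.finrank k W) (h : ∀ u v, ¬ LinearIndependent k ![M u, u, v, M v]) :
    IsScalarModulo M := by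
  intro v hv
  set Y := Submodule.span k {v, M v} with hY
  have hvY : v ∈ Y := Submodule.subset_span (by simp)
  have hMvY : M v ∈ Y := Submodule.subset_span (by simp)
  have hYr : Submodule.span k (Set.range ![v, M v]) = Y := by
    rw [Matrix.range_cons, Matrix.range_cons, Matrix.range_empty, Set.union_empty,
      Set.singleton_union]
  have hYd : Module.finrank k Y = 2 := by
    rw [← hYr, finrank_span_eq_card hv, Fintype.card_fin]
  have hq : 2 ≤ Module.finrank k (W ⧸ Y) := by
    have := Submodule.finrank_quotient_add_finrank Y
    omega
  obtain ⟨b, hb⟩ := exists_linearIndependent_of_le_finrank hq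
  obtain ⟨z₁, hz₁⟩ := Y.mkQ_surjective (b 0)
  obtain ⟨z₂, hz₂⟩ := Y.mkQ_surjective (b 1)
  obtain ⟨β, hβ⟩ := exists_eq_smul_of_forall_ne (T := Y.mkQ ∘ₗ M) (π := Y.mkQ) (z₁ := z₁)
    (z₂ := z₂) (by
      rw [hz₁, hz₂, show ![b 0, b 1] = b by funext i; fin_cases i <;> rfl]
      exact hb) fun u hu => by
    have hu' : u ∉ Y := fun h' => hu (by simpa using h')
    have hli : LinearIndependent k ![u, v, M v] :=
      linearIndependent_finCons.2 ⟨hv, by rwa [hYr]⟩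
    have := mem_span_of_not_linearIndependent_cons hli (h u v)
    rw [Matrix.range_cons, Set.singleton_union, Submodule.mem_span_insert, hYr] at this
    obtain ⟨c, w, hw, hc⟩ := this
    refine ⟨c, ?_⟩
    have hw' : Y.mkQ w = 0 := (Submodule.Quotient.mk_eq_zero Y).2 hw
    rw [LinearMap.comp_apply, hc, map_add, map_smul, hw', add_zero]
  have hmem : ∀ u, M u - β • u ∈ Y := fun u => by
    rw [← Submodule.Quotient.mk_eq_zero Y]
    have := hβ u
    rw [LinearMap.comp_apply, ← sub_eq_zero, ← map_smul, ← map_sub] at this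
    exact this
  refine ⟨?_, β, hmem⟩
  have := Y.add_mem (hmem (M v)) (Y.smul_mem β hMvY)
  rwa [sub_add_cancel] at this

theorem isScalarModulo_of_triple [FiniteDimensional k W] {M : W →ₗ[k] W}
    (hd : Module.finrank k W = 3) (h : ∀ v, ¬ LinearIndependent k ![M (M v), v, M v]) :
    IsScalarModulo M := by
  intro v hv
  set Y := Submodule.span k {v, M v} with hY
  have hvY : v ∈ Y := Submodule.subset_span (by simp)
  have hMvY : M v ∈ Y := Submodule.subset_span (by simp)
  have hYr : Submodule.span k (Set.range ![v, M v]) = Y := by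
    rw [Matrix.range_cons, Matrix.range_cons, Matrix.range_empty, Set.union_empty,
      Set.singleton_union]
  have hYd : Module.finrank k Y = 2 := by
    rw [← hYr, finrank_span_eq_card hv, Fintype.card_fin]
  have hq : Module.finrank k (W ⧸ Y) = 1 := by
    have := Submodule.finrank_quotient_add_finrank Y
    omega
  have hMM : M (M v) ∈ Y := by
    rw [← hYr]
    exact mem_span_of_not_linearIndependent_cons hv (h v)
  have hinv : ∀ y ∈ Y, M y ∈ Y := by
    intro y hy
    obtain ⟨a, b, rfl⟩ := Submodule.mem_span_pair.1 hy
    rw [map_add, map_smul, map_smul]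
    exact Y.add_mem (Y.smul_mem a hMvY) (Y.smul_mem b hMM)
  obtain ⟨b, hb⟩ := exists_linearIndependent_of_le_finrank hq.ge
  obtain ⟨z, hz⟩ := Y.mkQ_surjective (b 0)
  have hz0 : Y.mkQ z ≠ 0 := by
    rw [hz]
    exact hb.ne_zero 0
  have hspan := (finrank_eq_one_iff_of_nonzero' _ hz0).1 hq
  obtain ⟨β, hβ⟩ := hspan (Y.mkQ (M z))
  refine ⟨hMM, β, fun u => ?_⟩
  obtain ⟨c, hc⟩ := hspan (Y.mkQ u)
  have h1 : M z - β • z ∈ Y := by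
    rw [← Submodule.Quotient.mk_eq_zero Y]
    change Y.mkQ (M z - β • z) = 0
    rw [map_sub, map_smul, hβ, sub_self]
  have h2 : u - c • z ∈ Y := by
    rw [← Submodule.Quotient.mk_eq_zero Y]
    change Y.mkQ (u - c • z) = 0
    rw [map_sub, map_smul, hc, sub_self]
  have h3 := Y.add_mem (Y.sub_mem (hinv _ h2) (Y.smul_mem β h2)) (Y.smul_mem c h1)
  rw [map_sub, map_smul] at h3
  rwa [show M u - c • M z - β • (u - c • z) + c • (M z - β • z) = M u - β • u by module] at h3

theorem IsScalarModulo.exists_eq [FiniteDimensional k W] {M : W →ₗ[k] W} (h : IsScalarModulo M)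
    (hd : 3 ≤ Module.finrank k W) :
    ∃ (β : k) (ψ : W →ₗ[k] k) (p : W), ∀ y, M y = β • y + ψ y • p := by
  by_cases hv : ∃ v, LinearIndependent k ![v, M v]
  swap
  · push Not at hv
    obtain ⟨c, hc⟩ := exists_scalar_of_forall ⊤ M fun u _ => by
      by_cases hu : u = 0
      · exact ⟨0, by simp [hu]⟩
      · have := hv u
        rw [LinearIndependent.pair_iff' hu] at this
        push Not at this
        obtain ⟨a, ha⟩ := this
        exact ⟨a, ha.symm⟩
    exact ⟨c, 0, 0, fun y => by simpa using hc y trivial⟩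
  obtain ⟨v, hv⟩ := hv
  obtain ⟨-, β, hβ⟩ := h v hv
  set Y := Submodule.span k {v, M v} with hY
  have hYr : Submodule.span k (Set.range ![v, M v]) = Y := by
    rw [Matrix.range_cons, Matrix.range_cons, Matrix.range_empty, Set.union_empty,
      Set.singleton_union]
  have hvY : v ∈ Y := Submodule.subset_span (by simp)
  obtain ⟨z, hz⟩ : ∃ z, z ∉ Y := by
    by_contra hcon
    push Not at hcon
    have h1 : Module.finrank k Y = 2 := by
      rw [← hYr, finrank_span_eq_card hv, Fintype.card_fin]
    rw [(Submodule.eq_top_iff').2 hcon, finrank_top] at h1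
    omega
  have hv' := LinearIndependent.pair_iff.1 hv
  have hv0 : v ≠ 0 := hv.ne_zero 0
  obtain ⟨N, hN⟩ : ∃ N : W →ₗ[k] W, ∀ u, N u = M u - β • u := ⟨M - β • LinearMap.id, fun _ => rfl⟩
  have hNM : ∀ u, M u = β • u + N u := fun u => by rw [hN]; module
  have hNY : ∀ u, N u ∈ Y := fun u => by rw [hN]; exact hβ u
  have hNv : ∀ c : k, N v ≠ c • v := by
    intro c hc
    have := hv' (-β - c) 1 (by
      rw [hNM, hc]
      module)
    simp at this
  have hcyc : ∀ u, u ∉ Y → ∃ c : k, N (N u) = c • N u := by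
    intro u hu
    by_cases hNu : N u = 0
    · exact ⟨0, by simp [hNu]⟩
    have hli : LinearIndependent k ![u, M u] := by
      rw [LinearIndependent.pair_iff]
      intro s t hst
      rw [hNM] at hst
      have h1 : (s + t * β) • u ∈ Y := by
        rw [show (s + t * β) • u = (s • u + t • (β • u + N u)) - t • N u by module, hst]
        exact Y.sub_mem Y.zero_mem (Y.smul_mem t (hNY u))
      have h2 : s + t * β = 0 := by
        by_contra h0
        exact hu ((Y.smul_mem_iff h0).1 h1)
      have h3 : t • N u = 0 := by
        rw [show t • N u = (s • u + t • (β • u + N u)) - (s + t * β) • u by module, hst, h2]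
        simp
      have h4 : t = 0 := (smul_eq_zero.1 h3).resolve_right hNu
      subst h4
      exact ⟨by simpa using h2, rfl⟩
    obtain ⟨a, b, hab⟩ := Submodule.mem_span_pair.1 (h u hli).1
    have h1 : N (N u) = (a + (b - β) * β) • u + (b - β - β) • N u := by
      have : M (M u) = β • (β • u + N u) + (β • N u + N (N u)) := by
        rw [hNM (M u), hNM u, map_add, map_smul]
      rw [this, hNM] at hab
      rw [show N (N u) = (β • (β • u + N u) + (β • N u + N (N u))) - β • (β • u + N u) - β • N u by
        module, ← hab]
      module
    have h2 : (a + (b - β) * β) • u ∈ Y := by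
      rw [show (a + (b - β) * β) • u = N (N u) - (b - β - β) • N u by rw [h1]; module]
      exact Y.sub_mem (hNY _) (Y.smul_mem _ (hNY _))
    have h3 : a + (b - β) * β = 0 := by
      by_contra h0
      exact hu ((Y.smul_mem_iff h0).1 h2)
    exact ⟨b - β - β, by rw [h1, h3, zero_smul, zero_add]⟩
  have hline : ∀ u, u ∉ Y → ∃ c : k, N u = c • N v := by
    intro u hu
    obtain ⟨a', b, hab⟩ := Submodule.mem_span_pair.1 (hNY u)
    obtain ⟨a, ha⟩ : ∃ a, a = a' + b * β := ⟨_, rfl⟩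
    have hNu : N u = a • v + b • N v := by
      rw [← hab, hNM, ha]
      module
    by_cases ha0 : a = 0
    · exact ⟨b, by rw [hNu, ha0, zero_smul, zero_add]⟩
    obtain ⟨c, hc⟩ := hcyc (u - b • v) fun h' => hu (by
      have := Y.add_mem h' (Y.smul_mem b hvY)
      rwa [sub_add_cancel] at this)
    have h1 : N (u - b • v) = a • v := by
      rw [map_sub, map_smul, hNu]
      module
    rw [h1, map_smul, smul_comm c a] at hc
    exact absurd (smul_right_injective W ha0 hc) (hNv c)
  have hall : ∀ u, ∃ c : k, N u = c • N v := by
    intro u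
    by_cases hu : u ∈ Y
    · obtain ⟨c, hc⟩ := hline z hz
      obtain ⟨d, hd'⟩ := hline (u + z) fun h' => hz (by
        have := Y.sub_mem h' hu
        rwa [add_sub_cancel_left] at this)
      refine ⟨d - c, ?_⟩
      rw [sub_smul, ← hc, ← hd', map_add, add_sub_cancel_right]
    · exact hline u hu
  obtain ⟨f, hf⟩ := exists_dual_eq_one (k := k) (v := N v) fun h0 => hNv 0 (by simp [h0])
  refine ⟨β, f ∘ₗ N, N v, fun y => ?_⟩
  obtain ⟨c, hc⟩ := hall y
  rw [hNM, LinearMap.comp_apply, hc, map_smul, hf, smul_eq_mul, mul_one]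

theorem exists_eq_of_finrank_two [IsAlgClosed k] [FiniteDimensional k W] (M : W →ₗ[k] W)
    (hd : Module.finrank k W = 2) :
    ∃ (β : k) (ψ : W →ₗ[k] k) (p : W), ∀ y, M y = β • y + ψ y • p := by
  have : Nontrivial W := Module.nontrivial_of_finrank_pos (R := k) (by omega)
  obtain ⟨β, hβ⟩ := Module.End.exists_eigenvalue M
  obtain ⟨e, he⟩ := hβ.exists_hasEigenvector
  have he0 : e ≠ 0 := he.2
  have hq : Module.finrank k (W ⧸ (k ∙ e)) = 1 := by
    have := Submodule.finrank_quotient_add_finrank (k ∙ e)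
    rw [finrank_span_singleton he0] at this
    omega
  obtain ⟨b, hb⟩ := exists_linearIndependent_of_le_finrank hq.ge
  obtain ⟨z, hz⟩ := (k ∙ e).mkQ_surjective (b 0)
  have hz0 : (k ∙ e).mkQ z ≠ 0 := by
    rw [hz]
    exact hb.ne_zero 0
  obtain ⟨f, hf⟩ := exists_dual_eq_one (k := k) hz0
  refine ⟨β, f ∘ₗ (k ∙ e).mkQ, M z - β • z, fun y => ?_⟩
  obtain ⟨c, hc⟩ := (finrank_eq_one_iff_of_nonzero' _ hz0).1 hq ((k ∙ e).mkQ y)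
  have h2 : y - c • z ∈ (k ∙ e) := by
    rw [← Submodule.Quotient.mk_eq_zero]
    change (k ∙ e).mkQ (y - c • z) = 0
    rw [map_sub, map_smul, hc, sub_self]
  obtain ⟨d, hd'⟩ := Submodule.mem_span_singleton.1 h2
  have hy : y = d • e + c • z := by rw [hd']; module
  rw [LinearMap.comp_apply, ← hc, map_smul, hf, smul_eq_mul, mul_one]
  have hMe : M e = β • e := he.apply_eq_smul
  conv_lhs => rw [hy, map_add, map_smul, map_smul, hMe]
  conv_rhs => rw [hy]
  module

end RankOnePerturbation

section Alternating

variable {n : ℕ} {μ τ : AlgStr k n} {φ : (Fin n → k) →ₗ[k] k}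

theorem exists_apply_self_eq_smul [Infinite k] (h : ∀ x, ¬ LinearIndependent k ![x, μ x x]) :
    ∃ φ : (Fin n → k) →ₗ[k] k, ∀ x, μ x x = φ x • x := by
  have h1 : ∀ x, ∃ c : k, μ x x = c • x ∧ (x = 0 → c = 0) := by
    intro x
    by_cases hx : x = 0
    · exact ⟨0, by simp [hx], fun _ => rfl⟩
    · have := h x
      rw [LinearIndependent.pair_iff' hx] at this
      push Not at this
      obtain ⟨a, ha⟩ := this
      exact ⟨a, ha.symm, fun h => absurd h hx⟩
  choose c hc hc0 using h1
  have hsmul : ∀ (a : k) x, c (a • x) = a * c x := by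
    intro a x
    by_cases ha : a = 0
    · simp [ha, hc0]
    by_cases hx : x = 0
    · simp [hx, hc0]
    have h2 := hc (a • x)
    rw [map_smul, map_smul, LinearMap.smul_apply, hc, smul_smul, smul_smul, smul_smul] at h2
    have h3 := smul_left_injective k hx h2
    refine mul_left_cancel₀ ha ?_
    linear_combination -h3
  refine ⟨{ toFun := c, map_add' := fun x y => ?_, map_smul' := hsmul }, hc⟩
  by_cases hx : x = 0
  · simp [hx, hc0]
  by_cases hxy : LinearIndependent k ![x, y]
  · have hS : ∀ t : k, t • (μ x y + μ y x) =
        (c (x + t • y) - c x) • x + (t * c (x + t • y) - t * t * c y) • y := by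
      intro t
      have := hc (x + t • y)
      simp only [map_add, map_smul, LinearMap.add_apply, LinearMap.smul_apply, hc x, hc y] at this
      rw [show t • (μ x y + μ y x) = (c x • x + t • μ y x + t • (μ x y + t • c y • y)) - c x • x -
        (t * t * c y) • y by module, this]
      module
    obtain ⟨t, ht0, ht1⟩ := ((eventually_cofinite_ne (0 : k)).and (eventually_cofinite_ne 1)).exists
    have e1 := hS 1
    have et := hS t
    rw [one_smul] at e1
    rw [e1] at et
    have h3 := LinearIndependent.pair_iff.1 hxy
      (t * (c (x + (1 : k) • y) - c x) - (c (x + t • y) - c x))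
      (t * (1 * c (x + (1 : k) • y) - 1 * 1 * c y) - (t * c (x + t • y) - t * t * c y)) (by
        rw [← sub_eq_zero] at et
        rw [← et]
        module)
    rw [one_smul] at h3
    have h4 : t * (t - 1) ≠ 0 := mul_ne_zero ht0 (sub_ne_zero.2 ht1)
    refine mul_left_cancel₀ h4 ?_
    linear_combination -(h3.2 - t * h3.1)
  · rw [LinearIndependent.pair_iff' hx] at hxy
    push Not at hxy
    obtain ⟨a, rfl⟩ := hxy
    rw [show x + a • x = (1 + a) • x by module, hsmul, hsmul]
    ring

theorem map_comm_of_map_self_eq_zero (ha : ∀ x, τ x x = 0) (x y : Fin n → k) : τ x y = -τ y x := by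
  have := ha (x + y)
  simp only [map_add, LinearMap.add_apply, ha, zero_add, add_zero] at this
  exact eq_neg_of_add_eq_zero_right this

theorem exists_degenerates_isT022 [Infinite k] (ha : ∀ x, τ x x = 0)
    (hμ : ∀ x y, μ x y = φ x • y + τ x y) {x u v : Fin n → k}
    (h : LinearIndependent k ![x, τ x u, u, v, τ x v]) : ∃ χ, degenerates μ χ ∧ IsT022 χ := by
  obtain ⟨f, hf⟩ := exists_dual_family h
  have hp : LinearIndependent k ![x, u, v] := by
    convert h.comp ![0, 2, 3] (by decide) using 1
    ext i
    fin_cases i <;> rfl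
  have hq : LinearIndependent k ![τ x u, τ x v] := by
    convert h.comp ![1, 4] (by decide) using 1
    ext i
    fin_cases i <;> rfl
  obtain ⟨ψ, h1, h2, χ, hχ, h3⟩ := exists_degenerates_span μ (p := ![x, u, v])
    (q := ![τ x u, τ x v]) (θ := ![f 1, f 4]) hp
    (fun i j => by
      have := hf (![1, 4] i) (![1, 4] j)
      fin_cases i <;> fin_cases j <;> simpa using this)
    (fun i j => by
      have := hf (![1, 4] i) (![0, 2, 3] j)
      fin_cases i <;> fin_cases j <;> simpa using this)
  have hf1 := hf 1
  have hf4 := hf 4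
  simp only [Fin.forall_fin_succ, IsEmpty.forall_iff, Fin.isValue, and_true] at hf1 hf4
  simp at hf1 hf4
  obtain ⟨f1x, f1m, f1u, f1v, f1l⟩ := hf1
  obtain ⟨f4x, f4m, f4u, f4v, f4l⟩ := hf4
  refine ⟨χ, hχ, ψ 0 - f 1 (τ u v) • ψ 2 + f 4 (τ u v) • ψ 1, ψ 1, ψ 2, τ x u, τ x v, ?_, hq, ?_⟩
  · rw [Fintype.linearIndependent_iff]
    intro g hg
    have hx := LinearMap.congr_fun hg x
    have hu := LinearMap.congr_fun hg u
    have hv := LinearMap.congr_fun hg v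
    have h10 : ∀ i, ψ i x = if i = 0 then 1 else 0 := fun i => h1 i 0
    have h11 : ∀ i, ψ i u = if i = 1 then 1 else 0 := fun i => h1 i 1
    have h12 : ∀ i, ψ i v = if i = 2 then 1 else 0 := fun i => h1 i 2
    simp [Fin.sum_univ_three, h10, h11, h12] at hx hu hv
    rw [hx] at hu hv
    intro i
    fin_cases i
    · exact hx
    · simpa using hu
    · simpa using hv
  · have h20 := fun i => h2 i 0
    have h21 := fun i => h2 i 1
    simp only [Matrix.cons_val] at h20 h21
    refine ⟨by simp [h20], by simp [h21], h20 1, h21 1, h20 2, h21 2, fun y z => ?_⟩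
    rw [h3]
    simp only [Fin.sum_univ_two, Fin.sum_univ_three, Matrix.cons_val, hμ, map_add, map_smul,
      LinearMap.add_apply, LinearMap.smul_apply, smul_eq_mul, f1x, f1u, f1v, f4x, f4u, f4v, ha,
      map_comm_of_map_self_eq_zero ha u x, map_comm_of_map_self_eq_zero ha v x,
      map_comm_of_map_self_eq_zero ha v u, map_neg, f1m, f1l, f4m, f4l, map_zero, neg_zero,
      LinearMap.sub_apply]
    module

theorem exists_degenerates_isT03 [Infinite k] {μ τ : AlgStr k 4} {φ : (Fin 4 → k) →ₗ[k] k}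
    (ha : ∀ x, τ x x = 0) (hμ : ∀ x y, μ x y = φ x • y + τ x y) {x v : Fin 4 → k}
    (h : LinearIndependent k ![x, v, τ x v, τ x (τ x v)]) : ∃ χ, degenerates μ χ ∧ IsT03 χ := by
  obtain ⟨b, hb⟩ : ∃ b : Module.Basis (Fin 4) k (Fin 4 → k), ⇑b = ![x, v, τ x v, τ x (τ x v)] :=
    ⟨basisOfLinearIndependentOfCardEqFinrank h (by simp), by simp⟩
  obtain ⟨f, hf⟩ : ∃ f : Fin 4 → (Fin 4 → k) →ₗ[k] k, ∀ i, f i = b.coord i := ⟨_, fun _ => rfl⟩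
  have hfb : ∀ i j, f i (b j) = if i = j then 1 else 0 := fun i j => by
    rw [hf, Module.Basis.coord_apply, b.repr_self, Finsupp.single_apply]
    simp only [eq_comm]
  have hsum : ∀ y, y = f 0 y • b 0 + f 1 y • b 1 + f 2 y • b 2 + f 3 y • b 3 := fun y => by
    conv_lhs => rw [← b.sum_repr y]
    simp only [Fin.sum_univ_four, hf, Module.Basis.coord_apply]
  have m2 : τ (b 0) (b 1) = b 2 := by simp [hb]
  have m3 : τ (b 0) (b 2) = b 3 := by simp [hb]
  obtain ⟨H, hH⟩ : ∃ H : k → (Fin 4 → k) →ₗ[k] (Fin 4 → k), ∀ t y, H t y =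
      (t * f 0 y) • b 0 + (t ^ 2 * f 1 y) • b 1 + (t ^ 3 * f 2 y) • b 2 + (t ^ 4 * f 3 y) • b 3 :=
    ⟨fun t => t • (f 0).smulRight (b 0) + t ^ 2 • (f 1).smulRight (b 1) +
      t ^ 3 • (f 2).smulRight (b 2) + t ^ 4 • (f 3).smulRight (b 3),
      fun t y => by simp [smul_smul]⟩
  obtain ⟨G, hG⟩ : ∃ G : k → (Fin 4 → k) →ₗ[k] (Fin 4 → k), ∀ t y, G t y =
      (t ^ 4 * f 0 y) • b 0 + (t ^ 3 * f 1 y) • b 1 + (t ^ 2 * f 2 y) • b 2 + (t * f 3 y) • b 3 :=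
    ⟨fun t => t ^ 4 • (f 0).smulRight (b 0) + t ^ 3 • (f 1).smulRight (b 1) +
      t ^ 2 • (f 2).smulRight (b 2) + t • (f 3).smulRight (b 3),
      fun t y => by simp [smul_smul]⟩
  have hHG : ∀ t y, H t (G t y) = t ^ 5 • y := fun t y => by
    conv_rhs => rw [hsum y]
    simp only [hH, hG, map_add, map_smul, hfb, smul_eq_mul]
    simp
    module
  have hGH : ∀ t y, G t (H t y) = t ^ 5 • y := fun t y => by
    conv_rhs => rw [hsum y]
    simp only [hH, hG, map_add, map_smul, hfb, smul_eq_mul]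
    simp
    module
  have hid := PolyCurve.id (k := k)
  have hc := PolyCurve.const (k := k) (V := k)
  have hv := PolyCurve.const (k := k) (V := Fin 4 → k)
  have cH : ∀ y, PolyCurve fun t => H t y := fun y => by
    simp only [hH]
    exact ((((hid.mul (hc _)).smul' (hv _)).add (((hid.pow 2).mul (hc _)).smul' (hv _))).add
      (((hid.pow 3).mul (hc _)).smul' (hv _))).add (((hid.pow 4).mul (hc _)).smul' (hv _))
  have cG : ∀ y, PolyCurve fun t => G t y := fun y => by
    simp only [hG]
    exact (((((hid.pow 4).mul (hc _)).smul' (hv _)).add (((hid.pow 3).mul (hc _)).smul' (hv _))).add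
      (((hid.pow 2).mul (hc _)).smul' (hv _))).add ((hid.mul (hc _)).smul' (hv _))
  obtain ⟨χ, hχ, hχ'⟩ := exists_degenerates_of_family (μ := μ) H
    (fun t y z => φ (H t y) • z + (f 0 y * f 1 z - f 0 z * f 1 y) • b 2 +
      (f 0 y * f 2 z - f 0 z * f 2 y) • b 3 +
      (f 0 y * f 3 z - f 0 z * f 3 y) • G t (τ (b 0) (b 3)) +
      (f 1 y * f 2 z - f 1 z * f 2 y) • G t (τ (b 1) (b 2)) +
      (t * (f 1 y * f 3 z - f 1 z * f 3 y)) • G t (τ (b 1) (b 3)) +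
      (t ^ 2 * (f 2 y * f 3 z - f 2 z * f 3 y)) • G t (τ (b 2) (b 3)))
    (fun y z => (((((((((cH y).map φ).smul' (hv z)).add (hv _)).add (hv _)).add
      ((hc _).smul' (cG _))).add ((hc _).smul' (cG _))).add
      ((hid.mul (hc _)).smul' (cG _))).add (((hid.pow 2).mul (hc _)).smul' (cG _))))
    (fun t ht y z hyz => by
      have := congr_arg (G t) hyz
      rw [hGH, hGH] at this
      exact smul_right_injective _ (pow_ne_zero 5 ht) this)
    (fun t _ y z => by
      have hH2 : H t (b 2) = t ^ 3 • b 2 := by simp [hH, hfb]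
      have hH3 : H t (b 3) = t ^ 4 • b 3 := by simp [hH, hfb]
      have hτ : τ (H t y) (H t z) = (t ^ 3 * (f 0 y * f 1 z - f 0 z * f 1 y)) • b 2 +
          (t ^ 4 * (f 0 y * f 2 z - f 0 z * f 2 y)) • b 3 +
          (t ^ 5 * (f 0 y * f 3 z - f 0 z * f 3 y)) • τ (b 0) (b 3) +
          (t ^ 5 * (f 1 y * f 2 z - f 1 z * f 2 y)) • τ (b 1) (b 2) +
          (t ^ 6 * (f 1 y * f 3 z - f 1 z * f 3 y)) • τ (b 1) (b 3) +
          (t ^ 7 * (f 2 y * f 3 z - f 2 z * f 3 y)) • τ (b 2) (b 3) := by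
        rw [hH t y, hH t z]
        simp only [map_add, map_smul, LinearMap.add_apply, LinearMap.smul_apply, ha,
          map_comm_of_map_self_eq_zero ha (b 1) (b 0), map_comm_of_map_self_eq_zero ha (b 2) (b 0),
          map_comm_of_map_self_eq_zero ha (b 3) (b 0), map_comm_of_map_self_eq_zero ha (b 2) (b 1),
          map_comm_of_map_self_eq_zero ha (b 3) (b 1), map_comm_of_map_self_eq_zero ha (b 3) (b 2),
          m2, m3]
        module
      rw [hμ, hτ]
      simp only [map_add, map_smul, hHG, hH2, hH3]
      module)
  refine ⟨χ, hχ, f 0, f 1, f 2, b 2, b 3, ?_, ?_, by simp [hfb], by simp [hfb], by simp [hfb],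
    by simp [hfb], by simp [hfb], by simp [hfb], fun y z => ?_⟩
  · rw [Fintype.linearIndependent_iff]
    intro g hg i
    have := LinearMap.congr_fun hg (b (![0, 1, 2] i))
    fin_cases i <;> simpa [Fin.sum_univ_three, hfb] using this
  · convert b.linearIndependent.comp ![2, 3] (by decide) using 1
    ext i
    fin_cases i <;> rfl
  · rw [hχ']
    simp [hH, hG]

end Alternating

section NonScalar

variable {n : ℕ} {μ τ : AlgStr k n} {φ : (Fin n → k) →ₗ[k] k}

theorem exists_eq_of_semiconj [IsAlgClosed k] (hn : 3 ≤ n) (hc : ¬ IsCovered μ)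
    (ha : ∀ x, τ x x = 0) (hμ : ∀ x y, μ x y = φ x • y + τ x y) {x : Fin n → k} (hx : x ≠ 0)
    {Q : Type*} [AddCommGroup Q] [Module k Q] [FiniteDimensional k Q]
    (hd : Module.finrank k Q + 1 = n) (π : (Fin n → k) →ₗ[k] Q) (hπ : Function.Surjective π)
    (hπx : π x = 0) (M : Q →ₗ[k] Q) (hM : ∀ y, M (π y) = π (τ x y)) :
    ∃ (β : k) (ψ : Q →ₗ[k] k) (p : Q), ∀ y, M y = β • y + ψ y • p := by
  have := IsAlgClosed.instInfinite (K := k)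
  rcases (by omega : n = 3 ∨ n = 4 ∨ 5 ≤ n) with rfl | rfl | h5
  · exact exists_eq_of_finrank_two M (by omega)
  · refine (isScalarModulo_of_triple (M := M) (by omega) fun v hv => hc ?_).exists_eq (by omega)
    obtain ⟨v, rfl⟩ := hπ v
    have h1 := linearIndependent_cons_of_map π hx hπx (v := ![τ x (τ x v), v, τ x v]) (by
      rw [hM, hM] at hv
      convert hv using 1
      ext i
      fin_cases i <;> rfl)
    have h1' := h1.comp ![0, 2, 3, 1] (by decide)
    rw [show (Fin.cons x ![τ x (τ x v), v, τ x v] ∘ ![0, 2, 3, 1] : Fin 4 → Fin 4 → k) =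
      ![x, v, τ x v, τ x (τ x v)] from by funext i; fin_cases i <;> rfl] at h1'
    obtain ⟨χ, hχ, h2⟩ := exists_degenerates_isT03 ha hμ h1'
    exact .inr ⟨χ, .inr (.inr (.inr (.inr (.inl ⟨rfl, h2⟩)))), hχ⟩
  · refine (isScalarModulo_of_quadruple (M := M) (by omega) fun u v hv => hc ?_).exists_eq
      (by omega)
    obtain ⟨u, rfl⟩ := hπ u
    obtain ⟨v, rfl⟩ := hπ v
    have h1 := linearIndependent_cons_of_map π hx hπx (v := ![τ x u, u, v, τ x v]) (by
      rw [hM, hM] at hv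
      convert hv using 1
      ext i
      fin_cases i <;> rfl)
    obtain ⟨χ, hχ, h2⟩ := exists_degenerates_isT022 ha hμ h1
    exact .inr ⟨χ, .inr (.inr (.inr (.inr (.inr (.inl h2))))), hχ⟩

theorem exists_eq_add_of_not_isCovered [IsAlgClosed k] (hn : 3 ≤ n) (hc : ¬ IsCovered μ)
    (ha : ∀ x, τ x x = 0) (hμ : ∀ x y, μ x y = φ x • y + τ x y) (x : Fin n → k) :
    ∃ (β : k) (ψ : (Fin n → k) →ₗ[k] k) (p : Fin n → k), ψ x = 0 ∧
      ∀ y, ∃ r : k, τ x y = β • y + ψ y • p + r • x := by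
  by_cases hx : x = 0
  · exact ⟨0, 0, 0, by simp, fun y => ⟨0, by simp [hx]⟩⟩
  have hker : ∀ y, y ∈ (k ∙ x) ↔ (k ∙ x).mkQ y = 0 := fun y =>
    (Submodule.Quotient.mk_eq_zero _).symm
  have hx' := (hker x).1 (Submodule.mem_span_singleton_self x)
  have hle : (k ∙ x) ≤ (k ∙ x).comap (τ x) := by
    rw [Submodule.span_le, Set.singleton_subset_iff]
    simp [ha]
  have hd := Submodule.finrank_quotient_add_finrank (k ∙ x)
  rw [finrank_span_singleton hx, Module.finrank_fin_fun] at hd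
  have hM : ∀ y, (k ∙ x).mapQ (k ∙ x) (τ x) hle ((k ∙ x).mkQ y) = (k ∙ x).mkQ (τ x y) :=
    fun y => rfl
  obtain ⟨β, ψ, p, h⟩ := exists_eq_of_semiconj hn hc ha hμ hx hd _ (k ∙ x).mkQ_surjective hx' _ hM
  obtain ⟨p, rfl⟩ := (k ∙ x).mkQ_surjective p
  refine ⟨β, ψ ∘ₗ (k ∙ x).mkQ, p, by rw [LinearMap.comp_apply, hx', map_zero], fun y => ?_⟩
  have h1 : τ x y - (β • y + ψ ((k ∙ x).mkQ y) • p) ∈ (k ∙ x) := by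
    rw [hker, map_sub, ← hM, h, map_add, map_smul, map_smul, sub_self]
  obtain ⟨r, hr⟩ := Submodule.mem_span_singleton.1 h1
  exact ⟨r, by rw [hr, LinearMap.comp_apply]; module⟩

/-- A vector `x` is nonscalar for `τ` if the multiplication by `x` does not act as a scalar modulo
the line spanned by `x`. -/
def IsNonscalar (τ : AlgStr k n) (x : Fin n → k) : Prop :=
  ∃ (θ : (Fin n → k) →ₗ[k] k) (y : Fin n → k), θ x = 0 ∧ θ y = 0 ∧ θ (τ x y) ≠ 0

theorem IsNonscalar.exists_eq [IsAlgClosed k] (hn : 3 ≤ n) (hc : ¬ IsCovered μ)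
    (ha : ∀ x, τ x x = 0) (hμ : ∀ x y, μ x y = φ x • y + τ x y) {x : Fin n → k}
    (hx : IsNonscalar τ x) : φ x = 0 ∧ ∃ (ψ : (Fin n → k) →ₗ[k] k) (p : Fin n → k), ψ x = 0 ∧
      ψ p = 0 ∧ ∀ y, ∃ r : k, τ x y = ψ y • p + r • x := by
  have := IsAlgClosed.instInfinite (K := k)
  obtain ⟨θ, y, hθx, hθy, hθ⟩ := hx
  have hx0 : x ≠ 0 := by
    rintro rfl
    simp at hθ
  obtain ⟨β, ψ, p, hψx, h⟩ := exists_eq_add_of_not_isCovered hn hc ha hμ x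
  choose r hr using h
  rw [hr] at hθ
  simp only [map_add, map_smul, smul_eq_mul, hθx, hθy, mul_zero, zero_add, add_zero] at hθ
  obtain ⟨ξ, hξ⟩ := exists_dual_eq_one (k := k) hx0
  obtain ⟨χ, hχ, hχ'⟩ := exists_degenerates_IW μ (φ := ξ) hξ (a := φ x) (by rw [hμ, ha, add_zero])
  have hT : IsT (φ x + β) (-β) (ψ p) χ := by
    refine ⟨ξ, ψ, p - ξ p • x, linearIndependent_pair_of_apply_ne (x := x) (y := y) ?_, ?_, ?_, ?_,
      fun a b => ?_⟩
    · simpa [hξ, hψx] using left_ne_zero_of_mul hθ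
    · intro h0
      apply right_ne_zero_of_mul hθ
      rw [sub_eq_zero.1 h0, map_smul, hθx, smul_zero]
    · simp [hξ]
    · simp [hψx]
    · rw [hχ']
      simp only [hμ, map_add, map_sub, map_smul, LinearMap.sub_apply, LinearMap.smul_apply, ha,
        map_comm_of_map_self_eq_zero ha a x, hr, map_neg, smul_eq_mul, hξ, hψx,
        map_zero]
      module
  have h0 : (φ x + β, -β, ψ p) = 0 := by
    by_contra h0
    exact hc (.inr ⟨χ, .inr (.inr (.inr (.inl ⟨hn, _, _, _, h0, hT⟩))), hχ⟩)
  simp only [Prod.mk_eq_zero, neg_eq_zero] at h0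
  obtain ⟨h1, rfl, h2⟩ := h0
  exact ⟨by simpa using h1, ψ, p, hψx, h2, fun y => ⟨r y, by rw [hr]; module⟩⟩

theorem IsNonscalar.dense [Infinite k] (ha : ∀ x, τ x x = 0) {x₀ : Fin n → k}
    (hx₀ : IsNonscalar τ x₀) {g : (Fin n → k) → k}
    (hg : ∀ u v, PolyCurve fun s : k => g (u + s • v)) (h : ∀ x, IsNonscalar τ x → g x = 0)
    (x : Fin n → k) : g x = 0 := by
  obtain ⟨θ, y, hθx, hθy, hθ⟩ := hx₀
  have hli : LinearIndependent k ![x₀, y] := by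
    rw [LinearIndependent.pair_iff' (by rintro rfl; simp at hθ)]
    rintro a rfl
    simp [ha] at hθ
  obtain ⟨ξ, hξ⟩ := exists_dual_family hli
  have hξx : ξ 0 x₀ = 1 := by simpa using hξ 0 0
  have hξy : ξ 0 y = 0 := by simpa using hξ 0 1
  have cX : PolyCurve fun s : k => x₀ + s • (x - x₀) :=
    (PolyCurve.const _).add (PolyCurve.const _).smul
  have cG := (((cX.map (ξ 0)).mul ((cX.bilin (PolyCurve.const y) τ).map θ)).sub
    ((cX.map θ).mul ((cX.bilin (PolyCurve.const y) τ).map (ξ 0))))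
  have hev := cG.eventually_ne (s := 0) (by simpa [hξx, hθx] using hθ)
  have := (hg x₀ (x - x₀)).eq_zero_of_eventually (hev.mono fun s hs => h _
    ⟨ξ 0 (x₀ + s • (x - x₀)) • θ - θ (x₀ + s • (x - x₀)) • ξ 0, y, ?_, ?_, ?_⟩) 1
  · simpa using this
  · simp only [LinearMap.sub_apply, LinearMap.smul_apply, smul_eq_mul]
    ring
  · simp [hθy, hξy]
  · simpa only [LinearMap.sub_apply, LinearMap.smul_apply, smul_eq_mul] using hs

theorem exists_map_map_eq_smul [IsAlgClosed k] (hn : 3 ≤ n) (hc : ¬ IsCovered μ)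
    (ha : ∀ x, τ x x = 0) (hμ : ∀ x y, μ x y = φ x • y + τ x y) {x₀ : Fin n → k}
    (hx₀ : IsNonscalar τ x₀) (x y : Fin n → k) : ∃ r : k, τ x (τ x y) = r • x := by
  have := IsAlgClosed.instInfinite (K := k)
  refine exists_smul_of_forall_dual fun f hf => ?_
  by_cases hx : x = 0
  · simp [hx]
  obtain ⟨ξ, hξ⟩ := exists_dual_eq_one (k := k) hx
  have := hx₀.dense ha (g := fun x => f x * ξ (τ x (τ x y)) - ξ x * f (τ x (τ x y))) (fun u v => by
    have cX : PolyCurve fun s : k => u + s • v := (PolyCurve.const _).add (PolyCurve.const _).smul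
    have cT := cX.bilin (cX.bilin (PolyCurve.const y) τ) τ
    exact ((cX.map f).mul (cT.map ξ)).sub ((cX.map ξ).mul (cT.map f))) (fun x hx => by
    obtain ⟨-, ψ, p, hψx, hψp, h⟩ := hx.exists_eq hn hc ha hμ
    choose r hr using h
    simp only [hr, map_add, map_smul, hψx, hψp, smul_eq_mul]
    ring) x
  simpa [hf, hξ] using this

theorem exists_map_eq_add [IsAlgClosed k] (hn : 3 ≤ n) (hc : ¬ IsCovered μ)
    (ha : ∀ x, τ x x = 0) (hμ : ∀ x y, μ x y = φ x • y + τ x y) {x₀ : Fin n → k}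
    (hx₀ : IsNonscalar τ x₀) {x y : Fin n → k} (hxy : LinearIndependent k ![x, τ x y])
    (z : Fin n → k) : ∃ d e : k, τ x z = d • τ x y + e • x := by
  have := IsAlgClosed.instInfinite (K := k)
  obtain ⟨ξ, hξ⟩ := exists_dual_family hxy
  have h00 : ξ 0 x = 1 := by simpa using hξ 0 0
  have h01 : ξ 0 (τ x y) = 0 := by simpa using hξ 0 1
  have h10 : ξ 1 x = 0 := by simpa using hξ 1 0
  have h11 : ξ 1 (τ x y) = 1 := by simpa using hξ 1 1
  refine ⟨ξ 1 (τ x z), ξ 0 (τ x z), eq_of_forall_dual (k := k) fun f => ?_⟩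
  have := hx₀.dense ha (g := fun x =>
    f x * (ξ 0 (τ x y) * ξ 1 (τ x z) - ξ 1 (τ x y) * ξ 0 (τ x z)) -
    ξ 0 x * (f (τ x y) * ξ 1 (τ x z) - ξ 1 (τ x y) * f (τ x z)) +
    ξ 1 x * (f (τ x y) * ξ 0 (τ x z) - ξ 0 (τ x y) * f (τ x z))) (fun u v => by
    have cX : PolyCurve fun s : k => u + s • v := (PolyCurve.const _).add (PolyCurve.const _).smul
    have cy := cX.bilin (PolyCurve.const y) τ
    have cz := cX.bilin (PolyCurve.const z) τ
    exact (((cX.map f).mul (((cy.map (ξ 0)).mul (cz.map (ξ 1))).sub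
      ((cy.map (ξ 1)).mul (cz.map (ξ 0))))).sub ((cX.map (ξ 0)).mul
      (((cy.map f).mul (cz.map (ξ 1))).sub ((cy.map (ξ 1)).mul (cz.map f))))).add
      ((cX.map (ξ 1)).mul (((cy.map f).mul (cz.map (ξ 0))).sub
      ((cy.map (ξ 0)).mul (cz.map f))))) (fun x hx => by
    obtain ⟨-, ψ, p, hψx, hψp, h⟩ := hx.exists_eq hn hc ha hμ
    choose r hr using h
    simp only [hr, map_add, map_smul, smul_eq_mul]
    ring) x
  simp only [h00, h01, h10, h11] at this
  simp only [map_add, map_smul, smul_eq_mul]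
  linear_combination this

end NonScalar

section Form

variable {n : ℕ} {μ τ : AlgStr k n} {φ : (Fin n → k) →ₗ[k] k}

theorem linearIndependent_pair_of_dual_ne {V : Type*} [AddCommGroup V] [Module k V] {u v : V}
    (f g : V →ₗ[k] k) (h : f u * g v - f v * g u ≠ 0) : LinearIndependent k ![u, v] := by
  rw [LinearIndependent.pair_iff]
  intro s t hst
  have hf := congr_arg f hst
  have hg := congr_arg g hst
  simp only [map_add, map_smul, smul_eq_mul, map_zero] at hf hg
  exact ⟨(mul_eq_zero.1 (show s * (f u * g v - f v * g u) = 0 by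
      linear_combination g v * hf - f v * hg)).resolve_right h,
    (mul_eq_zero.1 (show t * (f u * g v - f v * g u) = 0 by
      linear_combination f u * hg - g u * hf)).resolve_right h⟩

theorem isCovered_of_alternating_form [Infinite k] {ω : (Fin n → k) →ₗ[k] (Fin n → k) →ₗ[k] k}
    {p : Fin n → k} (hp : p ≠ 0) (hω : ∀ x, ω x x = 0) (hωp : ∀ x, ω x p = 0)
    (hμ : ∀ x y, μ x y = ω x y • p) : IsCovered μ := by
  by_cases h0 : ω = 0
  · exact .inl (.inl (LinearMap.ext₂ fun x y => by simp [hμ, h0]))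
  have hneg : ∀ x y, ω x y = -ω y x := fun x y => by
    have := hω (x + y)
    simp only [map_add, LinearMap.add_apply, hω] at this
    linear_combination this
  have hpω : ∀ x, ω p x = 0 := fun x => by rw [hneg, hωp, neg_zero]
  obtain ⟨p₁, q₁, ω', h1, hω', hp₁, hq₁, hsp⟩ := exists_alternating_split hω h0
  by_cases h0' : ω' = 0
  · refine .inl (.inr (.inr (.inl ⟨ω.flip q₁, ω p₁, p, linearIndependent_pair_of_apply_ne (x := p₁)
      (y := q₁) (by simp [h1, hω]), hp, hpω q₁, hωp p₁, fun x y => ?_⟩)))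
    rw [hμ, hsp, h0']
    simp
  obtain ⟨p₂, q₂, ω'', h2, hω'', hp₂, hq₂, hsp'⟩ := exists_alternating_split hω' h0'
  have hneg' : ∀ x y, ω' x y = -ω' y x := fun x y => by
    have := hω' (x + y)
    simp only [map_add, LinearMap.add_apply, hω'] at this
    linear_combination this
  have hp₁' : ∀ x, ω' x p₁ = 0 := fun x => by rw [hneg', hp₁, LinearMap.zero_apply, neg_zero]
  have hq₁' : ∀ x, ω' x q₁ = 0 := fun x => by rw [hneg', hq₁, LinearMap.zero_apply, neg_zero]
  have hωp' : ∀ x, ω' x p = 0 := fun x => by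
    have := hsp x p
    rw [hωp, hωp, hpω] at this
    linear_combination -this
  have hpω' : ∀ x, ω' p x = 0 := fun x => by rw [hneg', hωp', neg_zero]
  have h3 : ω q₁ p₁ = -1 := by rw [hneg, h1]
  have h4 : ω' q₂ p₂ = -1 := by rw [hneg', h2]
  have hp₁'' : ω'' p₁ = 0 := LinearMap.ext fun x => by
    have := hsp' p₁ x
    rw [hp₁, hp₁'] at this
    simpa using this.symm
  have hq₁'' : ω'' q₁ = 0 := LinearMap.ext fun x => by
    have := hsp' q₁ x
    rw [hq₁, hq₁'] at this
    simpa using this.symm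
  obtain ⟨f, hf⟩ : ∃ f : Fin 4 → (Fin n → k) →ₗ[k] k,
    f = ![ω.flip q₁, ω p₁, ω'.flip q₂, ω' p₂] := ⟨_, rfl⟩
  obtain ⟨v, hv⟩ : ∃ v : Fin 4 → Fin n → k, v = ![p₁, q₁, p₂ - ω p₂ q₁ • p₁ - ω p₁ p₂ • q₁,
    q₂ - ω q₂ q₁ • p₁ - ω p₁ q₂ • q₁] := ⟨_, rfl⟩
  have hfv : ∀ i j, f i (v j) = if i = j then 1 else 0 := fun i j => by
    rw [hf, hv]
    fin_cases i <;> fin_cases j <;>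
      simp [h1, h2, hω, hω', hp₁, hq₁, hp₁', hq₁']
  have hfp : ∀ i, f i p = 0 := fun i => by
    rw [hf]
    fin_cases i <;> simp [hωp, hpω, hωp', hpω']
  have hv'' : ∀ i, ω'' (v i) = 0 := fun i => by
    rw [hv]
    fin_cases i <;> simp [hp₁'', hq₁'', hp₂, hq₂]
  have hform : ∀ x y, ω x y = f 0 x * f 1 y - f 0 y * f 1 x + (f 2 x * f 3 y - f 2 y * f 3 x) +
      ω'' x y := fun x y => by
    rw [hsp, hsp', hf]
    simp
    ring
  obtain ⟨ξ, hξ⟩ := exists_dual_eq_one (k := k) hp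
  have hdual : ∀ g : Fin 4 → (Fin n → k) →ₗ[k] k,
      (∀ i j, g i (v j) = if i = j then 1 else 0) → LinearIndependent k g := fun g hg => by
    rw [Fintype.linearIndependent_iff]
    intro c hc i
    simpa [hg] using LinearMap.congr_fun hc (v i)
  have hli : LinearIndependent k v := by
    rw [Fintype.linearIndependent_iff]
    intro c hc i
    simpa [hfv] using congr_arg (f i) hc
  obtain ⟨ψ, hψv, hψp, χ, hχ, hχ'⟩ := exists_degenerates_span μ (q := ![p])
    (θ := ![ξ - ∑ i, ξ (v i) • f i]) hli (by simp [hfp, hξ]) (by simp [hfv])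
  refine .inr ⟨χ, .inr (.inr (.inr (.inr (.inr (.inr
    ⟨ψ, p, hdual ψ hψv, hp, fun i => hψp i 0, fun x y => ?_⟩))))), hχ⟩
  rw [hχ', hμ, hform]
  simp [hfv, hv'', hfp, hξ]

/-- The structure of an alternating algebra that has a nonscalar vector and is not covered. -/
theorem exists_form_of_not_isCovered [IsAlgClosed k] (hn : 3 ≤ n) (hc : ¬ IsCovered μ)
    (ha : ∀ x, τ x x = 0) (hμ : ∀ x y, μ x y = φ x • y + τ x y) {x : Fin n → k}
    (hx : IsNonscalar τ x) : ∃ (ω : (Fin n → k) →ₗ[k] (Fin n → k) →ₗ[k] k) (p : Fin n → k),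
      p ≠ 0 ∧ (∀ x, ω x x = 0) ∧ (∀ x, ω x p = 0) ∧ ∀ x y, τ x y = ω x y • p := by
  have hneg := map_comm_of_map_self_eq_zero ha
  have C1 := exists_map_map_eq_smul hn hc ha hμ hx
  have C2 := fun {u v} => exists_map_eq_add hn hc ha hμ hx (x := u) (y := v)
  obtain ⟨θ, y, hθx, hθy, hθ⟩ := hx
  have hxy : LinearIndependent k ![x, y] := by
    rw [LinearIndependent.pair_iff' (by rintro rfl; simp at hθ)]
    rintro r rfl
    simp [ha] at hθ
  have hli : LinearIndependent k ![x, y, τ x y] := by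
    rw [Fintype.linearIndependent_iff]
    intro g hg
    simp only [Fin.sum_univ_three, Matrix.cons_val] at hg
    have h2 : g 2 = 0 := by
      have := congr_arg θ hg
      simpa [hθx, hθy, hθ] using this
    rw [h2, zero_smul, add_zero] at hg
    obtain ⟨h0, h1⟩ := LinearIndependent.pair_iff.1 hxy _ _ hg
    intro i
    fin_cases i <;> assumption
  obtain ⟨ξ, hξ⟩ := exists_dual_family hli
  obtain ⟨p, hp⟩ : ∃ p, p = τ x y := ⟨_, rfl⟩
  have hyx : τ y x = -p := by rw [hneg, hp]
  simp only [← hp] at hξ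
  have hξx : ∀ i, ξ i x = if i = 0 then 1 else 0 := fun i => hξ i 0
  have hξy : ∀ i, ξ i y = if i = 1 then 1 else 0 := fun i => hξ i 1
  have hξp : ∀ i, ξ i p = if i = 2 then 1 else 0 := fun i => hξ i 2
  have hp0 : p ≠ 0 := by
    rintro rfl
    simpa using hξp 2
  obtain ⟨a, hA⟩ : ∃ a : (Fin n → k) →ₗ[k] k, ∀ z, a z = ξ 2 (τ x z) :=
    ⟨ξ 2 ∘ₗ τ x, fun _ => rfl⟩
  obtain ⟨b, hB⟩ : ∃ b : (Fin n → k) →ₗ[k] k, ∀ z, b z = ξ 0 (τ x z) :=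
    ⟨ξ 0 ∘ₗ τ x, fun _ => rfl⟩
  obtain ⟨c, hC⟩ : ∃ c : (Fin n → k) →ₗ[k] k, ∀ z, c z = ξ 2 (τ y z) :=
    ⟨ξ 2 ∘ₗ τ y, fun _ => rfl⟩
  have hx1 : ∀ z, τ x z = a z • p + b z • x := fun z => by
    obtain ⟨d, e, h⟩ := C2 (u := x) (v := y)
      (linearIndependent_pair_of_dual_ne (ξ 0) (ξ 2) (by simp [← hp, hξx, hξp])) z
    rw [hA, hB, h, ← hp]
    simp [hξx, hξp]
  have hy1 : ∀ z, τ y z = c z • p + b z • y := fun z => by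
    obtain ⟨d, e, h⟩ := C2 (u := y) (v := x)
      (linearIndependent_pair_of_dual_ne (ξ 1) (ξ 2) (by simp [hyx, hξy, hξp])) z
    have hs : τ (x + y) y = p := by rw [map_add, LinearMap.add_apply, ha, add_zero, hp]
    obtain ⟨d', e', h'⟩ := C2 (u := x + y) (v := y)
      (linearIndependent_pair_of_dual_ne (ξ 0) (ξ 2) (by rw [hs]; simp [hξx, hξy, hξp])) z
    rw [hs, map_add, LinearMap.add_apply, h, hx1, hyx] at h'
    have h0 := congr_arg (ξ 0) h'
    have h1 := congr_arg (ξ 1) h'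
    simp [hξx, hξy, hξp] at h0 h1
    rw [hC, h, hyx, h0, ← h1]
    simp [hξy, hξp]
  have hxp : τ x p = 0 := by
    obtain ⟨r, hr⟩ := C1 x y
    obtain ⟨s, hs⟩ := C1 p x
    rw [← hp] at hr
    rw [hneg p x, hr, map_neg, map_smul, hneg p x, hr] at hs
    have := congr_arg (ξ 0) hs
    simp [hξx, hξp] at this
    rw [hr, this, zero_smul]
  have hap : a p = 0 := by rw [hA, hxp, map_zero]
  have hcp : c p = 0 := by
    obtain ⟨r, hr⟩ := C1 y x
    rw [hyx, map_neg] at hr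
    have := congr_arg (ξ 2) hr
    rw [map_neg, ← hC] at this
    simpa [hξy] using this
  have hax : a x = 0 := by rw [hA, ha, map_zero]
  have hay : a y = 1 := by rw [hA, ← hp, hξp, if_pos rfl]
  have hcx : c x = -1 := by rw [hC, hyx, map_neg, hξp, if_pos rfl]
  have hcy : c y = 0 := by rw [hC, ha, map_zero]
  have hb : ∀ z, b z = 0 := fun z => by
    by_contra hbz
    obtain ⟨w, hw⟩ : ∃ w, w = z - a z • y + c z • x := ⟨_, rfl⟩
    have hwx : τ w x = -(b z • x) := by
      rw [hneg, hw, map_add, map_sub, map_smul, map_smul, ← hp, ha, hx1]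
      module
    have hwy : τ w y = -(b z • y) := by
      rw [hneg, hw, map_add, map_sub, map_smul, map_smul, hyx, ha, hy1]
      module
    obtain ⟨r, hr⟩ := C1 w x
    obtain ⟨s, hs⟩ := C1 w y
    rw [hwx, map_neg, map_smul, hwx] at hr
    rw [hwy, map_neg, map_smul, hwy] at hs
    have h1 : (s * b z ^ 2) • x = (r * b z ^ 2) • y := by
      rw [show (s * b z ^ 2) • x = s • -(b z • -(b z • x)) by module, hr,
        show (r * b z ^ 2) • y = r • -(b z • -(b z • y)) by module, hs, smul_comm]
    have h2 := congr_arg (ξ 0) h1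
    simp [hξx, hξy, hbz] at h2
    rw [h2, zero_smul] at hs
    have h3 := congr_arg (ξ 1) hs
    simp [hξy, hbz] at h3
  simp only [hb, zero_smul, add_zero] at hx1 hy1
  have hz : ∀ z w, a z = 0 → c z = 0 → a w = 0 → c w = 0 → ∃ d, τ z w = d • p :=
    fun z w haz hcz haw hcw => by
      have hs : τ (x + z) y = p := by
        rw [map_add, LinearMap.add_apply, hneg z y, hy1, hcz, ← hp]
        simp
      have hs' : τ (y + z) x = -p := by
        rw [map_add, LinearMap.add_apply, hneg z x, hx1, haz, hyx]
        simp
      obtain ⟨d, e, h⟩ := C2 (u := x + z) (v := y) (linearIndependent_pair_of_dual_ne c (ξ 2)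
        (by rw [hs]; simp [hcx, hcz, hcp, hξp])) w
      obtain ⟨d', e', h'⟩ := C2 (u := y + z) (v := x) (linearIndependent_pair_of_dual_ne a (ξ 2)
        (by rw [hs']; simp [hay, haz, hap, hξp])) w
      rw [hs, map_add, LinearMap.add_apply, hx1, haw, zero_smul, zero_add] at h
      rw [hs', map_add, LinearMap.add_apply, hy1, hcw, zero_smul, zero_add, h] at h'
      have h0 := congr_arg c h'
      simp [hcp, hcx, hcy, hcz] at h0
      exact ⟨d, by rw [h, h0, zero_smul, add_zero]⟩
  have hall : ∀ u v, ∃ d, τ u v = d • p := fun u v => by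
    obtain ⟨π, hπ⟩ : ∃ π : (Fin n → k) → Fin n → k, ∀ u, π u = u - a u • y + c u • x :=
      ⟨_, fun _ => rfl⟩
    have hπa : ∀ u, a (π u) = 0 := fun u => by simp [hπ, hay, hax]
    have hπc : ∀ u, c (π u) = 0 := fun u => by simp [hπ, hcy, hcx]
    obtain ⟨d, hd⟩ := hz (π u) (π v) (hπa u) (hπc u) (hπa v) (hπc v)
    have h1 : τ (π u) x = 0 := by rw [hneg, hx1, hπa, zero_smul, neg_zero]
    have h2 : τ (π u) y = 0 := by rw [hneg, hy1, hπc, zero_smul, neg_zero]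
    have h3 : τ (π u) v = d • p := by
      rw [← hd, hπ v, map_add, map_sub, map_smul, map_smul, h1, h2]
      simp
    refine ⟨d + a u * c v - c u * a v, ?_⟩
    rw [show u = π u + a u • y - c u • x by rw [hπ]; module, map_sub, map_add, map_smul, map_smul,
      LinearMap.sub_apply, LinearMap.add_apply, LinearMap.smul_apply, LinearMap.smul_apply, h3,
      hx1, hy1]
    simp only [map_sub, map_add, map_smul, hπa, hπc, hay, hax, hcy, hcx, smul_eq_mul]
    module
  obtain ⟨ω, hω⟩ : ∃ ω : (Fin n → k) →ₗ[k] (Fin n → k) →ₗ[k] k, ∀ u v, ω u v = ξ 2 (τ u v) :=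
    ⟨τ.compr₂ (ξ 2), fun _ _ => rfl⟩
  have hτ : ∀ u v, τ u v = ω u v • p := fun u v => by
    obtain ⟨d, hd⟩ := hall u v
    rw [hω, hd, map_smul, hξp]
    simp
  refine ⟨ω, p, hp0, fun u => by rw [hω, ha, map_zero], fun u => ?_, hτ⟩
  by_contra h0
  obtain ⟨r, hr⟩ := C1 u p
  have h1 := congr_arg (fun w => τ w p) hr
  simp only [hτ u p, map_smul, LinearMap.smul_apply, ha, smul_zero] at h1
  have h2 : r = 0 := by
    by_contra hr0
    exact smul_ne_zero hr0 (smul_ne_zero h0 hp0) h1.symm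
  rw [hτ u p, map_smul, hτ u p, h2, zero_smul] at hr
  exact smul_ne_zero h0 (smul_ne_zero h0 hp0) hr

theorem isCovered_of_three_le [IsAlgClosed k] (hn : 3 ≤ n) (μ : AlgStr k n) : IsCovered μ := by
  have := IsAlgClosed.instInfinite (K := k)
  by_contra hc
  obtain ⟨φ, hφ⟩ := exists_apply_self_eq_smul (μ := μ)
    fun x hx => hc (isCovered_of_linearIndependent_sq hn hx)
  obtain ⟨τ, hτ⟩ : ∃ τ : AlgStr k n, ∀ x y, τ x y = μ x y - φ x • y :=
    ⟨μ - leftMul φ, fun _ _ => rfl⟩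
  have ha : ∀ x, τ x x = 0 := fun x => by rw [hτ, hφ, sub_self]
  have hμ : ∀ x y, μ x y = φ x • y + τ x y := fun x y => by rw [hτ, add_sub_cancel]
  by_cases h : ∃ x, IsNonscalar τ x
  · obtain ⟨x, hx⟩ := h
    have hφ0 : ∀ x, φ x = 0 := hx.dense ha (g := φ)
      (fun u v => ((PolyCurve.const _).add (PolyCurve.const _).smul).map φ)
      fun x hx => (hx.exists_eq hn hc ha hμ).1
    obtain ⟨ω, p, hp, hω, hωp, h⟩ := exists_form_of_not_isCovered hn hc ha hμ hx
    exact hc (isCovered_of_alternating_form hp hω hωp fun x y => by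
      rw [hμ, hφ0, zero_smul, zero_add, h])
  · obtain ⟨ρ, hρ⟩ := exists_wedge_id ha fun θ x y hx hy => by
      by_contra hxy
      exact h ⟨x, θ, y, hx, hy, hxy⟩
    exact hc (isCovered_of_wedge (α := φ + ρ) (β := -ρ) fun x y => by
      rw [hμ, hρ, LinearMap.add_apply, LinearMap.neg_apply]
      module)

end Form

section LevelTwo

variable {n : ℕ} {μ χ : AlgStr k n}

theorem isListed_two_iff (μ : AlgStr k 2) : IsListed μ ↔
    (∃ α β γ : k, (α, β, γ) ≠ 0 ∧ IsGamma α β γ μ) ∨ IsE4 μ := by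
  refine ⟨?_, fun h => h.imp_right .inl⟩
  rintro (h | h | ⟨α, β, -, h⟩ | ⟨h, -⟩ | ⟨h, -⟩ | h | h)
  · exact .inl h
  · exact .inr h
  · exact absurd h.three_le (by decide)
  · exact absurd h (by decide)
  · exact absurd h (by decide)
  · exact absurd h.five_le (by decide)
  · exact absurd h.five_le (by decide)

theorem exists_isF_iff (hn : 3 ≤ n) : (∃ α β : k, (α, β) ≠ 0 ∧ IsF α β μ) ↔
    ∃ α β : k, (α, β) ≠ (0, 0) ∧ μ ∈ orbit (FabStr n α β) := by
  simp only [isF_iff_mem_orbit hn, Prod.zero_eq_mk]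

variable [IsAlgClosed k]

theorem IsLow.degenerates (h : IsLow μ) (hd : _root_.degenerates μ χ) :
    χ = 0 ∨ χ ∈ orbit μ := by
  have := IsAlgClosed.instInfinite (K := k)
  rcases h with rfl | h | h | ⟨a, b, h⟩
  · by_contra! hχ
    exact not_properlyDegenerates_zero ⟨hd, hχ.2⟩
  · exact (h.degenerates hd).imp_right h.mem_orbit
  · exact (h.degenerates_zero hd).imp_right h.mem_orbit
  · exact (h.degenerates hd).imp_right h.mem_orbit

theorem IsListed.degenerates (hn : 2 ≤ n) (h : IsListed μ) (hd : _root_.degenerates μ χ) :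
    χ ∈ orbit μ ∨ IsLow χ := by
  rcases h with ⟨α, β, γ, h0, h⟩ | h | ⟨α, β, h0, h⟩ | ⟨hn, α, β, δ, h0, h⟩ | ⟨hn, h⟩ | h | h
  · exact (h.degenerates hn h0 hd).imp_left h.mem_orbit
  · exact (h.degenerates hd).imp_left h.mem_orbit
  · exact (h.degenerates h0 hd).imp_left h.mem_orbit
  · by_cases h1 : (α, β) = 0
    · obtain ⟨rfl, rfl⟩ := Prod.mk_eq_zero.1 h1
      exact (h.degenerates_of_ne_zero (by simpa using h0) hd).imp_left h.mem_orbit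
    · exact (h.degenerates hn h1 hd).imp_left h.mem_orbit
  · exact (h.degenerates hn hd).imp_left h.mem_orbit
  · exact (h.degenerates hd).imp_left h.mem_orbit
  · exact (h.degenerates hd).imp_left h.mem_orbit

theorem IsListed.exists_proper (hn : 2 ≤ n) (h : IsListed μ) :
    ∃ χ ≠ 0, properlyDegenerates μ χ := by
  have := IsAlgClosed.instInfinite (K := k)
  rcases h with ⟨α, β, γ, h0, h⟩ | h | ⟨α, β, h0, h⟩ | ⟨hn, α, β, δ, h0, h⟩ | ⟨hn, h⟩ | h | h
  · exact h.exists_proper hn h0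
  · exact h.exists_proper
  · exact h.exists_proper h0
  · exact h.exists_proper hn h0
  · exact h.exists_proper
  · exact h.exists_proper
  · exact h.exists_proper

theorem levelIs_two_iff_isListed (hn : 2 ≤ n) (μ : AlgStr k n) : levelIs μ 2 ↔ IsListed μ := by
  have := IsAlgClosed.instInfinite (K := k)
  refine levelIs_two_iff_of (Low := IsLow) (fun _ _ => IsLow.degenerates)
    (fun _ _ => IsListed.of_mem_orbit) (fun μ => ?_) (fun _ _ => IsListed.degenerates hn)
    (fun _ => IsListed.exists_proper hn) μ
  rcases hn.eq_or_lt with rfl | hn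
  · exact isCovered_two μ
  · exact isCovered_of_three_le hn μ

end LevelTwo

/-! ## STATEMENT 19 -/
theorem stmt19 {k : Type*} [Field k] [IsAlgClosed k] (n : ℕ) (μ : AlgStr k n) :
    (n = 2 → (levelIs μ 2 ↔
      ((∃ α : k, μ ∈ orbit (kA1str n α)) ∨ μ ∈ orbit (kA2str n) ∨
        (∃ α : k, μ ∈ orbit (ktB2str n α)) ∨
        (∃ α β : k, α + β ≠ 1 ∧ μ ∈ orbit (ktD2str n α β)) ∨
        μ ∈ orbit (kE4str n)))) ∧
    (n = 3 → (levelIs μ 2 ↔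
      ((∃ α : k, μ ∈ orbit (kA1str n α)) ∨ μ ∈ orbit (kA2str n) ∨
        (∃ α : k, μ ∈ orbit (ktB2str n α)) ∨
        (∃ α β : k, α + β ≠ 1 ∧ μ ∈ orbit (ktD2str n α β)) ∨
        (∃ α β : k, (α, β) ≠ (0, 0) ∧ μ ∈ orbit (FabStr n α β)) ∨
        (∃ α β : k, (α, β) ≠ (0, 0) ∧ μ ∈ orbit (T02str n α β)) ∨
        (∃ α β : k, μ ∈ orbit (T12str n α β)) ∨
        μ ∈ orbit (kE4str n)))) ∧
    (n = 4 → (levelIs μ 2 ↔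
      ((∃ α : k, μ ∈ orbit (kA1str n α)) ∨ μ ∈ orbit (kA2str n) ∨
        (∃ α : k, μ ∈ orbit (ktB2str n α)) ∨
        (∃ α β : k, α + β ≠ 1 ∧ μ ∈ orbit (ktD2str n α β)) ∨
        (∃ α β : k, (α, β) ≠ (0, 0) ∧ μ ∈ orbit (FabStr n α β)) ∨
        (∃ α β : k, (α, β) ≠ (0, 0) ∧ μ ∈ orbit (T02str n α β)) ∨
        (∃ α β : k, μ ∈ orbit (T12str n α β)) ∨
        μ ∈ orbit (T03str n) ∨ μ ∈ orbit (kE4str n)))) ∧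
    (5 ≤ n → (levelIs μ 2 ↔
      ((∃ α : k, μ ∈ orbit (kA1str n α)) ∨ μ ∈ orbit (kA2str n) ∨
        (∃ α : k, μ ∈ orbit (ktB2str n α)) ∨
        (∃ α β : k, α + β ≠ 1 ∧ μ ∈ orbit (ktD2str n α β)) ∨
        (∃ α β : k, (α, β) ≠ (0, 0) ∧ μ ∈ orbit (FabStr n α β)) ∨
        (∃ α β : k, (α, β) ≠ (0, 0) ∧ μ ∈ orbit (T02str n α β)) ∨
        (∃ α β : k, μ ∈ orbit (T12str n α β)) ∨
        μ ∈ orbit (T022str n) ∨ μ ∈ orbit (kE4str n) ∨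
        μ ∈ orbit (etaStr n 2)))) := by
  refine ⟨?_, ?_, ?_, fun hn => ?_⟩
  · rintro rfl
    rw [levelIs_two_iff_isListed le_rfl, isListed_two_iff, exists_isGamma_iff le_rfl,
      isE4_iff_mem_orbit le_rfl]
    simp only [or_assoc]
  · rintro rfl
    have h5 : ¬ IsT022 μ := fun h => absurd h.five_le (by decide)
    have h5' : ¬ IsEta μ := fun h => absurd h.five_le (by decide)
    rw [levelIs_two_iff_isListed (by decide), IsListed, exists_isGamma_iff (by decide),
      isE4_iff_mem_orbit (by decide), exists_isT_iff le_rfl, exists_isF_iff le_rfl]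
    simp only [h5, h5', le_refl, true_and, or_false,
      show (3 : ℕ) ≠ 4 by decide, false_and]
    have key {a b c d e f g h : Prop} : ((a ∨ b ∨ c ∨ d) ∨ h ∨ e ∨ f ∨ g) ↔
        a ∨ b ∨ c ∨ d ∨ e ∨ f ∨ g ∨ h := by tauto
    exact key
  · rintro rfl
    have h5 : ¬ IsT022 μ := fun h => absurd h.five_le (by decide)
    have h5' : ¬ IsEta μ := fun h => absurd h.five_le (by decide)
    rw [levelIs_two_iff_isListed (by decide), IsListed, exists_isGamma_iff (by decide),
      isE4_iff_mem_orbit (by decide), exists_isT_iff (by decide), exists_isF_iff (by decide),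
      isT03_iff_mem_orbit le_rfl]
    simp only [h5, h5', true_and, or_false, show (3 : ℕ) ≤ 4 by decide]
    have key {a b c d e f g h i : Prop} : ((a ∨ b ∨ c ∨ d) ∨ h ∨ e ∨ (f ∨ g) ∨ i) ↔
        a ∨ b ∨ c ∨ d ∨ e ∨ f ∨ g ∨ i ∨ h := by tauto
    exact key
  · rw [levelIs_two_iff_isListed (by omega), IsListed, exists_isGamma_iff (by omega),
      isE4_iff_mem_orbit (by omega), exists_isT_iff (by omega), exists_isF_iff (by omega),
      isT022_iff_mem_orbit hn, isEta_iff_mem_orbit hn]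
    simp only [show 3 ≤ n by omega, true_and, show n ≠ 4 by omega, false_and, false_or]
    have key {a b c d e f g h i j : Prop} : ((a ∨ b ∨ c ∨ d) ∨ h ∨ e ∨ (f ∨ g) ∨ i ∨ j) ↔
        a ∨ b ∨ c ∨ d ∨ e ∨ f ∨ g ∨ i ∨ h ∨ j := by tauto
    exact key

end
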